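/- Let P be a metric space with exactly 5 points that satisfies the CAT(0) comparison. Then there exist a geodesic metric space X satisfying the CAT(0) comparison and a distance-preserving map from P into X. -/

import Mathlib

/-- The quadruple `(p,q,x,y)` satisfies the CAT(0) (2+2) comparison with respect to the
distance function `d`: there is a model configuration `p', q', x', y'` in the Euclidean
plane realizing the five distances `d x y`, `d p x`, `d p y`, `d q x`, `d q y`, with `p'`
and `q'` on opposite sides of (or on) the line through `x'` and `y'`, such that
`d p q ≤ dist p' z + dist z q'` for every `z` on the segment `[x', y']`. -/
def Cat0Quad {X : Type*} (d : X → X → ℝ) (p q x y : X) : Prop :=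
  ∃ p' q' x' y' : EuclideanSpace ℝ (Fin 2),
    dist x' y' = d x y ∧
    dist p' x' = d p x ∧ dist p' y' = d p y ∧
    dist q' x' = d q x ∧ dist q' y' = d q y ∧
    ((y' 0 - x' 0) * (p' 1 - x' 1) - (y' 1 - x' 1) * (p' 0 - x' 0)) *
      ((y' 0 - x' 0) * (q' 1 - x' 1) - (y' 1 - x' 1) * (q' 0 - x' 0)) ≤ 0 ∧
    ∀ z ∈ segment ℝ x' y', d p q ≤ dist p' z + dist z q'

/-- A metric space satisfies the CAT(0) comparison if every quadruple of its points,
in every labeling, satisfies the CAT(0) (2+2) comparison. -/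
def Cat0Comparison (X : Type*) [MetricSpace X] : Prop :=
  ∀ p q x y : X, Cat0Quad (fun a b => dist a b) p q x y

/-- A metric space is geodesic if any two points `x`, `y` are joined by an isometric
embedding of the interval `[0, dist x y]`. -/
def IsGeodesicSpace (X : Type*) [MetricSpace X] : Prop :=
  ∀ x y : X, ∃ γ : ℝ → X, γ 0 = x ∧ γ (dist x y) = y ∧
    ∀ s ∈ Set.Icc (0 : ℝ) (dist x y), ∀ t ∈ Set.Icc (0 : ℝ) (dist x y),
      dist (γ s) (γ t) = |s - t|

/-- Spaces in which any two points have points dividing the pair in any given ratio and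
satisfying the Bruhat-Tits inequality. -/
def CN (X : Type*) [MetricSpace X] : Prop :=
  ∀ x y : X, ∀ s ∈ Set.Icc (0 : ℝ) 1, ∃ z, ∀ p,
    dist p z ^ 2 ≤ (1 - s) * dist p x ^ 2 + s * dist p y ^ 2 - s * (1 - s) * dist x y ^ 2

theorem CN.isGeodesicSpace {X : Type*} [MetricSpace X] (h : CN X) : IsGeodesicSpace X := by
  intro x y
  have : Nonempty X := ⟨x⟩
  choose! z hz using h x y
  rcases eq_or_ne x y with rfl | hxy
  · refine ⟨fun _ => x, rfl, rfl, ?_⟩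
    intro s hs t ht
    simp only [dist_self, Set.Icc_self, Set.mem_singleton_iff] at *
    simp [hs, ht]
  have hd : 0 < dist x y := dist_pos.2 hxy
  have h1 : ∀ s ∈ Set.Icc (0 : ℝ) 1, dist x (z s) ≤ s * dist x y := by
    intro s hs
    have := hz s hs x
    rw [dist_self] at this
    refine abs_le_of_sq_le_sq' ?_ (mul_nonneg hs.1 hd.le) |>.2
    nlinarith
  have h2 : ∀ s ∈ Set.Icc (0 : ℝ) 1, dist y (z s) ≤ (1 - s) * dist x y := by
    intro s hs
    have := hz s hs y
    rw [dist_self, dist_comm y x] at this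
    refine abs_le_of_sq_le_sq' ?_ (mul_nonneg (by linarith [hs.2]) hd.le) |>.2
    nlinarith
  have h3 : ∀ s ∈ Set.Icc (0 : ℝ) 1, ∀ t ∈ Set.Icc (0 : ℝ) 1, s ≤ t →
      dist (z s) (z t) = (t - s) * dist x y := by
    intro s hs t ht hst
    apply le_antisymm
    · refine abs_le_of_sq_le_sq' ?_ (mul_nonneg (by linarith) hd.le) |>.2
      have a1 := hz t ht (z s)
      have a2 : dist (z s) x ^ 2 ≤ (s * dist x y) ^ 2 := by
        rw [dist_comm]; have := h1 s hs; gcongr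
      have a3 : dist (z s) y ^ 2 ≤ ((1 - s) * dist x y) ^ 2 := by
        rw [dist_comm]; have := h2 s hs; gcongr
      have b2 := mul_le_mul_of_nonneg_left a2 (sub_nonneg.2 ht.2)
      have b3 := mul_le_mul_of_nonneg_left a3 ht.1
      nlinarith
    · have := dist_triangle4 x (z s) (z t) y
      have e1 := h1 s hs
      have e2 := h2 t ht
      rw [dist_comm] at e2
      nlinarith
  have h0 : z 0 = x := by
    have := h1 0 (by simp)
    rw [zero_mul] at this
    exact (dist_le_zero.1 this).symm
  have h1' : z 1 = y := by
    have := h2 1 (by simp)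
    rw [sub_self, zero_mul] at this
    exact (dist_le_zero.1 this).symm
  refine ⟨fun t => z (t / dist x y), by simp [h0], by simp [h1', hd.ne'], ?_⟩
  intro s hs t ht
  have hs' : s / dist x y ∈ Set.Icc (0 : ℝ) 1 :=
    ⟨div_nonneg hs.1 hd.le, (div_le_one hd).2 hs.2⟩
  have ht' : t / dist x y ∈ Set.Icc (0 : ℝ) 1 :=
    ⟨div_nonneg ht.1 hd.le, (div_le_one hd).2 ht.2⟩
  rcases le_total s t with hst | hst
  · rw [h3 _ hs' _ ht' (by gcongr), abs_sub_comm, abs_of_nonneg (sub_nonneg.2 hst)]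
    field_simp
  · rw [dist_comm, h3 _ ht' _ hs' (by gcongr), abs_of_nonneg (sub_nonneg.2 hst)]
    field_simp

/-- The box inequality for all quadruples. -/
def Box {X : Type*} (D : X → X → ℝ) : Prop :=
  ∀ p q x y : X, ∀ t ∈ Set.Icc (0 : ℝ) 1, ∀ s ∈ Set.Icc (0 : ℝ) 1,
    0 ≤ (1 - t) * (1 - s) * D p x + (1 - t) * s * D p y + t * (1 - s) * D q x
      + t * s * D q y - t * (1 - t) * D p q - s * (1 - s) * D x y

theorem CN.box {X : Type*} [MetricSpace X] (h : CN X) : Box fun a b : X => dist a b ^ 2 := by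
  intro p q x y t ht s hs
  obtain ⟨z, hz⟩ := h x y s hs
  have a := mul_le_mul_of_nonneg_left (hz p) (sub_nonneg.2 ht.2)
  have b := mul_le_mul_of_nonneg_left (hz q) ht.1
  have c : dist p q ^ 2 ≤ (dist p z + dist q z) ^ 2 := by
    have := dist_triangle_right p q z
    gcongr
  have c' := mul_le_mul_of_nonneg_left c (mul_nonneg ht.1 (sub_nonneg.2 ht.2))
  nlinarith [sq_nonneg ((1 - t) * dist p z - t * dist q z)]

theorem dist_segment_sq (p x y : EuclideanSpace ℝ (Fin 2)) (s : ℝ) :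
    dist p ((1 - s) • x + s • y) ^ 2 =
      (1 - s) * dist p x ^ 2 + s * dist p y ^ 2 - s * (1 - s) * dist x y ^ 2 := by
  simp only [EuclideanSpace.dist_eq, Fin.sum_univ_two, Real.dist_eq, sq_abs]
  rw [Real.sq_sqrt (by positivity), Real.sq_sqrt (by positivity), Real.sq_sqrt (by positivity),
    Real.sq_sqrt (by positivity)]
  simp
  ring

theorem Cat0Comparison.box {X : Type*} [MetricSpace X] (h : Cat0Comparison X) :
    Box fun a b : X => dist a b ^ 2 := by
  intro p q x y t ht s hs
  obtain ⟨p', q', x', y', e1, e2, e3, e4, e5, -, hz⟩ := h p q x y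
  have := hz ((1 - s) • x' + s • y') ⟨1 - s, s, by linarith [hs.2], hs.1, by ring, rfl⟩
  have a := dist_segment_sq p' x' y' s
  have b := dist_segment_sq q' x' y' s
  rw [dist_comm _ q'] at this
  set A := dist p' ((1 - s) • x' + s • y')
  set B := dist q' ((1 - s) • x' + s • y')
  simp only at *
  rw [e1, e2, e3] at a
  rw [e1, e4, e5] at b
  have c : dist p q ^ 2 ≤ (A + B) ^ 2 := by gcongr
  have c' := mul_le_mul_of_nonneg_left c (mul_nonneg ht.1 (sub_nonneg.2 ht.2))
  have key : 0 ≤ (1 - t) * A ^ 2 + t * B ^ 2 - t * (1 - t) * dist p q ^ 2 := by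
    nlinarith [sq_nonneg ((1 - t) * A - t * B)]
  rw [a, b] at key
  linarith

/-- A planar point with prescribed distances to `(0,0)` and `(d,0)`, up to the sign of the
height. -/
theorem exists_planar_coords {a b d : ℝ} (ha : 0 ≤ a) (hd : 0 ≤ d) (hb : 0 ≤ b)
    (h1 : d ≤ a + b) (h2 : a ≤ d + b) (h3 : b ≤ a + d) :
    ∃ u v : ℝ, 0 ≤ v ∧ u ^ 2 + v ^ 2 = a ^ 2 ∧ (u - d) ^ 2 + v ^ 2 = b ^ 2 := by
  rcases hd.eq_or_lt with rfl | hd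
  · obtain rfl : a = b := by linarith
    exact ⟨0, a, ha, by ring, by ring⟩
  set u := (a ^ 2 + d ^ 2 - b ^ 2) / (2 * d) with hu
  have hud : 2 * d * u = a ^ 2 + d ^ 2 - b ^ 2 := by rw [hu]; field_simp
  have hle : u ^ 2 ≤ a ^ 2 := by
    apply sq_le_sq'
    · have : 0 ≤ 2 * d * (u + a) := by nlinarith
      by_contra! hc
      nlinarith
    · have : 0 ≤ 2 * d * (a - u) := by nlinarith
      by_contra! hc
      nlinarith
  refine ⟨u, √(a ^ 2 - u ^ 2), Real.sqrt_nonneg _, ?_, ?_⟩ <;>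
    rw [Real.sq_sqrt (by linarith)] <;> nlinarith

theorem le_add_of_box {r A B : ℝ} (hr : 0 ≤ r) (hA : 0 ≤ A) (hB : 0 ≤ B)
    (h : ∀ t ∈ Set.Icc (0 : ℝ) 1, t * (1 - t) * r ^ 2 ≤ (1 - t) * A ^ 2 + t * B ^ 2) :
    r ≤ A + B := by
  by_contra! hc
  have hr' : 0 < r := by linarith
  rcases (add_nonneg hA hB).eq_or_lt with h0 | h0
  · have := h (1/2) (by norm_num)
    obtain rfl : A = 0 := by linarith
    obtain rfl : B = 0 := by linarith
    nlinarith
  rcases hA.eq_or_lt with rfl | hA'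
  · have hB' : 0 < B := by linarith
    have := h (1 - B / r) ⟨by rw [sub_nonneg, div_le_one hr']; linarith, by
      have : 0 ≤ B / r := by positivity
      linarith⟩
    have e : B / r * r = B := by field_simp
    set k := B / r
    have hk : 0 < k := by positivity
    have hk1 : k < 1 := by rw [div_lt_one hr']; linarith
    have : k * r ^ 2 ≤ B ^ 2 := by
      by_contra! hc
      nlinarith
    nlinarith
  rcases hB.eq_or_lt with rfl | hB'
  · have := h (A / r) ⟨by positivity, by rw [div_le_one hr']; linarith⟩
    have e : A / r * r = A := by field_simp
    set k := A / r
    have hk : 0 < k := by positivity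
    have hk1 : k < 1 := by rw [div_lt_one hr']; linarith
    have : k * r ^ 2 ≤ A ^ 2 := by
      by_contra! hc
      nlinarith
    nlinarith
  · have := h (A / (A + B)) ⟨by positivity, by rw [div_le_one h0]; linarith⟩
    have e1 : 1 - A / (A + B) = B / (A + B) := by field_simp; ring
    rw [e1] at this
    have e2 : A / (A + B) * (B / (A + B)) * r ^ 2 = A * B * r ^ 2 / (A + B) ^ 2 := by
      field_simp
    have e3 : B / (A + B) * A ^ 2 + A / (A + B) * B ^ 2 = A * B := by field_simp
    rw [e2, e3, div_le_iff₀ (by positivity)] at this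
    have h4 : r ^ 2 ≤ (A + B) ^ 2 := le_of_mul_le_mul_left this (by positivity)
    nlinarith

theorem Box.cat0Comparison {X : Type*} [MetricSpace X] (h : Box fun a b : X => dist a b ^ 2) :
    Cat0Comparison X := by
  intro p q x y
  obtain ⟨u, v, hv, hu1, hu2⟩ := exists_planar_coords (dist_nonneg (x := p) (y := x))
    (dist_nonneg (x := x) (y := y)) (dist_nonneg (x := p) (y := y))
    (dist_triangle_left x y p) (dist_triangle_right p x y |>.trans_eq (add_comm _ _))
    (dist_triangle p x y)
  obtain ⟨u', v', hv', hu1', hu2'⟩ := exists_planar_coords (dist_nonneg (x := q) (y := x))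
    (dist_nonneg (x := x) (y := y)) (dist_nonneg (x := q) (y := y))
    (dist_triangle_left x y q) (dist_triangle_right q x y |>.trans_eq (add_comm _ _))
    (dist_triangle q x y)
  have E1 : dist (!₂[u, v] : EuclideanSpace ℝ (Fin 2)) !₂[0, 0] = dist p x := by
    simp [EuclideanSpace.dist_eq, Real.dist_eq, hu1]
  have E2 : dist (!₂[u, v] : EuclideanSpace ℝ (Fin 2)) !₂[dist x y, 0] = dist p y := by
    simp [EuclideanSpace.dist_eq, Real.dist_eq, hu2]
  have E3 : dist (!₂[u', -v'] : EuclideanSpace ℝ (Fin 2)) !₂[0, 0] = dist q x := by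
    simp [EuclideanSpace.dist_eq, Real.dist_eq, hu1']
  have E4 : dist (!₂[u', -v'] : EuclideanSpace ℝ (Fin 2)) !₂[dist x y, 0] = dist q y := by
    simp [EuclideanSpace.dist_eq, Real.dist_eq, hu2']
  have E0 : dist (!₂[0, 0] : EuclideanSpace ℝ (Fin 2)) !₂[dist x y, 0] = dist x y := by
    simp [EuclideanSpace.dist_eq, Real.dist_eq]
  refine ⟨!₂[u, v], !₂[u', -v'], !₂[0, 0], !₂[dist x y, 0], E0, E1, E2, E3, E4, ?_, ?_⟩
  · simp
    have := mul_nonneg (mul_nonneg hv hv')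
      (mul_nonneg (dist_nonneg (x := x) (y := y)) (dist_nonneg (x := x) (y := y)))
    nlinarith
  · rintro z ⟨s', s, hs', hs, hss, rfl⟩
    obtain rfl : s' = 1 - s := by linarith
    refine le_add_of_box dist_nonneg dist_nonneg dist_nonneg ?_
    intro t ht
    rw [dist_comm _ !₂[u', -v'], dist_segment_sq, dist_segment_sq, E0, E1, E2, E3, E4]
    have := h p q x y t ht s ⟨hs, by linarith⟩
    simp only at *
    linarith

theorem CN.of_innerProductSpace (E : Type*) [NormedAddCommGroup E] [InnerProductSpace ℝ E] :
    CN E := by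
  intro x y s _
  refine ⟨(1 - s) • x + s • y, fun p => le_of_eq ?_⟩
  have h1 : p - ((1 - s) • x + s • y) = (1 - s) • (p - x) + s • (p - y) := by module
  have h2 : x - y = (p - y) - (p - x) := by abel
  rw [dist_eq_norm, dist_eq_norm p x, dist_eq_norm p y, dist_eq_norm x y, h1, h2, norm_add_sq_real,
    norm_sub_sq_real (p - y), norm_smul, norm_smul, inner_smul_left, inner_smul_right,
    real_inner_comm (p - x) (p - y), mul_pow, mul_pow, Real.norm_eq_abs, Real.norm_eq_abs,
    sq_abs, sq_abs]
  simp
  ring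

theorem dist_sq_prod {X Y : Type*} [MetricSpace X] [MetricSpace Y] (a b : WithLp 2 (X × Y)) :
    dist a b ^ 2 = dist a.fst b.fst ^ 2 + dist a.snd b.snd ^ 2 := by
  rw [WithLp.prod_dist_eq_add (by norm_num)]
  simp only [ENNReal.toReal_ofNat, Real.rpow_ofNat]
  rw [← Real.sqrt_eq_rpow, Real.sq_sqrt (by positivity)]

theorem CN.prod {X Y : Type*} [MetricSpace X] [MetricSpace Y] (hX : CN X) (hY : CN Y) :
    CN (WithLp 2 (X × Y)) := by
  intro x y s hs
  obtain ⟨z, hz⟩ := hX x.fst y.fst s hs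
  obtain ⟨w, hw⟩ := hY x.snd y.snd s hs
  refine ⟨WithLp.toLp 2 (z, w), fun p => ?_⟩
  have := hz p.fst
  have := hw p.snd
  rw [dist_sq_prod, dist_sq_prod, dist_sq_prod, dist_sq_prod]
  change dist p.fst z ^ 2 + dist p.snd w ^ 2 ≤ _
  linarith

/-- The space obtained from `X` by gluing a ray at the point `o`. -/
abbrev RayWedge (X : Type*) [MetricSpace X] (o : X) : Type _ :=
  {a : WithLp 1 (X × ℝ) // (a.fst = o ∧ 0 ≤ a.snd) ∨ a.snd = 0}

namespace RayWedge

variable {X : Type*} [MetricSpace X] {o : X}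

/-- The inclusion of `X`. -/
def inl (x : X) : RayWedge X o := ⟨WithLp.toLp 1 (x, 0), Or.inr rfl⟩

/-- The inclusion of the ray. -/
def inr (r : ℝ) (hr : 0 ≤ r) : RayWedge X o := ⟨WithLp.toLp 1 (o, r), Or.inl ⟨rfl, hr⟩⟩

theorem dist_def (a b : RayWedge X o) :
    dist a b = dist a.1.fst b.1.fst + |a.1.snd - b.1.snd| := by
  rw [Subtype.dist_eq, WithLp.prod_dist_eq_add (by norm_num)]
  simp [Real.dist_eq]

@[simp] theorem dist_inl_inl (x y : X) : dist (inl x : RayWedge X o) (inl y) = dist x y := by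
  simp [dist_def, inl]

@[simp] theorem dist_inl_inr (x : X) (r : ℝ) (hr : 0 ≤ r) :
    dist (inl x : RayWedge X o) (inr r hr) = dist x o + r := by
  simp [dist_def, inl, inr, abs_of_nonneg hr]

@[simp] theorem dist_inr_inl (x : X) (r : ℝ) (hr : 0 ≤ r) :
    dist (inr r hr) (inl x : RayWedge X o) = dist x o + r := by
  rw [dist_comm, dist_inl_inr]

@[simp] theorem dist_inr_inr (r t : ℝ) (hr : 0 ≤ r) (ht : 0 ≤ t) :
    dist (inr r hr : RayWedge X o) (inr t ht) = |r - t| := by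
  simp [dist_def, inr]

theorem cases_inl_inr (a : RayWedge X o) : (∃ x, a = inl x) ∨ ∃ r hr, a = inr r hr := by
  obtain ⟨⟨x, r⟩, ⟨h, hr⟩ | h⟩ := a
  · right
    change x = o at h
    subst h
    exact ⟨r, hr, rfl⟩
  · left
    change r = 0 at h
    subst h
    exact ⟨x, rfl⟩

theorem cn_aux (hX : CN X) (x : X) (r : ℝ) (hr : 0 ≤ r) (s : ℝ) (hs : s ∈ Set.Icc (0 : ℝ) 1) :
    ∃ z : RayWedge X o, ∀ p, dist p z ^ 2 ≤ (1 - s) * dist p (inl x) ^ 2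
      + s * dist p (inr r hr) ^ 2 - s * (1 - s) * (dist x o + r) ^ 2 := by
  set a := dist x o with ha
  have ha0 : 0 ≤ a := dist_nonneg
  rcases le_or_gt (s * (a + r)) a with hle | hlt
  · -- the point lies in `X`
    rcases ha0.eq_or_lt with h0 | h0
    · have hxo : x = o := dist_eq_zero.1 (ha.symm.trans h0.symm)
      refine ⟨inl x, fun p => ?_⟩
      have hsr : s * r = 0 := le_antisymm (by rw [← h0] at hle; linarith) (mul_nonneg hs.1 hr)
      rcases cases_inl_inr p with ⟨p, rfl⟩ | ⟨t, ht, rfl⟩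
      · rw [dist_inl_inl, dist_inl_inr, ← h0, hxo]
        nlinarith [mul_nonneg hs.1 (dist_nonneg (x := p) (y := o)), hs.1, hs.2]
      · rw [dist_inr_inl, dist_inr_inr, sq_abs, ← ha, ← h0]
        linear_combination (2 * t - s * r) * hsr
    · have hs1 : s * (a + r) / a ∈ Set.Icc (0 : ℝ) 1 :=
        ⟨div_nonneg (mul_nonneg hs.1 (by linarith)) h0.le, (div_le_one h0).2 hle⟩
      obtain ⟨z, hz⟩ := hX x o _ hs1
      refine ⟨inl z, fun p => ?_⟩
      have hk : s * (a + r) / a * a = s * (a + r) := by field_simp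
      set k := s * (a + r) / a
      rcases cases_inl_inr p with ⟨p, rfl⟩ | ⟨t, ht, rfl⟩
      · rw [dist_inl_inl, dist_inl_inl, dist_inl_inr]
        have h1 := hz p
        have h2 : (dist p o - a) ^ 2 ≤ dist p x ^ 2 := by
          rw [← sq_abs, ha]
          have := abs_dist_sub_le p x o
          gcongr
        refine h1.trans ?_
        rw [← ha]
        clear_value k
        set R := dist p o
        set P := dist p x
        have hks : s * r = (k - s) * a := by linarith
        have hks0 : 0 ≤ k - s := by
          by_contra! hc
          nlinarith [mul_nonneg hs.1 hr]
        have h3 := mul_le_mul_of_nonneg_left h2 hks0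
        have e : (1 - s) * P ^ 2 + s * (R + r) ^ 2 - s * (1 - s) * (a + r) ^ 2 -
            ((1 - k) * P ^ 2 + k * R ^ 2 - k * (1 - k) * a ^ 2) =
            (k - s) * P ^ 2 - (k - s) * (R - a) ^ 2 := by
          linear_combination (2 * R + r) * hks + ((1 - s) * (a + r) - k * a + a) * hk
        linarith
      · rw [dist_inr_inl, dist_inr_inl, dist_inr_inr, sq_abs, ← ha]
        have h1 := hz x
        have h2 := hz o
        rw [dist_self, ← ha] at h1
        rw [dist_self, dist_comm o x, ← ha] at h2
        have h3 : dist z o ≤ (1 - k) * a := by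
          rw [dist_comm]
          refine abs_le_of_sq_le_sq' ?_ (mul_nonneg (by linarith [hs1.2]) h0.le) |>.2
          nlinarith
        have h4 : (dist z o + t) ^ 2 ≤ ((1 - k) * a + t) ^ 2 := by
          gcongr
        have e : (1 - k) * a = a - s * (a + r) := by linarith
        rw [e] at h4
        refine h4.trans (le_of_eq ?_)
        ring
  · have hρ : 0 ≤ s * (a + r) - a := by linarith
    refine ⟨inr _ hρ, fun p => ?_⟩
    rcases cases_inl_inr p with ⟨p, rfl⟩ | ⟨t, ht, rfl⟩
    · rw [dist_inl_inl, dist_inl_inr, dist_inl_inr]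
      have h2 : (dist p o - a) ^ 2 ≤ dist p x ^ 2 := by
        rw [← sq_abs, ha]
        have := abs_dist_sub_le p x o
        gcongr
      have := mul_le_mul_of_nonneg_left h2 (sub_nonneg.2 hs.2)
      nlinarith
    · rw [dist_inr_inl, dist_inr_inr, dist_inr_inr, sq_abs, sq_abs, ← ha]
      apply le_of_eq
      ring

theorem cn (hX : CN X) (o : X) : CN (RayWedge X o) := by
  intro x y s hs
  rcases cases_inl_inr x with ⟨x, rfl⟩ | ⟨r, hr, rfl⟩ <;>
    rcases cases_inl_inr y with ⟨y, rfl⟩ | ⟨t, ht, rfl⟩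
  · obtain ⟨z, hz⟩ := hX x y s hs
    refine ⟨inl z, fun p => ?_⟩
    rcases cases_inl_inr p with ⟨p, rfl⟩ | ⟨t, ht, rfl⟩
    · simpa using hz p
    · simp only [dist_inr_inl, dist_inl_inl]
      have h1 := hz o
      have h2 := abs_dist_sub_le x y o
      have h3 : (dist x o - dist y o) ^ 2 ≤ dist x y ^ 2 := by
        rw [← sq_abs]; gcongr
      have hss : 0 ≤ s * (1 - s) := mul_nonneg hs.1 (sub_nonneg.2 hs.2)
      have h3' := mul_le_mul_of_nonneg_left h3 hss
      rw [dist_comm o x, dist_comm o y, dist_comm o z] at h1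
      have h4 : dist z o ≤ (1 - s) * dist x o + s * dist y o := by
        refine abs_le_of_sq_le_sq' ?_ (add_nonneg (mul_nonneg (by linarith [hs.2]) dist_nonneg)
          (mul_nonneg hs.1 dist_nonneg)) |>.2
        nlinarith
      have h5 := mul_le_mul_of_nonneg_left h4 ht
      nlinarith
  · simpa using cn_aux (o := o) hX x t ht s hs
  · obtain ⟨z, hz⟩ := cn_aux (o := o) hX y r hr (1 - s) ⟨by linarith [hs.2], by linarith [hs.1]⟩
    refine ⟨z, fun p => (hz p).trans (le_of_eq ?_)⟩
    rw [dist_inr_inl]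
    ring
  · have h0 : 0 ≤ (1 - s) * r + s * t :=
      add_nonneg (mul_nonneg (by linarith [hs.2]) hr) (mul_nonneg hs.1 ht)
    refine ⟨inr _ h0, fun p => le_of_eq ?_⟩
    rcases cases_inl_inr p with ⟨p, rfl⟩ | ⟨t, ht, rfl⟩
    · simp only [dist_inl_inr, dist_inr_inr, sq_abs]
      ring
    · simp only [dist_inr_inr, sq_abs]
      ring

end RayWedge

/-- `D` is the matrix of squared distances of a finite family of points in a `CN` space. -/
def Emb {ι : Type*} (D : ι → ι → ℝ) : Prop :=
  ∃ (X : Type) (_ : MetricSpace X), CN X ∧ ∃ f : ι → X, ∀ i j, dist (f i) (f j) ^ 2 = D i j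

/-- `D` is the matrix of squared distances of a family of points in a Euclidean space. -/
def Euclidean {ι : Type*} (D : ι → ι → ℝ) : Prop :=
  ∃ (n : ℕ) (f : ι → EuclideanSpace ℝ (Fin n)), ∀ i j, dist (f i) (f j) ^ 2 = D i j

theorem Euclidean.emb {ι : Type*} {D : ι → ι → ℝ} (h : Euclidean D) : Emb D := by
  obtain ⟨n, f, hf⟩ := h
  exact ⟨_, _, CN.of_innerProductSpace _, f, hf⟩

theorem Emb.add {ι : Type*} {D D' : ι → ι → ℝ} (h : Emb D) (h' : Emb D') : Emb (D + D') := by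
  obtain ⟨X, _, hX, f, hf⟩ := h
  obtain ⟨Y, _, hY, g, hg⟩ := h'
  refine ⟨WithLp 2 (X × Y), inferInstance, hX.prod hY, fun i => WithLp.toLp 2 (f i, g i), ?_⟩
  intro i j
  rw [dist_sq_prod, Pi.add_apply, Pi.add_apply, ← hf, ← hg]
  rfl

theorem Emb.comp {ι κ : Type*} {D : ι → ι → ℝ} (h : Emb D) (e : κ → ι) :
    Emb fun i j => D (e i) (e j) := by
  obtain ⟨X, _, hX, f, hf⟩ := h
  exact ⟨X, _, hX, f ∘ e, fun i j => hf _ _⟩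

/-- Linear matrices. -/
theorem emb_line {ι : Type*} (g : ι → ℝ) : Emb fun i j => (g i - g j) ^ 2 :=
  ⟨ℝ, _, CN.of_innerProductSpace ℝ, g, fun i j => by rw [Real.dist_eq, sq_abs]⟩

/-- The bilinear form of `D`. -/
noncomputable def bform {ι : Type*} [Fintype ι] (D : ι → ι → ℝ) (u v : ι → ℝ) : ℝ :=
  -(1 / 2) * ∑ i, ∑ j, u i * v j * D i j

/-- The quadratic form of `D`. -/
noncomputable def qform {ι : Type*} [Fintype ι] (D : ι → ι → ℝ) (v : ι → ℝ) : ℝ := bform D v v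

/-- Conditionally negative definite matrices. -/
def CondNeg {ι : Type*} [Fintype ι] (D : ι → ι → ℝ) : Prop :=
  (∀ i, D i i = 0) ∧ (∀ i j, D i j = D j i) ∧ ∀ v : ι → ℝ, ∑ i, v i = 0 → 0 ≤ qform D v

open scoped MatrixOrder in
theorem CondNeg.euclidean {n : ℕ} [NeZero n] {D : Fin n → Fin n → ℝ} (h : CondNeg D) :
    Euclidean D := by
  obtain ⟨hd, hs, hv⟩ := h
  let G : Matrix (Fin n) (Fin n) ℝ := fun i j => (D i 0 + D j 0 - D i j) / 2
  have hG : G.PosSemidef := by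
    refine Matrix.PosSemidef.of_dotProduct_mulVec_nonneg ?_ ?_
    · ext i j
      change (D j 0 + D i 0 - D j i) / 2 = (D i 0 + D j 0 - D i j) / 2
      rw [hs i j, add_comm]
    · intro v
      have := hv (fun i => v i - if i = 0 then ∑ j, v j else 0) (by simp)
      refine this.trans_eq ?_
      have e1 : ∑ i, ∑ j, v i * v j * D i 0 = (∑ j, v j) * ∑ i, v i * D i 0 := by
        rw [Finset.sum_mul_sum, Finset.sum_comm]
        exact Finset.sum_congr rfl fun i _ => Finset.sum_congr rfl fun j _ => by ring
      have e2 : ∑ i, ∑ j, v i * v j * D j 0 = (∑ j, v j) * ∑ i, v i * D i 0 := by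
        rw [Finset.sum_mul_sum]
        exact Finset.sum_congr rfl fun i _ => Finset.sum_congr rfl fun j _ => by ring
      have e3 : star v ⬝ᵥ G.mulVec v = (1 / 2) * ((∑ i, ∑ j, v i * v j * D i 0)
          + (∑ i, ∑ j, v i * v j * D j 0) - ∑ i, ∑ j, v i * v j * D i j) := by
        simp only [dotProduct, Matrix.mulVec, Finset.mul_sum, ← Finset.sum_add_distrib,
          ← Finset.sum_sub_distrib]
        refine Finset.sum_congr rfl fun i _ => Finset.sum_congr rfl fun j _ => ?_
        simp [G]
        ring
      rw [e3, e1, e2, qform, bform]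
      simp only [sub_mul, mul_sub, Finset.sum_sub_distrib, ite_mul, mul_ite, zero_mul, mul_zero,
        Finset.sum_ite_eq', Finset.mem_univ, if_true, Finset.sum_ite_irrel, Finset.sum_const_zero]
      simp only [hd, hs 0, mul_zero, sub_zero]
      have e4 : ∑ i, v i * (∑ j, v j) * D i 0 = (∑ j, v j) * ∑ i, v i * D i 0 := by
        rw [Finset.mul_sum]
        exact Finset.sum_congr rfl fun i _ => by ring
      have e5 : ∑ i, (∑ j, v j) * v i * D i 0 = (∑ j, v j) * ∑ i, v i * D i 0 := by
        rw [Finset.mul_sum]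
        exact Finset.sum_congr rfl fun i _ => by ring
      rw [e4, e5]
      ring
  obtain ⟨B, hB⟩ := CStarAlgebra.nonneg_iff_eq_star_mul_self.1 hG.nonneg
  have hB' : ∀ i j, G i j = ∑ k, B k i * B k j := by
    intro i j
    rw [hB]
    simp [Matrix.mul_apply]
  refine ⟨n, fun i => WithLp.toLp 2 fun k => B k i, fun i j => ?_⟩
  rw [EuclideanSpace.dist_eq, Real.sq_sqrt (by positivity)]
  have e : D i j = G i i + G j j - 2 * G i j := by
    simp [G, hd]
    ring
  rw [e, hB', hB', hB', Finset.mul_sum, ← Finset.sum_add_distrib, ← Finset.sum_sub_distrib]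
  refine Finset.sum_congr rfl fun k _ => ?_
  rw [Real.dist_eq, sq_abs]
  ring

section bform

variable {ι : Type*} [Fintype ι] {D : ι → ι → ℝ}

theorem bform_add_left (D : ι → ι → ℝ) (u u' v : ι → ℝ) :
    bform D (u + u') v = bform D u v + bform D u' v := by
  simp only [bform, Pi.add_apply, add_mul, Finset.sum_add_distrib, mul_add]

theorem bform_smul_left (D : ι → ι → ℝ) (c : ℝ) (u v : ι → ℝ) :
    bform D (c • u) v = c * bform D u v := by
  simp only [bform, Pi.smul_apply, smul_eq_mul, Finset.mul_sum]
  exact Finset.sum_congr rfl fun _ _ => Finset.sum_congr rfl fun _ _ => by ring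

theorem bform_comm (hs : ∀ i j, D i j = D j i) (u v : ι → ℝ) : bform D u v = bform D v u := by
  rw [bform, bform, Finset.sum_comm]
  congr 1
  exact Finset.sum_congr rfl fun i _ => Finset.sum_congr rfl fun j _ => by rw [hs j i]; ring

theorem bform_add_right (D : ι → ι → ℝ) (u v v' : ι → ℝ) :
    bform D u (v + v') = bform D u v + bform D u v' := by
  simp only [bform, Pi.add_apply, add_mul, Finset.sum_add_distrib, mul_add]

theorem bform_smul_right (D : ι → ι → ℝ) (c : ℝ) (u v : ι → ℝ) :
    bform D u (c • v) = c * bform D u v := by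
  simp only [bform, Pi.smul_apply, smul_eq_mul, Finset.mul_sum]
  exact Finset.sum_congr rfl fun _ _ => Finset.sum_congr rfl fun _ _ => by ring

theorem bform_single [DecidableEq ι] (D : ι → ι → ℝ) (a b : ι) (α β : ℝ) :
    bform D (Pi.single a α) (Pi.single b β) = -(1 / 2) * (α * β * D a b) := by
  simp [bform, Pi.single_apply]

theorem qform_add (hs : ∀ i j, D i j = D j i) (u v : ι → ℝ) :
    qform D (u + v) = qform D u + 2 * bform D u v + qform D v := by
  rw [qform, bform_add_left, bform_add_right, bform_add_right, bform_comm hs v u]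
  simp only [qform]
  ring

theorem qform_smul (D : ι → ι → ℝ) (c : ℝ) (v : ι → ℝ) : qform D (c • v) = c ^ 2 * qform D v := by
  rw [qform, bform_smul_left, bform_smul_right, qform]
  ring

theorem qform_neg (D : ι → ι → ℝ) (v : ι → ℝ) : qform D (-v) = qform D v := by
  simp [qform, bform]

theorem qform_comp {κ : Type*} [Fintype κ] (D : ι → ι → ℝ) (e : κ ≃ ι) (v : ι → ℝ) :
    qform (fun i j => D (e i) (e j)) (v ∘ e) = qform D v := by
  simp only [qform, bform, Function.comp]
  congr 1
  rw [← e.sum_comp]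
  exact Finset.sum_congr rfl fun i _ => e.sum_comp fun j => v (e i) * v j * D (e i) j

end bform

/-- Vectors with zero sum, at most two positive and at most two negative entries. -/
def IsCone {ι : Type*} [Fintype ι] (v : ι → ℝ) : Prop :=
  ∑ i, v i = 0 ∧ ∀ i j k, i ≠ j → i ≠ k → j ≠ k →
    (v i ≤ 0 ∨ v j ≤ 0 ∨ v k ≤ 0) ∧ (0 ≤ v i ∨ 0 ≤ v j ∨ 0 ≤ v k)

/-- The cone of matrices satisfying the box inequalities. -/
structure InK {ι : Type*} (D : ι → ι → ℝ) : Prop where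
  diag : ∀ i, D i i = 0
  symm : ∀ i j, D i j = D j i
  box : Box D

theorem InK.comp {ι κ : Type*} {D : ι → ι → ℝ} (h : InK D) (e : κ → ι) :
    InK fun i j => D (e i) (e j) :=
  ⟨fun _ => h.diag _, fun _ _ => h.symm _ _, fun _ _ _ _ => h.box _ _ _ _⟩

theorem IsCone.neg {ι : Type*} [Fintype ι] {v : ι → ℝ} (h : IsCone v) : IsCone (-v) := by
  refine ⟨by simp [h.1], fun i j k hij hik hjk => ?_⟩
  have := h.2 i j k hij hik hjk
  simpa using this.symm

theorem IsCone.smul {ι : Type*} [Fintype ι] {v : ι → ℝ} (h : IsCone v) (c : ℝ) :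
    IsCone (c • v) := by
  wlog hc : 0 ≤ c generalizing c
  · have := (this (-c) (by linarith)).neg
    rwa [neg_smul, neg_neg] at this
  refine ⟨by simp [← Finset.mul_sum, h.1], fun i j k hij hik hjk => ?_⟩
  have := h.2 i j k hij hik hjk
  simp only [Pi.smul_apply, smul_eq_mul]
  exact ⟨this.1.imp (mul_nonpos_of_nonneg_of_nonpos hc)
    (Or.imp (mul_nonpos_of_nonneg_of_nonpos hc) (mul_nonpos_of_nonneg_of_nonpos hc)),
    this.2.imp (mul_nonneg hc) (Or.imp (mul_nonneg hc) (mul_nonneg hc))⟩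

theorem IsCone.comp {ι κ : Type*} [Fintype ι] [Fintype κ] {v : ι → ℝ} (h : IsCone v)
    (e : κ ≃ ι) : IsCone (v ∘ e) :=
  ⟨by simpa [Function.comp] using (e.sum_comp v).trans h.1, fun i j k hij hik hjk =>
    h.2 _ _ _ (e.injective.ne hij) (e.injective.ne hik) (e.injective.ne hjk)⟩

theorem exists_two_singles {ι : Type*} [DecidableEq ι] [Nonempty ι] {w : ι → ℝ}
    (h0 : ∀ i, 0 ≤ w i)
    (h : ∀ i j k, i ≠ j → i ≠ k → j ≠ k → w i ≤ 0 ∨ w j ≤ 0 ∨ w k ≤ 0) :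
    ∃ a b α β, 0 ≤ α ∧ 0 ≤ β ∧ w = Pi.single a α + Pi.single b β := by
  have hz : ∀ i, w i ≤ 0 → w i = 0 := fun i hi => le_antisymm hi (h0 i)
  by_cases h1 : ∃ a, w a ≠ 0
  · obtain ⟨a, ha⟩ := h1
    by_cases h2 : ∃ b, b ≠ a ∧ w b ≠ 0
    · obtain ⟨b, hba, hb⟩ := h2
      refine ⟨a, b, w a, w b, h0 _, h0 _, ?_⟩
      ext i
      by_cases hia : i = a
      · subst hia; simp [hba.symm]
      by_cases hib : i = b
      · subst hib; simp [hba]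
      rcases h a b i hba.symm (Ne.symm hia) (Ne.symm hib) with h | h | h
      · exact absurd (hz _ h) ha
      · exact absurd (hz _ h) hb
      · simp [hz _ h, hia, hib]
    · push Not at h2
      refine ⟨a, a, w a, 0, h0 _, le_rfl, ?_⟩
      ext i
      by_cases hia : i = a
      · subst hia; simp
      · simp [h2 i hia, hia]
  · push Not at h1
    exact ⟨Classical.arbitrary ι, Classical.arbitrary ι, 0, 0, le_rfl, le_rfl, by ext i; simp [h1]⟩

theorem qform_box {ι : Type*} [Fintype ι] [DecidableEq ι] {D : ι → ι → ℝ} (hd : ∀ i, D i i = 0)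
    (hs : ∀ i j, D i j = D j i) (a b c d : ι) (α β γ δ : ℝ) :
    qform D ((Pi.single a α + Pi.single b β) + (Pi.single c (-γ) + Pi.single d (-δ))) =
      α * γ * D a c + α * δ * D a d + β * γ * D b c + β * δ * D b d - α * β * D a b
        - γ * δ * D c d := by
  simp only [bform_add_left, bform_add_right, qform, bform_single, hd]
  rw [hs b a, hs c a, hs d a, hs c b, hs d b, hs d c]
  ring

theorem InK.box_smul {ι : Type*} {D : ι → ι → ℝ} (h : InK D) (a b c d : ι) {α β γ δ : ℝ}
    (hα : 0 ≤ α) (hβ : 0 ≤ β) (hγ : 0 ≤ γ) (hδ : 0 ≤ δ) (hsum : α + β = γ + δ) :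
    0 ≤ α * γ * D a c + α * δ * D a d + β * γ * D b c + β * δ * D b d - α * β * D a b
        - γ * δ * D c d := by
  rcases (add_nonneg hα hβ).eq_or_lt with h0 | h0
  · obtain rfl : α = 0 := by linarith
    obtain rfl : β = 0 := by linarith
    obtain rfl : γ = 0 := by linarith
    obtain rfl : δ = 0 := by linarith
    simp
  · have := h.box a b c d (β / (α + β)) ⟨by positivity, by rw [div_le_one h0]; linarith⟩
      (δ / (α + β)) ⟨by positivity, by rw [div_le_one h0]; linarith⟩
    have := mul_nonneg this (sq_nonneg (α + β))
    have t1 : β / (α + β) * (α + β) = β := by field_simp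
    have t2 : δ / (α + β) * (α + β) = δ := by field_simp
    generalize β / (α + β) = t at *
    generalize δ / (α + β) = s at *
    have t3 : (1 - t) * (α + β) = α := by linarith
    have t4 : (1 - s) * (α + β) = γ := by linarith
    generalize α + β = k at *
    subst t1 t2 t3 t4
    linarith

theorem InK.qform_nonneg {ι : Type*} [Fintype ι] {D : ι → ι → ℝ} (h : InK D) {v : ι → ℝ}
    (hv : IsCone v) : 0 ≤ qform D v := by
  classical
  rcases isEmpty_or_nonempty ι with hι | hι
  · simp [qform, bform]
  obtain ⟨a, b, α, β, hα, hβ, e1⟩ := exists_two_singles (w := fun i => max (v i) 0)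
    (fun i => le_max_right _ _) (fun i j k hij hik hjk => by
      simpa using (hv.2 i j k hij hik hjk).1)
  obtain ⟨c, d, γ, δ, hγ, hδ, e2⟩ := exists_two_singles (w := fun i => max (-v i) 0)
    (fun i => le_max_right _ _) (fun i j k hij hik hjk => by
      simpa using (hv.2 i j k hij hik hjk).2)
  have e : v = (Pi.single a α + Pi.single b β) + (Pi.single c (-γ) + Pi.single d (-δ)) := by
    rw [Pi.single_neg, Pi.single_neg, ← neg_add, ← e1, ← e2]
    ext i
    rcases le_total (v i) 0 with h | h <;> simp [h]
  have hsum : α + β = γ + δ := by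
    have := hv.1
    rw [e] at this
    simp [Finset.sum_add_distrib] at this
    linarith
  rw [e, qform_box h.diag h.symm]
  exact h.box_smul a b c d hα hβ hγ hδ hsum

theorem isCone_box {ι : Type*} [Fintype ι] [DecidableEq ι] (p q x y : ι) {t s : ℝ}
    (ht : t ∈ Set.Icc (0 : ℝ) 1) (hs : s ∈ Set.Icc (0 : ℝ) 1) :
    IsCone ((Pi.single p (1 - t) + Pi.single q t) +
      (Pi.single x (-(1 - s)) + Pi.single y (-s)) : ι → ℝ) := by
  have hpos : ∀ i, i ≠ p → i ≠ q → ((Pi.single p (1 - t) + Pi.single q t) +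
      (Pi.single x (-(1 - s)) + Pi.single y (-s)) : ι → ℝ) i ≤ 0 := by
    intro i hip hiq
    simp only [Pi.add_apply, Pi.single_apply, hip, hiq, if_false]
    have := hs.1
    have := hs.2
    split_ifs <;> linarith
  have hneg : ∀ i, i ≠ x → i ≠ y → 0 ≤ ((Pi.single p (1 - t) + Pi.single q t) +
      (Pi.single x (-(1 - s)) + Pi.single y (-s)) : ι → ℝ) i := by
    intro i hip hiq
    simp only [Pi.add_apply, Pi.single_apply, hip, hiq, if_false]
    have := ht.1
    have := ht.2
    split_ifs <;> linarith
  have key : ∀ p q i j k : ι, i ≠ j → i ≠ k → j ≠ k →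
      (i ≠ p ∧ i ≠ q) ∨ (j ≠ p ∧ j ≠ q) ∨ (k ≠ p ∧ k ≠ q) := by
    intro p q i j k hij hik hjk
    grind
  refine ⟨?_, fun i j k hij hik hjk => ⟨?_, ?_⟩⟩
  · simp [Finset.sum_add_distrib]
    ring
  · exact (key p q i j k hij hik hjk).imp (fun h => hpos _ h.1 h.2)
      (Or.imp (fun h => hpos _ h.1 h.2) (fun h => hpos _ h.1 h.2))
  · exact (key x y i j k hij hik hjk).imp (fun h => hneg _ h.1 h.2)
      (Or.imp (fun h => hneg _ h.1 h.2) (fun h => hneg _ h.1 h.2))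

theorem InK.of_qform_nonneg {ι : Type*} [Fintype ι] {D : ι → ι → ℝ} (hd : ∀ i, D i i = 0)
    (hs : ∀ i j, D i j = D j i) (h : ∀ v, IsCone v → 0 ≤ qform D v) : InK D := by
  classical
  refine ⟨hd, hs, fun p q x y t ht s hs' => ?_⟩
  have := h _ (isCone_box p q x y ht hs')
  rw [qform_box hd hs] at this
  linarith

theorem CondNeg.inK {ι : Type*} [Fintype ι] {D : ι → ι → ℝ} (h : CondNeg D) : InK D :=
  .of_qform_nonneg h.1 h.2.1 fun v hv => h.2.2 v hv.1

theorem InK.nonneg {ι : Type*} {D : ι → ι → ℝ} (h : InK D) (i j : ι) : 0 ≤ D i j := by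
  have := h.box i i j j 0 (by simp) 0 (by simp)
  simpa using this

theorem InK.triangle {ι : Type*} {D : ι → ι → ℝ} (h : InK D) (i j k : ι) :
    √(D i k) ≤ √(D i j) + √(D j k) := by
  refine le_add_of_box (Real.sqrt_nonneg _) (Real.sqrt_nonneg _) (Real.sqrt_nonneg _) ?_
  intro t ht
  rw [Real.sq_sqrt (h.nonneg _ _), Real.sq_sqrt (h.nonneg _ _), Real.sq_sqrt (h.nonneg _ _)]
  have := h.box i k j j t ht 0 (by simp)
  rw [h.diag, h.symm k j] at this
  linarith

theorem Cat0Comparison.inK {X ι : Type*} [MetricSpace X] (h : Cat0Comparison X) (f : ι → X) :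
    InK fun i j => dist (f i) (f j) ^ 2 :=
  ⟨fun i => by simp, fun i j => by rw [dist_comm], fun _ _ _ _ => h.box _ _ _ _⟩

theorem emb_tripod {a b c : ℝ} (hc : 0 ≤ c) (ha : 0 ≤ a) (hb : 0 ≤ b)
    {D : Fin 4 → Fin 4 → ℝ} (hd : ∀ i, D i i = 0) (hs : ∀ i j, D i j = D j i)
    (h01 : D 0 1 = a ^ 2) (h02 : D 0 2 = b ^ 2) (h03 : D 0 3 = c ^ 2)
    (h12 : D 1 2 = (a + b) ^ 2) (h13 : D 1 3 = (a + c) ^ 2) (h23 : D 2 3 = (b + c) ^ 2) :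
    Emb D := by
  refine ⟨RayWedge ℝ 0, inferInstance, RayWedge.cn (CN.of_innerProductSpace ℝ) 0,
    ![.inl 0, .inl a, .inl (-b), .inr c hc], fun i j => ?_⟩
  fin_cases i <;> fin_cases j <;>
    simp [hd, h01, h02, h03, h12, h13, h23, hs 1 0, hs 2 0, hs 3 0, hs 2 1, hs 3 1, hs 3 2,
      Real.dist_eq, sq_abs, abs_of_nonneg ha, abs_of_nonneg hb, dist_self]
  all_goals ring

theorem exists_ucoef {a b D : ℝ} (ha : 0 ≤ a) (hb : 0 ≤ b) (h1 : (a - b) ^ 2 ≤ D)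
    (h2 : D ≤ (a + b) ^ 2) : ∃ u, 0 ≤ u ∧ u ≤ 2 ∧ D = (a + b) ^ 2 - 2 * (a * b) * u := by
  rcases (mul_nonneg ha hb).eq_or_lt with h | h
  · exact ⟨0, le_rfl, by norm_num, by nlinarith⟩
  · refine ⟨((a + b) ^ 2 - D) / (2 * (a * b)), ?_, ?_, ?_⟩
    · apply div_nonneg <;> linarith
    · rw [div_le_iff₀ (by positivity)]; nlinarith
    · have h1 := left_ne_zero_of_mul h.ne'
      have h2 := right_ne_zero_of_mul h.ne'
      field_simp
      ring

theorem sum_sq_ge_of_le {X Y Z m n p : ℝ} (hY : 0 ≤ Y) (hZ : 0 ≤ Z)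
    (hm2 : m ≤ 2) (hn2 : n ≤ 2) (h : m + n + p ≤ 4)
    (h1 : Y * Z ≤ X * Y) (h2 : Y * Z ≤ X * Z) :
    2 * (m * (X * Y) + n * (X * Z) + p * (Y * Z)) ≤ (X + Y + Z) ^ 2 := by
  nlinarith [sq_nonneg (X - Y - Z), mul_nonneg (sub_nonneg.2 hm2) (sub_nonneg.2 h1),
    mul_nonneg (sub_nonneg.2 hn2) (sub_nonneg.2 h2),
    mul_nonneg (mul_nonneg hY hZ) (sub_nonneg.2 h)]

theorem sum_sq_ge {X Y Z m n p : ℝ} (hX : 0 ≤ X) (hY : 0 ≤ Y) (hZ : 0 ≤ Z)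
    (hm2 : m ≤ 2) (hn2 : n ≤ 2) (hp2 : p ≤ 2)
    (h : m + n + p ≤ 4) :
    2 * (m * (X * Y) + n * (X * Z) + p * (Y * Z)) ≤ (X + Y + Z) ^ 2 := by
  rcases le_total (X * Y) (X * Z) with h1 | h1 <;> rcases le_total (X * Y) (Y * Z) with h2 | h2 <;>
    rcases le_total (X * Z) (Y * Z) with h3 | h3
  all_goals first
    | linarith [sum_sq_ge_of_le (X := X) hY hZ hm2 hn2 h (by linarith) (by linarith)]
    | linarith [sum_sq_ge_of_le (X := Y) (p := n) hX hZ hm2 hp2 (by linarith) (by linarith) (by linarith)]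
    | linarith [sum_sq_ge_of_le (X := Z) (p := m) hX hY hn2 hp2 (by linarith) (by linarith) (by linarith)]

theorem InK.sub_sq_le {ι : Type*} {D : ι → ι → ℝ} (h : InK D) (o i j : ι) :
    (√(D o i) - √(D o j)) ^ 2 ≤ D i j := by
  have h1 := h.triangle o j i
  have h2 := h.triangle o i j
  rw [h.symm j i] at h1
  rw [← Real.sq_sqrt (h.nonneg i j)]
  apply sq_le_sq'
  all_goals linarith

theorem InK.le_add_sq {ι : Type*} {D : ι → ι → ℝ} (h : InK D) (o i j : ι) :
    D i j ≤ (√(D o i) + √(D o j)) ^ 2 := by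
  have h1 := h.triangle i o j
  rw [h.symm i o] at h1
  rw [← Real.sq_sqrt (h.nonneg i j)]
  gcongr

theorem InK.emb_of_center {D : Fin 4 → Fin 4 → ℝ} (h : InK D) (v : Fin 4 → ℝ)
    (hv0 : ∑ i, v i = 0) (h1 : 0 ≤ v 1) (h2 : 0 ≤ v 2) (h3 : 0 ≤ v 3) (hq : qform D v < 0) :
    Emb D := by
  have a0 := Real.sqrt_nonneg (D 0 1)
  have b0 := Real.sqrt_nonneg (D 0 2)
  have c0 := Real.sqrt_nonneg (D 0 3)
  obtain ⟨u, hu0, hu2, hu⟩ := exists_ucoef a0 b0 (h.sub_sq_le 0 1 2) (h.le_add_sq 0 1 2)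
  obtain ⟨w, hw0, hw2, hw⟩ := exists_ucoef a0 c0 (h.sub_sq_le 0 1 3) (h.le_add_sq 0 1 3)
  obtain ⟨z, hz0, hz2, hz⟩ := exists_ucoef b0 c0 (h.sub_sq_le 0 2 3) (h.le_add_sq 0 2 3)
  have ha := (Real.sq_sqrt (h.nonneg 0 1)).symm
  have hb := (Real.sq_sqrt (h.nonneg 0 2)).symm
  have hc := (Real.sq_sqrt (h.nonneg 0 3)).symm
  generalize √(D 0 1) = a at *
  generalize √(D 0 2) = b at *
  generalize √(D 0 3) = c at *
  have hS : u + w + z ≤ 2 := by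
    by_contra! hc'
    have := sum_sq_ge (m := 2 - u) (n := 2 - w) (p := 2 - z) (mul_nonneg a0 h1) (mul_nonneg b0 h2)
      (mul_nonneg c0 h3) (by linarith) (by linarith) (by linarith) (by linarith)
    have e : v 0 = -v 1 - v 2 - v 3 := by
      rw [Fin.sum_univ_four] at hv0
      linarith
    have : qform D v = (a * v 1 + b * v 2 + c * v 3) ^ 2 - 2 * ((2 - u) * (a * v 1 * (b * v 2)) +
        (2 - w) * (a * v 1 * (c * v 3)) + (2 - z) * (b * v 2 * (c * v 3))) := by
      simp only [qform, bform, Fin.sum_univ_four, h.diag, h.symm 1 0, h.symm 2 0, h.symm 3 0,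
        h.symm 2 1, h.symm 3 1, h.symm 3 2, hu, hw, hz, ha, hb, hc, e]
      ring
    linarith
  have hS' : 0 ≤ 1 - (u + w + z) / 2 := by linarith
  set r := √(1 - (u + w + z) / 2) with hr
  have hr0 : 0 ≤ r := Real.sqrt_nonneg _
  have hr2 : r ^ 2 = 1 - (u + w + z) / 2 := Real.sq_sqrt hS'
  have eu : √(u / 2) ^ 2 = u / 2 := Real.sq_sqrt (by linarith)
  have ew : √(w / 2) ^ 2 = w / 2 := Real.sq_sqrt (by linarith)
  have ez : √(z / 2) ^ 2 = z / 2 := Real.sq_sqrt (by linarith)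
  generalize √(u / 2) = u' at *
  generalize √(w / 2) = w' at *
  generalize √(z / 2) = z' at *
  obtain ⟨T, hT0, hTs, h01, h02, h03, h12, h13, h23⟩ : ∃ T : Fin 4 → Fin 4 → ℝ, (∀ i, T i i = 0) ∧
      (∀ i j, T i j = T j i) ∧ T 0 1 = (r * a) ^ 2 ∧ T 0 2 = (r * b) ^ 2 ∧ T 0 3 = (r * c) ^ 2 ∧
      T 1 2 = (r * a + r * b) ^ 2 ∧ T 1 3 = (r * a + r * c) ^ 2 ∧ T 2 3 = (r * b + r * c) ^ 2 :=
    ⟨![![0, (r * a) ^ 2, (r * b) ^ 2, (r * c) ^ 2],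
      ![(r * a) ^ 2, 0, (r * a + r * b) ^ 2, (r * a + r * c) ^ 2],
      ![(r * b) ^ 2, (r * a + r * b) ^ 2, 0, (r * b + r * c) ^ 2],
      ![(r * c) ^ 2, (r * a + r * c) ^ 2, (r * b + r * c) ^ 2, 0]],
      by intro i; fin_cases i <;> rfl, by intro i j; fin_cases i <;> fin_cases j <;> rfl,
      rfl, rfl, rfl, rfl, rfl, rfl⟩
  have hT : Emb T := emb_tripod (mul_nonneg hr0 c0) (mul_nonneg hr0 a0) (mul_nonneg hr0 b0)
    hT0 hTs h01 h02 h03 h12 h13 h23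
  have H := ((hT.add (emb_line ![0, u' * a, u' * b, -(u' * c)])).add
    (emb_line ![0, w' * a, -(w' * b), w' * c])).add (emb_line ![0, -(z' * a), z' * b, z' * c])
  convert H using 1
  funext i j
  simp only [Pi.add_apply]
  wlog hij : i < j generalizing i j
  · rcases (not_lt.1 hij).eq_or_lt with rfl | hij
    · simp [h.diag, hT0]
    · rw [h.symm, this j i hij, hTs]
      ring
  fin_cases i <;> fin_cases j <;> first | exact absurd hij (by decide) | skip
  · simp [ha, h01]
    linear_combination -a ^ 2 * (hr2 + eu + ew + ez)
  · simp [hb, h02]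
    linear_combination -b ^ 2 * (hr2 + eu + ew + ez)
  · simp [hc, h03]
    linear_combination -c ^ 2 * (hr2 + eu + ew + ez)
  · simp [hu, h12]
    linear_combination -(a + b) ^ 2 * (hr2 + ew + ez) - (a - b) ^ 2 * eu
  · simp [hw, h13]
    linear_combination -(a + c) ^ 2 * (hr2 + eu + ez) - (a - c) ^ 2 * ew
  · simp [hz, h23]
    linear_combination -(b + c) ^ 2 * (hr2 + eu + ew) - (b - c) ^ 2 * ez

theorem InK.emb_four {D : Fin 4 → Fin 4 → ℝ} (h : InK D) : Emb D := by
  by_cases hc : ∀ v : Fin 4 → ℝ, ∑ i, v i = 0 → 0 ≤ qform D v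
  · exact (CondNeg.euclidean ⟨h.diag, h.symm, hc⟩).emb
  push Not at hc
  obtain ⟨v, hv0, hv⟩ := hc
  have key : ∃ (w : Fin 4 → ℝ) (o : Fin 4), ∑ i, w i = 0 ∧ qform D w < 0 ∧ ∀ i, i ≠ o → 0 ≤ w i := by
    by_contra! hk
    have : IsCone v := by
      refine ⟨hv0, fun i j k hij hik hjk => ?_⟩
      have hex : ∃ o : Fin 4, ∀ l, l ≠ o → l = i ∨ l = j ∨ l = k := by
        revert i j k; decide
      obtain ⟨o, ho⟩ := hex
      constructor
      · obtain ⟨l, hl, hl0⟩ := hk v o hv0 hv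
        rcases ho l hl with rfl | rfl | rfl
        · exact Or.inl hl0.le
        · exact Or.inr (Or.inl hl0.le)
        · exact Or.inr (Or.inr hl0.le)
      · obtain ⟨l, hl, hl0⟩ := hk (-v) o (by simp [hv0]) (by rwa [qform_neg])
        simp only [Pi.neg_apply, neg_lt_zero] at hl0
        rcases ho l hl with rfl | rfl | rfl
        · exact Or.inl hl0.le
        · exact Or.inr (Or.inl hl0.le)
        · exact Or.inr (Or.inr hl0.le)
    linarith [h.qform_nonneg this]
  obtain ⟨w, o, hw0, hw, hpos⟩ := key
  let e := Equiv.swap 0 o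
  have he : e 0 = o := Equiv.swap_apply_left _ _
  have hne : ∀ i, i ≠ 0 → 0 ≤ (w ∘ e) i := fun i hi =>
    hpos _ (by rw [← he]; exact e.injective.ne hi)
  have := (h.comp e).emb_of_center (w ∘ e) (by rw [← hw0]; exact Equiv.sum_comp e w)
    (hne 1 (by decide)) (hne 2 (by decide)) (hne 3 (by decide)) (by rwa [qform_comp])
  simpa using this.comp e.symm

/-- The point `i` hangs off the rest at `j`. -/
def Pendant {ι : Type*} (D : ι → ι → ℝ) (i j : ι) : Prop :=
  i ≠ j ∧ ∀ k, k ≠ i → √(D i k) = √(D i j) + √(D j k)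

theorem InK.emb_of_pendant {D : Fin 5 → Fin 5 → ℝ} (h : InK D) {i j : Fin 5} (hp : Pendant D i j) :
    Emb D := by
  obtain ⟨X, _, hX, f, hf⟩ := (h.comp i.succAbove).emb_four
  replace hf : ∀ k l, dist (f k) (f l) ^ 2 = D (i.succAbove k) (i.succAbove l) := hf
  obtain ⟨j', rfl⟩ := Fin.exists_succAbove_eq hp.1.symm
  refine ⟨RayWedge X (f j'), inferInstance, RayWedge.cn hX _,
    i.insertNth (.inr (√(D i (i.succAbove j'))) (Real.sqrt_nonneg _)) fun k => .inl (f k), ?_⟩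
  have key : ∀ k, (dist (f k) (f j') + √(D i (i.succAbove j'))) ^ 2 = D i (i.succAbove k) := by
    intro k
    have e := hp.2 (i.succAbove k) (Fin.succAbove_ne _ _)
    have : √(D (i.succAbove j') (i.succAbove k)) = dist (f k) (f j') := by
      rw [dist_comm, ← hf, Real.sqrt_sq dist_nonneg]
    rw [← Real.sq_sqrt (h.nonneg i (i.succAbove k)), e, this, add_comm]
  intro a b
  rcases Fin.eq_self_or_eq_succAbove i a with ha | ⟨a, rfl⟩ <;>
    rcases Fin.eq_self_or_eq_succAbove i b with hb | ⟨b, rfl⟩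
  · simp [ha, hb, h.diag]
  · simp [ha, key]
  · simp [hb, key, h.symm _ i]
  · simp [hf]

theorem isCompact_convexHull_of_finiteDimensional {E : Type*} [NormedAddCommGroup E]
    [NormedSpace ℝ E] [FiniteDimensional ℝ E] {s : Set E} (hs : IsCompact s) :
    IsCompact (convexHull ℝ s) := by
  rcases s.eq_empty_or_nonempty with rfl | ⟨g, hg⟩
  · simp
  let N := Module.finrank ℝ E + 1
  have hc : IsCompact (stdSimplex ℝ (Fin N) ×ˢ Set.pi Set.univ fun _ : Fin N => s) :=
    (isCompact_stdSimplex ℝ (Fin N)).prod (isCompact_univ_pi fun _ => hs)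
  have hf : Continuous fun p : (Fin N → ℝ) × (Fin N → E) => ∑ i, p.1 i • p.2 i := by fun_prop
  convert hc.image hf using 1
  ext x
  constructor
  · intro hx
    obtain ⟨ι, _, z, w, hz, hind, hw, hw1, hx⟩ := eq_pos_convex_span_of_mem_convexHull hx
    have hcard : Fintype.card ι ≤ Fintype.card (Fin N) := by
      rw [Fintype.card_fin]
      exact hind.card_le_finrank_succ.trans (Nat.succ_le_succ (Submodule.finrank_le _))
    obtain ⟨e⟩ := Function.Embedding.nonempty_of_card_le hcard
    have hew : ∀ i, Function.extend e w 0 (e i) = w i := fun i => e.injective.extend_apply _ _ _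
    have hez : ∀ i, Function.extend e z (fun _ => g) (e i) = z i := fun i =>
      e.injective.extend_apply _ _ _
    have h0 : ∀ k ∉ Set.range e, Function.extend e w 0 k = 0 := fun k hk =>
      Function.extend_apply' _ _ _ hk
    refine ⟨(Function.extend e w 0, Function.extend e z fun _ => g), ⟨⟨fun k => ?_, ?_⟩,
      fun k _ => ?_⟩, ?_⟩
    · by_cases hk : k ∈ Set.range e
      · obtain ⟨i, rfl⟩ := hk
        simp only [hew]
        exact (hw i).le
      · simp only [h0 k hk, le_refl]
    · rw [← hw1]
      exact (Fintype.sum_of_injective e e.injective _ _ h0 fun i => (hew i).symm).symm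
    · by_cases hk : k ∈ Set.range e
      · obtain ⟨i, rfl⟩ := hk
        simp only [hez]
        exact hz ⟨i, rfl⟩
      · simp only [Function.extend_apply' _ _ _ hk, hg]
    · rw [← hx]
      exact (Fintype.sum_of_injective e e.injective _ _ (fun k hk => by simp only [h0 k hk, zero_smul])
        fun i => by simp only [hew, hez]).symm
  · rintro ⟨⟨w, z⟩, ⟨hw, hz⟩, rfl⟩
    exact (convex_convexHull ℝ s).sum_mem (fun i _ => hw.1 i) hw.2
      fun i _ => subset_convexHull ℝ s (hz i trivial)

theorem exists_pos_mul_le {α : Type*} [TopologicalSpace α] {S : Set α} (hS : IsCompact S)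
    {f g : α → ℝ} (hf : Continuous f) (hg : Continuous g) (h0 : ∀ x ∈ S, 0 ≤ f x)
    (h : ∀ x ∈ S, f x = 0 → g x < 0) : ∃ ε, 0 < ε ∧ ε < 1 ∧ ∀ x ∈ S, ε * g x ≤ f x := by
  have hS' : IsCompact (S ∩ {x | 0 ≤ g x}) := hS.inter_right (isClosed_le continuous_const hg)
  rcases (S ∩ {x | 0 ≤ g x}).eq_empty_or_nonempty with he | hne
  · refine ⟨1 / 2, by norm_num, by norm_num, fun x hx => ?_⟩
    have : g x < 0 := by
      by_contra! hc
      exact (he ▸ (⟨hx, hc⟩ : x ∈ S ∩ {x | 0 ≤ g x}) : x ∈ (∅ : Set α))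
    linarith [h0 x hx]
  · obtain ⟨a, ha, hamin⟩ := hS'.exists_isMinOn hne hf.continuousOn
    obtain ⟨b, hb, hbmax⟩ := hS'.exists_isMaxOn hne hg.continuousOn
    have hfa : 0 < f a := (h0 a ha.1).lt_of_ne fun e => absurd (h a ha.1 e.symm) (not_lt.2 ha.2)
    have hgb : 0 ≤ g b := hb.2
    refine ⟨min (1 / 2) (f a / (g b + 1)), by positivity, by
      exact (min_le_left _ _).trans_lt (by norm_num), fun x hx => ?_⟩
    rcases lt_or_ge (g x) 0 with hx0 | hx0
    · exact (mul_nonpos_of_nonneg_of_nonpos (by positivity) hx0.le).trans (h0 x hx)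
    · calc min (1 / 2) (f a / (g b + 1)) * g x ≤ f a / (g b + 1) * (g b + 1) := by
            gcongr
            · exact min_le_right _ _
            · have : g x ≤ g b := hbmax ⟨hx, hx0⟩
              linarith
        _ = f a := by field_simp
        _ ≤ f x := hamin ⟨hx, hx0⟩

theorem qform_add_left {ι : Type*} [Fintype ι] (D D' : ι → ι → ℝ) (v : ι → ℝ) :
    qform (D + D') v = qform D v + qform D' v := by
  simp only [qform, bform, Pi.add_apply, mul_add, Finset.sum_add_distrib]

theorem qform_smul_left {ι : Type*} [Fintype ι] (c : ℝ) (D : ι → ι → ℝ) (v : ι → ℝ) :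
    qform (c • D) v = c * qform D v := by
  simp only [qform, bform, Pi.smul_apply, smul_eq_mul, Finset.mul_sum]
  exact Finset.sum_congr rfl fun _ _ => Finset.sum_congr rfl fun _ _ => by ring

theorem InK.smul {ι : Type*} [Fintype ι] {D : ι → ι → ℝ} (h : InK D) {c : ℝ} (hc : 0 ≤ c) :
    InK (c • D) :=
  .of_qform_nonneg (fun i => by simp [h.diag]) (fun i j => by simp [h.symm i j]) fun v hv => by
    rw [qform_smul_left]
    exact mul_nonneg hc (h.qform_nonneg hv)

theorem CondNeg.smul {ι : Type*} [Fintype ι] {D : ι → ι → ℝ} (h : CondNeg D) {c : ℝ}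
    (hc : 0 ≤ c) : CondNeg (c • D) :=
  ⟨fun i => by simp [h.1], fun i j => by simp [h.2.1 i j], fun v hv => by
    rw [qform_smul_left]
    exact mul_nonneg hc (h.2.2 v hv)⟩

theorem Pendant.smul {ι : Type*} {D : ι → ι → ℝ} {i j : ι} (h : Pendant D i j) {c : ℝ}
    (hc : 0 ≤ c) : Pendant (c • D) i j :=
  ⟨h.1, fun k hk => by
    simp only [Pi.smul_apply, smul_eq_mul, Real.sqrt_mul hc]
    rw [h.2 k hk, mul_add]⟩

/-- The matrix of a regular simplex. -/
def simplexMatrix (ι : Type*) [DecidableEq ι] (i j : ι) : ℝ := if i = j then 0 else 1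

theorem qform_simplexMatrix {ι : Type*} [Fintype ι] [DecidableEq ι] {v : ι → ℝ}
    (hv : ∑ i, v i = 0) : qform (simplexMatrix ι) v = 1 / 2 * ∑ i, v i ^ 2 := by
  have : ∀ i j, v i * v j * simplexMatrix ι i j = v i * v j - if i = j then v i * v j else 0 := by
    intro i j
    rw [simplexMatrix]
    split_ifs <;> ring
  simp only [qform, bform, this, Finset.sum_sub_distrib, ← Finset.mul_sum, hv]
  simp [sq]

theorem isClosed_isCone {ι : Type*} [Fintype ι] : IsClosed {v : ι → ℝ | IsCone v} := by
  simp only [IsCone, Set.ofPred_and, Set.ofPred_forall, Set.ofPred_or]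
  refine (isClosed_eq (by fun_prop) (by fun_prop)).inter ?_
  refine isClosed_iInter fun i => isClosed_iInter fun j => isClosed_iInter fun k =>
    isClosed_iInter fun _ => isClosed_iInter fun _ => isClosed_iInter fun _ => ?_
  have h1 : ∀ i : ι, IsClosed {v : ι → ℝ | v i ≤ 0} := fun i =>
    isClosed_le (by fun_prop) (by fun_prop)
  have h2 : ∀ i : ι, IsClosed {v : ι → ℝ | 0 ≤ v i} := fun i =>
    isClosed_le (by fun_prop) (by fun_prop)
  exact ((h1 i).union ((h1 j).union (h1 k))).inter ((h2 i).union ((h2 j).union (h2 k)))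

theorem isCompact_isCone_sphere {ι : Type*} [Fintype ι] :
    IsCompact {v : ι → ℝ | IsCone v ∧ ∑ i, v i ^ 2 = 1} := by
  refine (isCompact_Icc (a := fun _ : ι => (-1 : ℝ)) (b := fun _ => 1)).of_isClosed_subset
    (isClosed_isCone.inter (isClosed_eq (by fun_prop) (by fun_prop))) ?_
  rintro v ⟨-, hv⟩
  have : ∀ i, |v i| ≤ 1 := fun i => by
    rw [← sq_le_one_iff_abs_le_one, ← hv]
    exact Finset.single_le_sum (f := fun i => v i ^ 2) (fun _ _ => sq_nonneg _) (Finset.mem_univ i)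
  exact ⟨fun i => (abs_le.1 (this i)).1, fun i => (abs_le.1 (this i)).2⟩

theorem InK.exists_perturb {ι : Type*} [Fintype ι] [DecidableEq ι] {W T : ι → ι → ℝ} (hW : InK W)
    (hT : InK T) (h : ∀ v, IsCone v → qform W v = 0 → qform T v = 0) {η : ℝ} (hη : 0 < η) :
    ∃ ε : ℝ, 0 < ε ∧ ε < 1 ∧ InK (W + (-ε) • (T + (-η) • simplexMatrix ι)) := by
  obtain ⟨ε, h0, h1, hε⟩ := exists_pos_mul_le (isCompact_isCone_sphere (ι := ι))
    (f := qform W) (g := qform (T + (-η) • simplexMatrix ι))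
    (by unfold qform bform; fun_prop) (by unfold qform bform; fun_prop)
    (fun v hv => hW.qform_nonneg hv.1) (fun v hv hv0 => by
      rw [qform_add_left, qform_smul_left, h v hv.1 hv0, qform_simplexMatrix hv.1.1, hv.2]
      linarith)
  refine ⟨ε, h0, h1, .of_qform_nonneg (fun i => by simp [hW.diag, hT.diag, simplexMatrix])
    (fun i j => by simp [hW.symm i j, hT.symm i j, simplexMatrix, eq_comm]) fun v hv => ?_⟩
  rw [qform_add_left, qform_smul_left]
  rcases (Finset.sum_nonneg fun i _ => sq_nonneg (v i) : 0 ≤ ∑ i, v i ^ 2).eq_or_lt with hv0 | hv0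
  · have : v = 0 := by
      ext i
      have := (Finset.sum_eq_zero_iff_of_nonneg fun i _ => sq_nonneg (v i)).1 hv0.symm i
        (Finset.mem_univ i)
      simpa using this
    simp [this, qform, bform]
  · set s := ∑ i, v i ^ 2
    have hs : (√s)⁻¹ ^ 2 * s = 1 := by
      rw [inv_pow, Real.sq_sqrt hv0.le, inv_mul_cancel₀ hv0.ne']
    have := hε ((√s)⁻¹ • v) ⟨hv.smul _, by
      simp only [Pi.smul_apply, smul_eq_mul, mul_pow, ← Finset.mul_sum]
      exact hs⟩
    rw [qform_smul, qform_smul] at this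
    have hp : 0 < (√s)⁻¹ ^ 2 := by positivity
    have : (√s)⁻¹ ^ 2 * (ε * qform (T + (-η) • simplexMatrix ι) v) ≤ (√s)⁻¹ ^ 2 * qform W v := by
      linarith
    linarith [le_of_mul_le_mul_left this hp]

/-- The sum of the entries. -/
def entrySum (ι : Type*) [Fintype ι] : (ι → ι → ℝ) →ₗ[ℝ] ℝ where
  toFun D := ∑ i, ∑ j, D i j
  map_add' D D' := by simp [Finset.sum_add_distrib]
  map_smul' c D := by simp [Finset.mul_sum]

theorem InK.le_entrySum {ι : Type*} [Fintype ι] {D : ι → ι → ℝ} (h : InK D) (i j : ι) :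
    D i j ≤ entrySum ι D :=
  (Finset.single_le_sum (f := fun j => D i j) (fun j _ => h.nonneg i j) (Finset.mem_univ j)).trans
    (Finset.single_le_sum (f := fun i => ∑ j, D i j)
      (fun i _ => Finset.sum_nonneg fun j _ => h.nonneg i j) (Finset.mem_univ i))

theorem InK.entrySum_pos {ι : Type*} [Fintype ι] {D : ι → ι → ℝ} (h : InK D) (h0 : D ≠ 0) :
    0 < entrySum ι D := by
  by_contra! hc
  refine h0 ?_
  ext i j
  exact le_antisymm ((h.le_entrySum i j).trans hc) (h.nonneg i j)

theorem isClosed_inK {ι : Type*} [Fintype ι] : IsClosed {D : ι → ι → ℝ | InK D} := by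
  have : {D : ι → ι → ℝ | InK D} = {D | (∀ i, D i i = 0) ∧ (∀ i j, D i j = D j i) ∧
      ∀ v, IsCone v → 0 ≤ qform D v} := by
    ext D
    exact ⟨fun h => ⟨h.diag, h.symm, fun v => h.qform_nonneg⟩,
      fun h => .of_qform_nonneg h.1 h.2.1 h.2.2⟩
  rw [this]
  simp only [Set.ofPred_and, Set.ofPred_forall]
  refine (isClosed_iInter fun i => isClosed_eq (by fun_prop) (by fun_prop)).inter
    ((isClosed_iInter fun i => isClosed_iInter fun j => isClosed_eq (by fun_prop)
      (by fun_prop)).inter (isClosed_iInter fun v => isClosed_iInter fun _ => ?_))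
  exact isClosed_le (by fun_prop) (by unfold qform bform; fun_prop)

theorem isClosed_condNeg {ι : Type*} [Fintype ι] : IsClosed {D : ι → ι → ℝ | CondNeg D} := by
  simp only [CondNeg, Set.ofPred_and, Set.ofPred_forall]
  refine (isClosed_iInter fun i => isClosed_eq (by fun_prop) (by fun_prop)).inter
    ((isClosed_iInter fun i => isClosed_iInter fun j => isClosed_eq (by fun_prop)
      (by fun_prop)).inter (isClosed_iInter fun v => isClosed_iInter fun _ => ?_))
  exact isClosed_le (by fun_prop) (by unfold qform bform; fun_prop)

theorem isClosed_pendant {ι : Type*} [Finite ι] :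
    IsClosed {D : ι → ι → ℝ | ∃ i j, Pendant D i j} := by
  simp only [Pendant, Set.ofPred_exists, Set.ofPred_and, Set.ofPred_forall]
  refine isClosed_iUnion_of_finite fun i => isClosed_iUnion_of_finite fun j => ?_
  refine IsClosed.inter (by by_cases h : i = j <;> simp [h]) (isClosed_iInter fun k => isClosed_iInter fun _ => ?_)
  exact isClosed_eq (by fun_prop) (by fun_prop)

theorem isCompact_slice {ι : Type*} [Fintype ι] :
    IsCompact {D : ι → ι → ℝ | InK D ∧ entrySum ι D = 1} := by
  refine (isCompact_Icc (a := fun _ _ : ι => (0 : ℝ)) (b := fun _ _ => 1)).of_isClosed_subset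
    (isClosed_inK.inter (isClosed_eq (LinearMap.continuous_of_finiteDimensional _)
      continuous_const)) ?_
  rintro D ⟨hD, h1⟩
  exact ⟨fun i j => hD.nonneg i j, fun i j => h1 ▸ hD.le_entrySum i j⟩

theorem InK.emb_of_extremal
    (key : ∀ W : Fin 5 → Fin 5 → ℝ, InK W → W ≠ 0 → ∃ T, T ≠ 0 ∧ InK T ∧
      (CondNeg T ∨ ∃ i j, Pendant T i j) ∧ ∀ v, IsCone v → qform W v = 0 → qform T v = 0)
    {D : Fin 5 → Fin 5 → ℝ} (hD : InK D) : Emb D := by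
  let G : Set (Fin 5 → Fin 5 → ℝ) := {D | InK D ∧ entrySum _ D = 1} ∩
    ({D | CondNeg D} ∪ {D | ∃ i j, Pendant D i j})
  have hG : IsCompact G := isCompact_slice.inter_right (isClosed_condNeg.union isClosed_pendant)
  have hE : convexHull ℝ G ⊆ {D | ∀ c : ℝ, 0 ≤ c → Emb (c • D)} := by
    refine convexHull_min ?_ ?_
    · rintro T ⟨⟨hT, -⟩, h | ⟨i, j, h⟩⟩ c hc
      · exact (h.smul hc).euclidean.emb
      · exact (hT.smul hc).emb_of_pendant (h.smul hc)
    · intro A hA B hB a b ha hb _ c hc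
      rw [smul_add, smul_smul, smul_smul]
      exact (hA _ (mul_nonneg hc ha)).add (hB _ (mul_nonneg hc hb))
  by_cases hD0 : D = 0
  · subst hD0
    exact ⟨ℝ, _, CN.of_innerProductSpace ℝ, fun _ => 0, by simp⟩
  have hpos := hD.entrySum_pos hD0
  set D' := (entrySum _ D)⁻¹ • D with hD'
  have hD1 : D' ∈ {D | InK D ∧ entrySum (Fin 5) D = 1} :=
    ⟨hD.smul (by positivity), by simp [hD', hpos.ne']⟩
  suffices hmem : D' ∈ convexHull ℝ G by
    have := hE hmem _ hpos.le
    rwa [hD', smul_smul, mul_inv_cancel₀ hpos.ne', one_smul] at this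
  by_contra hmem
  obtain ⟨f, u, hfu, hu⟩ := geometric_hahn_banach_point_closed (convex_convexHull ℝ G)
    (isCompact_convexHull_of_finiteDimensional hG).isClosed hmem
  let M : (Fin 5 → Fin 5 → ℝ) →ₗ[ℝ] ℝ := f.toLinearMap - u • entrySum _
  have hM : ∀ A, M A = f A - u * entrySum _ A := fun A => rfl
  have hMc : Continuous M := M.continuous_of_finiteDimensional
  obtain ⟨W, hW, hmin⟩ := isCompact_slice.exists_isMinOn ⟨D', hD1⟩ hMc.continuousOn
  have hm : M W < 0 := lt_of_le_of_lt (hmin hD1) (by rw [hM, hD1.2]; linarith)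
  obtain ⟨T, hT0, hT, hTG, hTW⟩ := key W hW.1 (fun h => by simpa [h] using hW.2)
  have hTpos := hT.entrySum_pos hT0
  set T' := (entrySum _ T)⁻¹ • T with hT'
  have hT1 : T' ∈ G := ⟨⟨hT.smul (by positivity), by simp [hT', hTpos.ne']⟩,
    hTG.imp (fun h => h.smul (by positivity))
      (fun ⟨i, j, h⟩ => ⟨i, j, h.smul (by positivity)⟩)⟩
  have hMT : 0 < M T' := by
    have := hu T' (subset_convexHull ℝ G hT1)
    rw [hM, hT1.1.2]
    linarith
  set J := simplexMatrix (Fin 5)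
  set η := -M W / (2 * (|M J - entrySum _ J * M W| + 1)) with hη
  have hη0 : 0 < η := div_pos (by linarith) (by positivity)
  obtain ⟨ε, h0, h1, hK⟩ := hW.1.exists_perturb hT1.1.1 (fun v hv hv0 => by
    rw [hT', qform_smul_left, hTW v hv hv0, mul_zero]) hη0
  have hJ : 0 ≤ entrySum _ J := by
    change 0 ≤ ∑ i, ∑ j, J i j
    refine Finset.sum_nonneg fun i _ => Finset.sum_nonneg fun j _ => ?_
    change 0 ≤ if i = j then (0 : ℝ) else 1
    split_ifs <;> norm_num
  set V := W + (-ε) • (T' + (-η) • J)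
  have hV : entrySum _ V = 1 - ε + ε * η * entrySum _ J := by
    simp only [V, map_add, map_smul, hW.2, hT1.1.2, smul_eq_mul]
    ring
  have hVM : M V = M W - ε * M T' + ε * η * M J := by
    simp only [V, map_add, map_smul, smul_eq_mul]
    ring
  have hVpos : 0 < entrySum _ V := by
    rw [hV]
    have : 0 ≤ ε * η * entrySum _ J := by positivity
    linarith
  have := hmin (show (entrySum _ V)⁻¹ • V ∈ _ from
    ⟨hK.smul (by positivity), by simp [hVpos.ne']⟩)
  simp only [Set.mem_ofPred_eq, map_smul, smul_eq_mul] at this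
  rw [inv_mul_eq_div, le_div_iff₀ hVpos, hV, hVM] at this
  have h2 : ε * (M T' - M W) ≤ ε * (η * (M J - entrySum _ J * M W)) := by linarith
  have h3 := le_of_mul_le_mul_left h2 h0
  have h4 : η * (M J - entrySum _ J * M W) ≤ -M W / 2 := by
    calc η * (M J - entrySum _ J * M W) ≤ η * (|M J - entrySum _ J * M W| + 1) := by
          gcongr
          linarith [le_abs_self (M J - entrySum _ J * M W)]
      _ = -M W / 2 := by
          rw [hη]
          field_simp
  linarith

theorem sq_add_sq_pos_of_lt {s e k : ℝ} (he : 0 < e) (hs : 0 ≤ s) (hk : -1 < k) :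
    0 < s ^ 2 + e ^ 2 + 2 * k * (e * s) := by
  rcases hs.eq_or_lt with rfl | hs
  · simp
    positivity
  · nlinarith [sq_nonneg (s - e), mul_pos (mul_pos he hs) (by linarith : 0 < k + 1)]

theorem null_quad_aux {A B E k₁ k₂ : ℝ} (hk : -1 < k₁) (h1 : k₁ ≤ 1) (h2 : -1 ≤ k₂)
    (h12 : k₂ ≤ -k₁) (hE : 0 < E) (hp : A ≤ 0 ∨ B ≤ 0)
    (h0 : A ^ 2 + B ^ 2 + E ^ 2 - 2 * (A * B) + 2 * k₁ * (A * E) + 2 * k₂ * (B * E) = 0) :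
    k₂ = -1 ∧ E = B - A := by
  have h21 : k₂ < 1 := by linarith
  rcases le_total 0 B with hB | hB
  · have hA : A ≤ 0 := by
      rcases hp with h | h
      · exact h
      · obtain rfl : B = 0 := le_antisymm h hB
        by_contra! hA
        have := sq_add_sq_pos_of_lt hE hA.le hk
        linarith
    have e1 := mul_nonneg (mul_nonneg (neg_nonneg.2 hA) hE.le) (sub_nonneg.2 h1)
    have e2 := mul_nonneg (mul_nonneg hB hE.le) (by linarith : 0 ≤ k₂ + 1)
    have e3 : (B - A - E) ^ 2 = 0 := le_antisymm (by linarith) (sq_nonneg _)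
    have e4 : E = B - A := by
      have := pow_eq_zero_iff two_ne_zero |>.1 e3
      linarith
    refine ⟨?_, e4⟩
    by_contra hne
    have hk2 : 0 < k₂ + 1 := by
      rcases h2.eq_or_lt with h | h
      · exact absurd h.symm hne
      · linarith
    rcases hB.eq_or_lt with rfl | hB
    · nlinarith [mul_pos hE hE]
    · nlinarith [mul_pos (mul_pos hB hE) hk2, sq_nonneg (B - A - E)]
  · rcases le_total 0 A with hA | hA
    · have := sq_add_sq_pos_of_lt hE (by linarith : 0 ≤ A - B) hk
      nlinarith [mul_nonneg (neg_nonneg.2 hB) hE.le]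
    · rcases le_total B A with hBA | hBA
      · have := sq_add_sq_pos_of_lt (k := -k₂) hE (by linarith : 0 ≤ A - B) (by linarith)
        nlinarith [mul_nonneg (mul_nonneg (neg_nonneg.2 hA) hE.le) (by linarith : 0 ≤ -k₁ - k₂)]
      · have e1 := mul_nonneg (mul_nonneg (neg_nonneg.2 hB) hE.le) (by linarith : 0 ≤ -k₁ - k₂)
        have e2 := mul_nonneg (mul_nonneg (sub_nonneg.2 hBA) hE.le) (sub_nonneg.2 h1)
        have e3 : (B - A - E) ^ 2 = 0 := le_antisymm (by linarith) (sq_nonneg _)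
        have e4 : E = B - A := by
          have := pow_eq_zero_iff two_ne_zero |>.1 e3
          linarith
        refine ⟨?_, e4⟩
        have e5 : E * E * (1 - k₁) ≤ 0 := by
          obtain rfl : A = B - E := by linarith
          linarith
        have e6 := nonpos_of_mul_nonpos_right e5 (mul_pos hE hE)
        linarith

theorem null_quad {A B E k₁ k₂ : ℝ} (hk : -1 < k₁) (h1 : k₁ ≤ 1) (h2 : -1 ≤ k₂)
    (h12 : k₂ ≤ -k₁) (hp : A ≤ 0 ∨ B ≤ 0 ∨ E ≤ 0) (hn : 0 ≤ A ∨ 0 ≤ B ∨ 0 ≤ E)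
    (h0 : A ^ 2 + B ^ 2 + E ^ 2 - 2 * (A * B) + 2 * k₁ * (A * E) + 2 * k₂ * (B * E) = 0) :
    (E = 0 ∧ A = B) ∨ k₂ = -1 ∧ E = B - A := by
  rcases lt_trichotomy E 0 with hE | rfl | hE
  · have := null_quad_aux (A := -A) (B := -B) (E := -E) hk h1 h2 h12 (by linarith)
      (by
        rcases hn with h | h | h
        · left; linarith
        · right; linarith
        · linarith) (by linarith)
    exact Or.inr ⟨this.1, by linarith [this.2]⟩
  · have : (A - B) ^ 2 = 0 := by linarith
    have := pow_eq_zero_iff two_ne_zero |>.1 this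
    exact Or.inl ⟨rfl, by linarith⟩
  · refine Or.inr (null_quad_aux hk h1 h2 h12 hE ?_ h0)
    rcases hp with h | h | h
    · exact Or.inl h
    · exact Or.inr h
    · linarith

theorem null_fork {A B C k : ℝ} (hk : -1 < k) (hk1 : k ≤ 1) (hp : A ≤ 0 ∨ B ≤ 0 ∨ C ≤ 0)
    (hn : 0 ≤ A ∨ 0 ≤ B ∨ 0 ≤ C)
    (h0 : A ^ 2 + B ^ 2 + C ^ 2 - 2 * (A * B) - 2 * (A * C) + 2 * k * (B * C) = 0) :
    A = B + C := by
  rcases le_or_gt (B * C) 0 with h | h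
  · have : (B + C - A) ^ 2 = 0 := le_antisymm
      (by nlinarith [mul_nonneg (neg_nonneg.2 h) (sub_nonneg.2 hk1)]) (sq_nonneg _)
    have := pow_eq_zero_iff two_ne_zero |>.1 this
    linarith
  · exfalso
    rcases pos_and_pos_or_neg_and_neg_of_mul_pos h with ⟨hB, hC⟩ | ⟨hB, hC⟩
    · have hA : A ≤ 0 := by
        rcases hp with h | h | h
        · exact h
        · linarith
        · linarith
      have := sq_add_sq_pos_of_lt hB hC.le hk
      nlinarith [mul_nonneg (neg_nonneg.2 hA) (add_pos hB hC).le]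
    · have hA : 0 ≤ A := by
        rcases hn with h | h | h
        · exact h
        · linarith
        · linarith
      have := sq_add_sq_pos_of_lt (neg_pos.2 hB) (neg_pos.2 hC).le hk
      nlinarith [mul_nonneg hA (add_pos (neg_pos.2 hB) (neg_pos.2 hC)).le]

theorem opposite_ends_pos {A B C E k k₁ k₂ k₃ : ℝ} (hA : 0 < A) (hB : 0 < B) (hC : 0 < C)
    (hE : 0 < E) (hk1 : -1 < k₁) (hk2 : k₂ ≤ 1) (hk3 : k₃ ≤ 1)
    (hN : ∀ E', 0 ≤ E' → E' ≤ E →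
      0 ≤ B ^ 2 + C ^ 2 + E' ^ 2 + 2 * k * (B * C) - 2 * k₂ * (B * E') - 2 * k₃ * (C * E')) :
    0 < A ^ 2 + B ^ 2 + C ^ 2 + E ^ 2 + 2 * (A * B) + 2 * (A * C) + 2 * k * (B * C)
      + 2 * k₁ * (A * E) - 2 * k₂ * (B * E) - 2 * k₃ * (C * E) := by
  have hAE := mul_pos (mul_pos hA hE) (by linarith : 0 < k₁ + 1)
  rcases le_total E (B + C) with h | h
  · have := hN E hE.le le_rfl
    nlinarith [mul_nonneg hA.le (sub_nonneg.2 h), mul_pos hA hA]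
  · have := hN (B + C) (by linarith) h
    nlinarith [sq_nonneg (E - B - C - A), mul_nonneg (sub_nonneg.2 h)
      (by nlinarith : 0 ≤ B * (1 - k₂) + C * (1 - k₃))]

theorem same_ends_null {A B C E k k₁ k₂ k₃ : ℝ} (hA : 0 < A) (hB : 0 < B) (hC : 0 < C)
    (hE : 0 < E) (hk : k ≤ 1) (hk2 : -1 ≤ k₂) (hk3 : -1 ≤ k₃) (h13 : k₃ ≤ -k₁)
    (hN : ∀ C', 0 ≤ C' → C' ≤ C →
      0 ≤ B ^ 2 + C' ^ 2 + E ^ 2 - 2 * k * (B * C') + 2 * k₂ * (B * E) - 2 * k₃ * (C' * E))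
    (h0 : A ^ 2 + B ^ 2 + C ^ 2 + E ^ 2 + 2 * (A * B) - 2 * (A * C) - 2 * k * (B * C)
      - 2 * k₁ * (A * E) + 2 * k₂ * (B * E) - 2 * k₃ * (C * E) = 0) :
    k = 1 ∧ k₁ = -k₃ ∧ C - (B + k₃ * E) = A ∧ E * (1 - k₃ ^ 2) + 2 * B * (k₂ - k₃) = 0 := by
  have hAE := mul_nonneg (mul_pos hA hE).le (by linarith : 0 ≤ -k₁ - k₃)
  rcases le_or_gt C (B + k₃ * E) with h | h
  · exfalso
    have := hN C hC.le le_rfl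
    nlinarith [mul_nonneg hA.le (sub_nonneg.2 h), mul_pos hA hA]
  · obtain ⟨C', hC', hQ⟩ : ∃ C', C' < C ∧
        0 ≤ E * (E * (1 - k₃ ^ 2) + 2 * B * (k₂ - k₃)) + 2 * (B * C') * (1 - k) := by
      rcases le_total 0 (B + k₃ * E) with h1 | h1
      · refine ⟨_, h, (hN _ h1 h.le).trans_eq ?_⟩
        ring
      · refine ⟨0, hC, ?_⟩
        have e0 : 0 ≤ E * (1 + k₃) := mul_nonneg hE.le (by linarith)
        have e1 := mul_nonneg (by linarith : 0 ≤ 1 + k₃) (by linarith : 0 ≤ E * (1 - k₃) - 2 * B)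
        have e2 := mul_nonneg hB.le (by linarith : 0 ≤ k₂ + 1)
        have e3 := mul_nonneg hE.le (by linarith : 0 ≤ (1 + k₃) * (E * (1 - k₃) - 2 * B)
          + 2 * (B * (k₂ + 1)))
        linarith
    have h1 : 0 ≤ 2 * (B * (C - C')) * (1 - k) :=
      mul_nonneg (by nlinarith [mul_pos hB (sub_pos.2 hC')]) (by linarith)
    have h2 := sq_nonneg (C - (B + k₃ * E) - A)
    have h3 : 2 * (B * (C - C')) * (1 - k) = 0 := by
      refine le_antisymm ?_ h1
      linarith
    have h4 : A * E * (-k₁ - k₃) = 0 := by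
      refine le_antisymm ?_ hAE
      linarith
    have h5 : (C - (B + k₃ * E) - A) ^ 2 = 0 := by
      refine le_antisymm ?_ h2
      linarith
    have hk' : k = 1 := by
      have : B * (C - C') ≠ 0 := (mul_pos hB (sub_pos.2 hC')).ne'
      have := (mul_eq_zero.1 h3).resolve_left (mul_ne_zero two_ne_zero this)
      linarith
    have h6 := (mul_eq_zero.1 h4).resolve_left (mul_pos hA hE).ne'
    have h7 := pow_eq_zero_iff two_ne_zero |>.1 h5
    refine ⟨hk', by linarith, by linarith, ?_⟩
    have h8 : E * (E * (1 - k₃ ^ 2) + 2 * B * (k₂ - k₃)) = 0 := by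
      subst hk'
      refine le_antisymm ?_ (by linarith)
      linarith
    exact (mul_eq_zero.1 h8).resolve_left hE.ne'

theorem InK.bform_eq_zero {ι : Type*} [Fintype ι] {D : ι → ι → ℝ} (h : InK D) {v u : ι → ℝ}
    (hv : IsCone v) (h0 : qform D v = 0) (hu : ∑ i, u i = 0) (hs : ∀ i, v i = 0 → u i = 0) :
    bform D v u = 0 := by
  have hev : ∀ᶠ s : ℝ in nhds 0, ∀ i, (v i ≤ 0 → v i + s * u i ≤ 0) ∧
      (0 ≤ v i → 0 ≤ v i + s * u i) := by
    rw [Filter.eventually_all]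
    intro i
    have hc : Filter.Tendsto (fun s : ℝ => v i + s * u i) (nhds 0) (nhds (v i)) := by
      have : Continuous fun s : ℝ => v i + s * u i := by fun_prop
      simpa using this.tendsto 0
    rcases lt_trichotomy (v i) 0 with hi | hi | hi
    · filter_upwards [hc.eventually_lt_const hi] with s hs
      exact ⟨fun _ => hs.le, fun h => absurd hi (not_lt.2 h)⟩
    · simp [hi, hs i hi]
    · filter_upwards [hc.eventually_const_lt hi] with s hs
      exact ⟨fun h => absurd hi (not_lt.2 h), fun _ => hs.le⟩
  have hmin : IsLocalMin (fun s : ℝ => s * (2 * bform D v u) + s ^ 2 * qform D u) 0 := by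
    filter_upwards [hev] with s hs
    have : IsCone (v + s • u) := by
      refine ⟨by simp [Finset.sum_add_distrib, ← Finset.mul_sum, hv.1, hu], fun i j k a b c => ?_⟩
      have := hv.2 i j k a b c
      exact ⟨this.1.imp (hs i).1 (Or.imp (hs j).1 (hs k).1),
        this.2.imp (hs i).2 (Or.imp (hs j).2 (hs k).2)⟩
    have := h.qform_nonneg this
    rw [qform_add h.symm, qform_smul, bform_smul_right, h0] at this
    simp only [zero_mul, ne_eq, OfNat.ofNat_ne_zero, not_false_eq_true, zero_pow, add_zero]
    linarith
  have hd : HasDerivAt (fun s : ℝ => s * (2 * bform D v u) + s ^ 2 * qform D u)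
      (1 * (2 * bform D v u) + (2 : ℕ) * 0 ^ (2 - 1) * qform D u) 0 :=
    ((hasDerivAt_id (0 : ℝ)).mul_const _).add ((hasDerivAt_pow 2 (0 : ℝ)).mul_const _)
  have := hmin.hasDerivAt_eq_zero hd
  simpa using this

/-- There is a nonconstant function orthogonal to all null vectors of the cone. -/
def HasPotential (D : Fin 5 → Fin 5 → ℝ) : Prop :=
  ∃ f : Fin 5 → ℝ, (∃ i j, f i ≠ f j) ∧ ∀ v, IsCone v → qform D v = 0 → ∑ i, f i * v i = 0

theorem InK.pos_of_not_pendant {ι : Type*} {D : ι → ι → ℝ} (h : InK D) {i j : ι}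
    (hp : ¬Pendant D i j) (hij : i ≠ j) : 0 < D i j := by
  refine (h.nonneg i j).lt_of_ne fun e => hp ⟨hij, fun k _ => ?_⟩
  have h1 := h.triangle i j k
  have h2 := h.triangle j i k
  rw [h.symm j i, ← e, Real.sqrt_zero] at h2
  rw [← e, Real.sqrt_zero] at h1 ⊢
  linarith

theorem InK.exists_coef {ι : Type*} {D : ι → ι → ℝ} (h : InK D) (o i j : ι) :
    ∃ k, -1 ≤ k ∧ k ≤ 1 ∧
      D i j = √(D o i) ^ 2 + √(D o j) ^ 2 - 2 * k * (√(D o i) * √(D o j)) := by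
  obtain ⟨u, h0, h2, hu⟩ := exists_ucoef (Real.sqrt_nonneg _) (Real.sqrt_nonneg _)
    (h.sub_sq_le o i j) (h.le_add_sq o i j)
  exact ⟨u - 1, by linarith, by linarith, by rw [hu]; ring⟩

theorem InK.coef_form_nonneg {ι : Type*} {D : ι → ι → ℝ} (h : InK D) {o i j l : ι}
    {a b e k k₁ k₂ : ℝ} (hi : D o i = a ^ 2) (hj : D o j = b ^ 2) (hl : D o l = e ^ 2)
    (hij : D i j = a ^ 2 + b ^ 2 - 2 * k * (a * b)) (hil : D i l = a ^ 2 + e ^ 2 - 2 * k₁ * (a * e))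
    (hjl : D j l = b ^ 2 + e ^ 2 - 2 * k₂ * (b * e)) {α β δ : ℝ} (hα : 0 ≤ α) (hβ : 0 ≤ β)
    (hδ : 0 ≤ δ) (hle : δ ≤ α + β) :
    0 ≤ (a * α) ^ 2 + (b * β) ^ 2 + (e * δ) ^ 2 + 2 * k * ((a * α) * (b * β))
      - 2 * k₁ * ((a * α) * (e * δ)) - 2 * k₂ * ((b * β) * (e * δ)) := by
  have := h.box_smul i j o l hα hβ (sub_nonneg.2 hle) hδ (by ring)
  rw [h.symm i o, h.symm j o, hi, hj, hl, hij, hil, hjl] at this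
  linarith

theorem InK.coef_le {ι : Type*} {D : ι → ι → ℝ} (h : InK D) {o i j l : ι}
    {a b e k k₁ k₂ : ℝ} (ha : 0 < a) (hb : 0 < b) (he : 0 < e)
    (hi : D o i = a ^ 2) (hj : D o j = b ^ 2) (hl : D o l = e ^ 2)
    (hij : D i j = a ^ 2 + b ^ 2 - 2 * k * (a * b)) (hil : D i l = a ^ 2 + e ^ 2 - 2 * k₁ * (a * e))
    (hjl : D j l = b ^ 2 + e ^ 2 - 2 * k₂ * (b * e)) (hk : k = -1) : k₂ ≤ -k₁ := by
  by_contra! hc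
  have hc : 0 < k₁ + k₂ := by linarith
  subst hk
  set δ := min (a + b) (a * b * (k₁ + k₂) / e) with hδ
  have hδ0 : 0 < δ := lt_min (by positivity) (by positivity)
  have h1 := h.coef_form_nonneg hi hj hl hij hil hjl hb.le ha.le hδ0.le
    ((min_le_left _ _).trans_eq (add_comm _ _))
  have h2 : e * δ ≤ a * b * (k₁ + k₂) := by
    calc e * δ ≤ e * (a * b * (k₁ + k₂) / e) := by
          gcongr
          exact min_le_right _ _
      _ = _ := by field_simp
  have h3 : 0 ≤ (e * δ) * (e * δ - 2 * (a * b * (k₁ + k₂))) := by linarith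
  have h4 := nonneg_of_mul_nonneg_right h3 (by positivity)
  have h5 : 0 < a * b * (k₁ + k₂) := by positivity
  linarith

/-- The point `1` is collinear with `0, 2` and with `0, 3`, with `0` in the middle. -/
structure Fork (W : Fin 5 → Fin 5 → ℝ) (a b c e k k₁ k₂ k₃ : ℝ) : Prop where
  inK : InK W
  ha : 0 < a
  hb : 0 < b
  hc : 0 < c
  he : 0 < e
  hk : -1 ≤ k
  hk' : k ≤ 1
  hk₁ : -1 < k₁
  hk₁' : k₁ ≤ 1
  hk₂ : -1 ≤ k₂
  hk₂' : k₂ ≤ -k₁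
  hk₃ : -1 ≤ k₃
  hk₃' : k₃ ≤ -k₁
  h01 : W 0 1 = a ^ 2
  h02 : W 0 2 = b ^ 2
  h03 : W 0 3 = c ^ 2
  h04 : W 0 4 = e ^ 2
  h12 : W 1 2 = a ^ 2 + b ^ 2 - 2 * (-1) * (a * b)
  h13 : W 1 3 = a ^ 2 + c ^ 2 - 2 * (-1) * (a * c)
  h23 : W 2 3 = b ^ 2 + c ^ 2 - 2 * k * (b * c)
  h14 : W 1 4 = a ^ 2 + e ^ 2 - 2 * k₁ * (a * e)
  h24 : W 2 4 = b ^ 2 + e ^ 2 - 2 * k₂ * (b * e)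
  h34 : W 3 4 = c ^ 2 + e ^ 2 - 2 * k₃ * (c * e)

theorem InK.exists_fork {W : Fin 5 → Fin 5 → ℝ} (h : InK W) (hp : ∀ i j, ¬Pendant W i j)
    (h12 : √(W 1 2) = √(W 0 1) + √(W 0 2)) (h13 : √(W 1 3) = √(W 0 1) + √(W 0 3)) :
    ∃ a b c e k k₁ k₂ k₃, Fork W a b c e k k₁ k₂ k₃ ∧ (k = -1 → -1 < k₂ ∧ -1 < k₃) := by
  have hpos : ∀ i : Fin 5, i ≠ 0 → 0 < √(W 0 i) := fun i hi =>
    Real.sqrt_pos.2 (h.pos_of_not_pendant (hp _ _) hi.symm)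
  have hsq : ∀ i j, √(W i j) ^ 2 = W i j := fun i j => Real.sq_sqrt (h.nonneg i j)
  have e12 : W 1 2 = √(W 0 1) ^ 2 + √(W 0 2) ^ 2 - 2 * (-1) * (√(W 0 1) * √(W 0 2)) := by
    rw [← hsq 1 2, h12]; ring
  have e13 : W 1 3 = √(W 0 1) ^ 2 + √(W 0 3) ^ 2 - 2 * (-1) * (√(W 0 1) * √(W 0 3)) := by
    rw [← hsq 1 3, h13]; ring
  obtain ⟨k, hk, hk', e23⟩ := h.exists_coef 0 2 3
  obtain ⟨k₁, hk₁, hk₁', e14⟩ := h.exists_coef 0 1 4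
  obtain ⟨k₂, hk₂, hk₂', e24⟩ := h.exists_coef 0 2 4
  obtain ⟨k₃, hk₃, hk₃', e34⟩ := h.exists_coef 0 3 4
  have hadd : ∀ {i j : Fin 5} {k : ℝ}, k = -1 →
      W i j = √(W 0 i) ^ 2 + √(W 0 j) ^ 2 - 2 * k * (√(W 0 i) * √(W 0 j)) →
      √(W i j) = √(W i 0) + √(W 0 j) := by
    intro i j k hk hw
    rw [hw, hk, h.symm i 0, ← Real.sqrt_sq (add_nonneg (Real.sqrt_nonneg _) (Real.sqrt_nonneg _))]
    congr 1
    ring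
  have hadd' : ∀ {i j : Fin 5} {k : ℝ}, k = -1 →
      W i j = √(W 0 i) ^ 2 + √(W 0 j) ^ 2 - 2 * k * (√(W 0 i) * √(W 0 j)) →
      √(W j i) = √(W j 0) + √(W 0 i) := by
    intro i j k hk hw
    rw [h.symm j i, hadd hk hw, h.symm j 0, h.symm i 0, add_comm]
  have h00 : ∀ i, √(W i 0) = √(W i 0) + √(W 0 0) := fun i => by simp [h.diag]
  have hlt : ∀ {i : Fin 5}, i ≠ 0 → (∀ j, j ≠ i → j ≠ 0 → √(W i j) = √(W i 0) + √(W 0 j)) →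
      False := by
    intro i hi hj
    refine hp i 0 ⟨hi, fun l hl => ?_⟩
    by_cases hl0 : l = 0
    · rw [hl0]; exact h00 i
    · exact hj l hl hl0
  refine ⟨_, _, _, _, k, k₁, k₂, k₃, ⟨h, hpos 1 (by decide), hpos 2 (by decide), hpos 3 (by decide),
    hpos 4 (by decide), hk, hk', hk₁.lt_of_ne' fun hk₁ => ?_, hk₁', hk₂, ?_, hk₃, ?_,
    (hsq _ _).symm, (hsq _ _).symm, (hsq _ _).symm, (hsq _ _).symm, e12, e13, e23, e14, e24, e34⟩,
    fun hk => ⟨hk₂.lt_of_ne' fun hk₂ => ?_, hk₃.lt_of_ne' fun hk₃ => ?_⟩⟩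
  · refine hlt (i := 1) (by decide) fun j hj hj0 => ?_
    fin_cases j
    · exact absurd rfl hj0
    · exact absurd rfl hj
    · exact hadd rfl e12
    · exact hadd rfl e13
    · exact hadd hk₁ e14
  · exact h.coef_le (hpos 1 (by decide)) (hpos 2 (by decide)) (hpos 4 (by decide)) (hsq _ _).symm
      (hsq _ _).symm (hsq _ _).symm e12 e14 e24 rfl
  · exact h.coef_le (hpos 1 (by decide)) (hpos 3 (by decide)) (hpos 4 (by decide)) (hsq _ _).symm
      (hsq _ _).symm (hsq _ _).symm e13 e14 e34 rfl
  · refine hlt (i := 2) (by decide) fun j hj hj0 => ?_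
    fin_cases j
    · exact absurd rfl hj0
    · exact hadd' rfl e12
    · exact absurd rfl hj
    · exact hadd hk e23
    · exact hadd hk₂ e24
  · refine hlt (i := 3) (by decide) fun j hj hj0 => ?_
    fin_cases j
    · exact absurd rfl hj0
    · exact hadd' rfl e13
    · exact hadd' hk e23
    · exact absurd rfl hj
    · exact hadd hk₃ e34

namespace Fork

variable {W : Fin 5 → Fin 5 → ℝ} {a b c e k k₁ k₂ k₃ : ℝ} {v u : Fin 5 → ℝ}

theorem bform_eq (F : Fork W a b c e k k₁ k₂ k₃) (hv : ∑ i, v i = 0) (hu : ∑ i, u i = 0) :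
    bform W v u = a * v 1 * (a * u 1) + b * v 2 * (b * u 2) + c * v 3 * (c * u 3)
      + e * v 4 * (e * u 4) - (a * v 1 * (b * u 2) + b * v 2 * (a * u 1))
      - (a * v 1 * (c * u 3) + c * v 3 * (a * u 1))
      + k * (b * v 2 * (c * u 3) + c * v 3 * (b * u 2))
      + k₁ * (a * v 1 * (e * u 4) + e * v 4 * (a * u 1))
      + k₂ * (b * v 2 * (e * u 4) + e * v 4 * (b * u 2))
      + k₃ * (c * v 3 * (e * u 4) + e * v 4 * (c * u 3)) := by
  have h := F.inK
  have hv0 : v 0 = -(v 1 + v 2 + v 3 + v 4) := by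
    rw [Fin.sum_univ_five] at hv; linarith
  have hu0 : u 0 = -(u 1 + u 2 + u 3 + u 4) := by
    rw [Fin.sum_univ_five] at hu; linarith
  simp only [bform, Fin.sum_univ_five, h.diag, h.symm 1 0, h.symm 2 0, h.symm 3 0, h.symm 4 0,
    h.symm 2 1, h.symm 3 1, h.symm 4 1, h.symm 3 2, h.symm 4 2, h.symm 4 3, F.h01, F.h02, F.h03,
    F.h04, F.h12, F.h13, F.h23, F.h14, F.h24, F.h34, hv0, hu0]
  ring

theorem qform_eq (F : Fork W a b c e k k₁ k₂ k₃) (hv : ∑ i, v i = 0) :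
    qform W v = (a * v 1) ^ 2 + (b * v 2) ^ 2 + (c * v 3) ^ 2 + (e * v 4) ^ 2
      - 2 * (a * v 1 * (b * v 2)) - 2 * (a * v 1 * (c * v 3)) + 2 * k * (b * v 2 * (c * v 3))
      + 2 * k₁ * (a * v 1 * (e * v 4)) + 2 * k₂ * (b * v 2 * (e * v 4))
      + 2 * k₃ * (c * v 3 * (e * v 4)) := by
  rw [qform, F.bform_eq hv hv]
  ring

theorem strict_null_of_neg (F : Fork W a b c e k k₁ k₂ k₃) (hv : IsCone v) (hq : qform W v = 0)
    (h0 : v 0 = 0) (h1 : v 1 < 0) (h2 : v 2 ≠ 0) (h3 : v 3 ≠ 0) (h4 : v 4 ≠ 0) :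
    k = 1 ∧ k₂ = -1 ∧ k₃ = -1 ∧ -(a * v 1) + b * v 2 + c * v 3 - e * v 4 = 0 := by
  have h := F.inK
  have ha := F.ha
  have hb := F.hb
  have hc := F.hc
  have he := F.he
  have hk₁ := F.hk₁
  have hk₂' := F.hk₂'
  have hk₃' := F.hk₃'
  have hs : v 1 + v 2 + v 3 + v 4 = 0 := by
    have := hv.1
    rw [Fin.sum_univ_five, h0] at this
    linarith
  have hA : 0 < -(a * v 1) := by nlinarith
  have hq' := F.qform_eq hv.1
  have hker : k = 1 → k₁ * a * (c - b) - k₂ * b * (a + c) + k₃ * c * (a + b) = 0 := by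
    intro hk
    have hu : ∑ i, ![0, c - b, -(a + c), a + b, 0] i = 0 := by
      simp [Fin.sum_univ_five]; ring
    have := h.bform_eq_zero hv hq hu (by
      intro i hi
      fin_cases i
      · rfl
      · exact absurd hi h1.ne
      · exact absurd hi h2
      · exact absurd hi h3
      · exact absurd hi h4)
    rw [F.bform_eq hv.1 hu, hk] at this
    simp at this
    have : e * v 4 * (k₁ * a * (c - b) - k₂ * b * (a + c) + k₃ * c * (a + b)) = 0 := by
      linarith
    exact (mul_eq_zero.1 this).resolve_left (mul_ne_zero he.ne' h4)
  have hpos : ¬(0 < v 2 ∧ 0 < v 3 ∧ 0 < v 4) := by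
    rintro ⟨p2, p3, p4⟩
    rcases (hv.2 2 3 4 (by decide) (by decide) (by decide)).1 with h | h | h <;> linarith
  have hneg : ∀ i j : Fin 5, 1 ≠ i → 1 ≠ j → i ≠ j → v i < 0 → 0 ≤ v j := by
    intro i j hi hj hij hn
    rcases (hv.2 1 i j hi hj hij).2 with h | h | h <;> linarith
  rcases lt_or_gt_of_ne h2 with n2 | p2
  · have p3 := (hneg 2 3 (by decide) (by decide) (by decide) n2).lt_of_ne' h3
    have p4 := (hneg 2 4 (by decide) (by decide) (by decide) n2).lt_of_ne' h4
    obtain ⟨e1, e2, e3, e4⟩ := same_ends_null (B := c * v 3) (C := -(b * v 2)) (E := e * v 4)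
      (k := k) (k₁ := k₁) (k₂ := k₃) (k₃ := k₂) hA (by positivity) (by nlinarith) (by positivity)
      F.hk' F.hk₃ F.hk₂ F.hk₂' (by
        intro C' hC hC'
        have := h.coef_form_nonneg (o := 0) (i := 3) (j := 4) (l := 2) F.h03 F.h04 F.h02 F.h34
          (k₁ := k) (by rw [h.symm, F.h23]; ring) (k₂ := k₂) (by rw [h.symm, F.h24]; ring) p3.le p4.le
          (δ := C' / b) (by positivity) (by
            rw [div_le_iff₀ hb]
            nlinarith)
        rw [mul_div_cancel₀ _ hb.ne'] at this
        linarith) (by linarith)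
    have hkk := hker e1
    have h23 : k₃ = k₂ := by
      have : c * (a + b) * (k₃ - k₂) = 0 := by rw [e2] at hkk; linarith
      have := (mul_eq_zero.1 this).resolve_left (by positivity)
      linarith
    rw [h23, sub_self, mul_zero, add_zero] at e4
    have e5 := (mul_eq_zero.1 e4).resolve_left (by positivity)
    have e6 : (1 - k₂) * (1 + k₂) = 0 := by linarith
    have e7 := (mul_eq_zero.1 e6).resolve_left (by linarith)
    have e8 : k₂ = -1 := by linarith
    refine ⟨e1, e8, by linarith, ?_⟩
    rw [e8] at e3
    linarith
  rcases lt_or_gt_of_ne h3 with n3 | p3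
  · have p4 := (hneg 3 4 (by decide) (by decide) (by decide) n3).lt_of_ne' h4
    obtain ⟨e1, e2, e3, e4⟩ := same_ends_null (B := b * v 2) (C := -(c * v 3)) (E := e * v 4)
      (k := k) (k₁ := k₁) (k₂ := k₂) (k₃ := k₃) hA (by positivity) (by nlinarith) (by positivity)
      F.hk' F.hk₂ F.hk₃ F.hk₃' (by
        intro C' hC hC'
        have := h.coef_form_nonneg (o := 0) (i := 2) (j := 4) (l := 3) F.h02 F.h04 F.h03 F.h24
          F.h23 (k₂ := k₃) (by rw [h.symm, F.h34]; ring) p2.le p4.le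
          (δ := C' / c) (by positivity) (by
            rw [div_le_iff₀ hc]
            nlinarith)
        rw [mul_div_cancel₀ _ hc.ne'] at this
        linarith) (by linarith)
    have hkk := hker e1
    have h23 : k₂ = k₃ := by
      have : b * (a + c) * (k₃ - k₂) = 0 := by rw [e2] at hkk; linarith
      have := (mul_eq_zero.1 this).resolve_left (by positivity)
      linarith
    rw [h23, sub_self, mul_zero, add_zero] at e4
    have e5 := (mul_eq_zero.1 e4).resolve_left (by positivity)
    have e6 : (1 - k₃) * (1 + k₃) = 0 := by linarith
    have e7 := (mul_eq_zero.1 e6).resolve_left (by linarith)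
    have e8 : k₃ = -1 := by linarith
    refine ⟨e1, by linarith, e8, ?_⟩
    rw [e8] at e3
    linarith
  · have n4 : v 4 < 0 := by
      by_contra! h5
      exact hpos ⟨p2, p3, h5.lt_of_ne' h4⟩
    have := opposite_ends_pos (B := b * v 2) (C := c * v 3) (E := -(e * v 4)) (k := k) (k₁ := k₁)
      (k₂ := k₂) (k₃ := k₃) hA (by positivity) (by positivity) (by nlinarith)
      F.hk₁ (by linarith) (by linarith) (by
        intro C' hC hC'
        have := h.coef_form_nonneg (o := 0) (i := 2) (j := 3) (l := 4) F.h02 F.h03 F.h04 F.h23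
          F.h24 F.h34 p2.le p3.le (δ := C' / e) (by positivity) (by
            rw [div_le_iff₀ he]
            nlinarith)
        rw [mul_div_cancel₀ _ he.ne'] at this
        linarith)
    exfalso
    linarith

theorem strict_null (F : Fork W a b c e k k₁ k₂ k₃) (hv : IsCone v) (hq : qform W v = 0)
    (h0 : v 0 = 0) (h1 : v 1 ≠ 0) (h2 : v 2 ≠ 0) (h3 : v 3 ≠ 0) (h4 : v 4 ≠ 0) :
    k = 1 ∧ k₂ = -1 ∧ k₃ = -1 ∧ -(a * v 1) + b * v 2 + c * v 3 - e * v 4 = 0 := by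
  rcases lt_or_gt_of_ne h1 with h1 | h1
  · exact F.strict_null_of_neg hv hq h0 h1 h2 h3 h4
  · have := F.strict_null_of_neg hv.neg (by rwa [qform_neg]) (by simpa) (by simpa) (by simpa)
      (by simpa) (by simpa)
    refine ⟨this.1, this.2.1, this.2.2.1, ?_⟩
    have := this.2.2.2
    simp only [Pi.neg_apply] at this
    linarith

end Fork

theorem IsCone.exists_scaled {v : Fin 5 → ℝ} (hv : IsCone v) {i j l : Fin 5} {a b c : ℝ}
    (ha : 0 < a) (hb : 0 < b) (hc : 0 < c) (hij : i ≠ j) (hil : i ≠ l) (hjl : j ≠ l) :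
    (a * v i ≤ 0 ∨ b * v j ≤ 0 ∨ c * v l ≤ 0) ∧ (0 ≤ a * v i ∨ 0 ≤ b * v j ∨ 0 ≤ c * v l) := by
  have := hv.2 i j l hij hil hjl
  have hn : ∀ {a : ℝ}, 0 < a → ∀ x, a * x ≤ 0 ↔ x ≤ 0 := fun ha x => by
    rw [← not_lt, mul_pos_iff_of_pos_left ha, not_lt]
  simpa only [mul_nonneg_iff_of_pos_left, hn, ha, hb, hc] using this

theorem exists_three_eq (p : Fin 5 → Bool) :
    ∃ i j k, i ≠ j ∧ i ≠ k ∧ j ≠ k ∧ p i = p j ∧ p i = p k := by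
  revert p
  decide

theorem IsCone.exists_eq_zero {v : Fin 5 → ℝ} (hv : IsCone v) : ∃ i, v i = 0 := by
  by_contra! h
  obtain ⟨i, j, k, hij, hik, hjk, e1, e2⟩ := exists_three_eq fun i => decide (0 < v i)
  have hc := hv.2 i j k hij hik hjk
  have hn : ∀ i, 0 ≤ v i ↔ 0 < v i := fun i => ⟨fun h' => h'.lt_of_ne' (h i), le_of_lt⟩
  simp only [decide_eq_decide] at e1 e2
  simp only [hn, ← not_lt] at hc
  simp only [not_lt, ← e1, ← e2, or_self] at hc
  exact absurd hc.2 (not_lt.2 hc.1)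

namespace Fork

variable {W : Fin 5 → Fin 5 → ℝ} {a b c e k k₁ k₂ k₃ : ℝ} {v u : Fin 5 → ℝ}

theorem null_two (F : Fork W a b c e k k₁ k₂ k₃) (hv : IsCone v) (hq : qform W v = 0)
    (h2 : v 2 = 0) : (e * v 4 = 0 ∧ a * v 1 = c * v 3) ∨ k₃ = -1 ∧ e * v 4 = c * v 3 - a * v 1 := by
  have hs := hv.exists_scaled F.ha F.hc F.he (i := 1) (j := 3) (l := 4) (by decide) (by decide)
    (by decide)
  refine null_quad F.hk₁ F.hk₁' F.hk₃ F.hk₃' hs.1 hs.2 ?_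
  rw [F.qform_eq hv.1, h2] at hq
  linarith

theorem null_three (F : Fork W a b c e k k₁ k₂ k₃) (hv : IsCone v) (hq : qform W v = 0)
    (h3 : v 3 = 0) : (e * v 4 = 0 ∧ a * v 1 = b * v 2) ∨ k₂ = -1 ∧ e * v 4 = b * v 2 - a * v 1 := by
  have hs := hv.exists_scaled F.ha F.hb F.he (i := 1) (j := 2) (l := 4) (by decide) (by decide)
    (by decide)
  refine null_quad F.hk₁ F.hk₁' F.hk₂ F.hk₂' hs.1 hs.2 ?_
  rw [F.qform_eq hv.1, h3] at hq
  linarith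

theorem null_four (F : Fork W a b c e k k₁ k₂ k₃) (hk : -1 < k) (hv : IsCone v)
    (hq : qform W v = 0) (h4 : v 4 = 0) : a * v 1 = b * v 2 + c * v 3 := by
  have hs := hv.exists_scaled F.ha F.hb F.hc (i := 1) (j := 2) (l := 3) (by decide) (by decide)
    (by decide)
  refine null_fork hk F.hk' hs.1 hs.2 ?_
  rw [F.qform_eq hv.1, h4] at hq
  linarith

theorem hasPotential_of_eq_neg_one (F : Fork W a b c e k k₁ k₂ k₃) (hk : k = -1) (hk₂ : -1 < k₂)
    (hk₃ : -1 < k₃) : HasPotential W := by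
  refine ⟨![0, 0, 0, 0, 1], ⟨0, 4, by simp⟩, fun v hv hq => ?_⟩
  suffices e * v 4 = 0 by simpa [Fin.sum_univ_five, F.he.ne'] using this
  by_cases h4 : v 4 = 0
  · simp [h4]
  by_cases h2 : v 2 = 0
  · rcases F.null_two hv hq h2 with h | h
    · exact h.1
    · linarith
  by_cases h3 : v 3 = 0
  · rcases F.null_three hv hq h3 with h | h
    · exact h.1
    · linarith
  by_cases h1 : v 1 = 0
  · have hle : k₃ ≤ -k₂ := F.inK.coef_le F.hb F.hc F.he F.h02 F.h03 F.h04 F.h23 F.h24 F.h34 hk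
    have hs := hv.exists_scaled F.hb F.hc F.he (i := 2) (j := 3) (l := 4) (by decide) (by decide)
      (by decide)
    have h0 := F.qform_eq hv.1
    rw [hq, h1, hk] at h0
    rcases null_quad (A := b * v 2) (B := c * v 3) (E := e * v 4) (k₁ := k₂) hk₂
      (by linarith [F.hk₂', F.hk₁]) F.hk₃ hle hs.1 hs.2 (by linarith) with h | h
    · exact h.1
    · linarith
  · obtain ⟨i, hi⟩ := hv.exists_eq_zero
    have h0 : v 0 = 0 := by
      fin_cases i
      · exact hi
      · exact absurd hi h1
      · exact absurd hi h2
      · exact absurd hi h3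
      · exact absurd hi h4
    have := F.strict_null hv hq h0 h1 h2 h3 h4
    linarith

theorem hasPotential_of_line (F : Fork W a b c e k k₁ k₂ k₃) (hk : -1 < k)
    (h : k₂ = -1 ∨ k₃ = -1) : HasPotential W := by
  refine ⟨![0, -a, b, c, -e], ⟨0, 1, by simpa using F.ha.ne'⟩, fun v hv hq => ?_⟩
  suffices -(a * v 1) + b * v 2 + c * v 3 - e * v 4 = 0 by
    simp [Fin.sum_univ_five]
    linarith
  by_cases h4 : v 4 = 0
  · have := F.null_four hk hv hq h4
    rw [h4]
    linarith
  by_cases h2 : v 2 = 0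
  · rw [h2]
    rcases F.null_two hv hq h2 with h | h <;> linarith
  by_cases h3 : v 3 = 0
  · rw [h3]
    rcases F.null_three hv hq h3 with h | h <;> linarith
  by_cases h1 : v 1 = 0
  · have h0 := F.qform_eq hv.1
    rw [hq, h1] at h0
    rw [h1]
    rcases h with h | h
    · have hle : k₃ ≤ -k := F.inK.coef_le F.hb F.he F.hc F.h02 F.h04 F.h03 F.h24 F.h23
        (by rw [F.inK.symm, F.h34]; ring) h
      have hs := hv.exists_scaled F.hb F.he F.hc (i := 2) (j := 4) (l := 3) (by decide) (by decide)
        (by decide)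
      rw [h] at h0
      rcases null_quad (A := b * v 2) (B := e * v 4) (E := c * v 3) (k₁ := k) hk
        F.hk' F.hk₃ hle hs.1 hs.2 (by linarith) with h | h <;> linarith
    · have hle : k₂ ≤ -k := F.inK.coef_le F.hc F.he F.hb F.h03 F.h04 F.h02 F.h34
        (by rw [F.inK.symm, F.h23]; ring) (by rw [F.inK.symm, F.h24]; ring) h
      have hs := hv.exists_scaled F.hc F.he F.hb (i := 3) (j := 4) (l := 2) (by decide) (by decide)
        (by decide)
      rw [h] at h0
      rcases null_quad (A := c * v 3) (B := e * v 4) (E := b * v 2) (k₁ := k) hk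
        F.hk' F.hk₂ hle hs.1 hs.2 (by linarith) with h | h <;> linarith
  · obtain ⟨i, hi⟩ := hv.exists_eq_zero
    have h0 : v 0 = 0 := by
      fin_cases i
      · exact hi
      · exact absurd hi h1
      · exact absurd hi h2
      · exact absurd hi h3
      · exact absurd hi h4
    exact (F.strict_null hv hq h0 h1 h2 h3 h4).2.2.2

theorem null_of_ne (F : Fork W a b c e k k₁ k₂ k₃) (hk : -1 < k) (hk₂ : -1 < k₂) (hk₃ : -1 < k₃)
    (hv : IsCone v) (hq : qform W v = 0) :
    (v 4 = 0 ∧ a * v 1 = b * v 2 + c * v 3) ∨ v 1 = 0 ∧ v 2 ≠ 0 ∧ v 3 ≠ 0 ∧ v 4 ≠ 0 := by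
  by_cases h4 : v 4 = 0
  · exact Or.inl ⟨h4, F.null_four hk hv hq h4⟩
  have he := F.he.ne'
  by_cases h2 : v 2 = 0
  · rcases F.null_two hv hq h2 with h | h
    · exact absurd ((mul_eq_zero.1 h.1).resolve_left he) h4
    · linarith
  by_cases h3 : v 3 = 0
  · rcases F.null_three hv hq h3 with h | h
    · exact absurd ((mul_eq_zero.1 h.1).resolve_left he) h4
    · linarith
  by_cases h1 : v 1 = 0
  · exact Or.inr ⟨h1, h2, h3, h4⟩
  · obtain ⟨i, hi⟩ := hv.exists_eq_zero
    have h0 : v 0 = 0 := by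
      fin_cases i
      · exact hi
      · exact absurd hi h1
      · exact absurd hi h2
      · exact absurd hi h3
      · exact absurd hi h4
    have := F.strict_null hv hq h0 h1 h2 h3 h4
    linarith

theorem proportional (F : Fork W a b c e k k₁ k₂ k₃) (hk₃ : -1 < k₃) (hv : IsCone v)
    (hq : qform W v = 0) (hu : IsCone u) (hq' : qform W u = 0) (hv1 : v 1 = 0) (hv2 : v 2 ≠ 0)
    (hv3 : v 3 ≠ 0) (hv4 : v 4 ≠ 0) (hu1 : u 1 = 0) (hu2 : u 2 ≠ 0) (hu3 : u 3 ≠ 0)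
    (hu4 : u 4 ≠ 0) : ∃ t, v 2 = t * u 2 ∧ v 3 = t * u 3 ∧ v 4 = t * u 4 := by
  have hb : bform W v u = 0 := by
    by_cases h0 : v 0 = 0
    · rw [bform_comm F.inK.symm]
      refine F.inK.bform_eq_zero hu hq' hv.1 fun i hi => ?_
      fin_cases i
      · exact h0
      · exact hv1
      · exact absurd hi hu2
      · exact absurd hi hu3
      · exact absurd hi hu4
    · refine F.inK.bform_eq_zero hv hq hu.1 fun i hi => ?_
      fin_cases i
      · exact absurd hi h0
      · exact hu1
      · exact absurd hi hv2
      · exact absurd hi hv3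
      · exact absurd hi hv4
  set t := v 2 / u 2 with ht
  have ht2 : v 2 = t * u 2 := by rw [ht, div_mul_cancel₀ _ hu2]
  have hw : qform W (v + (-t) • u) = 0 := by
    rw [qform_add F.inK.symm, bform_smul_right, qform_smul, hq, hq', hb]
    simp
  have hsum : ∑ i, (v + (-t) • u) i = 0 := by
    simp only [Pi.add_apply, Pi.smul_apply, smul_eq_mul, Finset.sum_add_distrib, ← Finset.mul_sum,
      hv.1, hu.1]
    simp
  rw [F.qform_eq hsum] at hw
  simp only [Pi.add_apply, Pi.smul_apply, smul_eq_mul, hv1, hu1, ht2] at hw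
  set C := c * (v 3 + -t * u 3) with hC
  set E := e * (v 4 + -t * u 4) with hE
  have hk : k₃ < 1 := by linarith [F.hk₃', F.hk₁]
  have h0 : C ^ 2 + E ^ 2 + 2 * k₃ * (C * E) = 0 := by linarith
  have h1 : (C + k₃ * E) ^ 2 + (1 - k₃) * (1 + k₃) * E ^ 2 = 0 := by linarith
  have hpos : 0 < (1 - k₃) * (1 + k₃) := mul_pos (by linarith) (by linarith)
  have h2 : E ^ 2 = 0 := by
    have := mul_nonneg hpos.le (sq_nonneg E)
    have h3 : (1 - k₃) * (1 + k₃) * E ^ 2 = 0 := by linarith [sq_nonneg (C + k₃ * E)]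
    exact (mul_eq_zero.1 h3).resolve_left hpos.ne'
  have h3 : E = 0 := pow_eq_zero_iff two_ne_zero |>.1 h2
  have h4 : C = 0 := by
    rw [h3] at h0
    exact pow_eq_zero_iff two_ne_zero |>.1 (by linarith : C ^ 2 = 0)
  refine ⟨t, ht2, ?_, ?_⟩
  · have := (mul_eq_zero.1 (hC.symm.trans h4)).resolve_left F.hc.ne'
    linarith
  · have := (mul_eq_zero.1 (hE.symm.trans h3)).resolve_left F.he.ne'
    linarith

theorem hasPotential_of_ne (F : Fork W a b c e k k₁ k₂ k₃) (hk : -1 < k) (hk₂ : -1 < k₂)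
    (hk₃ : -1 < k₃) : HasPotential W := by
  by_cases hex : ∃ u, IsCone u ∧ qform W u = 0 ∧ u 1 = 0 ∧ u 2 ≠ 0 ∧ u 3 ≠ 0 ∧ u 4 ≠ 0
  · obtain ⟨u, hu, hq', hu1, hu2, hu3, hu4⟩ := hex
    refine ⟨![0, -(e * u 4 * a), e * u 4 * b, e * u 4 * c, -(b * u 2 + c * u 3) * e],
      ⟨0, 1, by simpa using ⟨⟨F.he.ne', hu4⟩, F.ha.ne'⟩⟩, fun v hv hq => ?_⟩
    suffices e * u 4 * (-(a * v 1) + b * v 2 + c * v 3) - (b * u 2 + c * u 3) * (e * v 4) = 0 by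
      simp [Fin.sum_univ_five]
      linarith
    rcases F.null_of_ne hk hk₂ hk₃ hv hq with ⟨h4, h⟩ | ⟨h1, h2, h3, h4⟩
    · rw [h4, h]
      ring
    · obtain ⟨t, e2, e3, e4⟩ := F.proportional hk₃ hv hq hu hq' h1 h2 h3 h4 hu1 hu2 hu3 hu4
      rw [h1, e2, e3, e4]
      ring
  · refine ⟨![0, -a, b, c, 0], ⟨0, 1, by simpa using F.ha.ne'⟩, fun v hv hq => ?_⟩
    rcases F.null_of_ne hk hk₂ hk₃ hv hq with ⟨h4, h⟩ | ⟨h1, h2, h3, h4⟩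
    · simp [Fin.sum_univ_five]
      linarith
    · exact absurd ⟨v, hv, hq, h1, h2, h3, h4⟩ hex

end Fork

theorem HasPotential.of_comp {W : Fin 5 → Fin 5 → ℝ} (σ : Equiv.Perm (Fin 5))
    (h : HasPotential fun i j => W (σ i) (σ j)) : HasPotential W := by
  obtain ⟨f, ⟨i, j, hij⟩, hf⟩ := h
  refine ⟨f ∘ σ.symm, ⟨σ i, σ j, by simpa using hij⟩, fun v hv hq => ?_⟩
  have := hf (v ∘ σ) (hv.comp σ) (by rwa [qform_comp])
  rw [← this, ← Equiv.sum_comp σ]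
  simp

theorem Pendant.of_comp {ι : Type*} {W : ι → ι → ℝ} (σ : Equiv.Perm ι) {i j : ι}
    (h : Pendant (fun i j => W (σ i) (σ j)) i j) : Pendant W (σ i) (σ j) := by
  refine ⟨by simpa using h.1, fun k hk => ?_⟩
  have := h.2 (σ.symm k) (by rintro rfl; simp at hk)
  simpa using this

theorem exists_perm_four {i j k l : Fin 5} (hij : i ≠ j) (hik : i ≠ k) (hil : i ≠ l) (hjk : j ≠ k)
    (hjl : j ≠ l) (hkl : k ≠ l) :
    ∃ σ : Equiv.Perm (Fin 5), σ 0 = i ∧ σ 1 = j ∧ σ 2 = k ∧ σ 3 = l := by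
  have hinj : Function.Injective ![i, j, k, l] := by
    intro x y h
    fin_cases x <;> fin_cases y <;> simp_all
  obtain ⟨σ, hσ⟩ := Equiv.Perm.exists_extending_pair (fun x : Fin 4 => x.castSucc) ![i, j, k, l]
    (Fin.castSucc_injective 4) hinj
  exact ⟨σ, hσ 0, hσ 1, hσ 2, hσ 3⟩

theorem InK.hasPotential_of_fork {W : Fin 5 → Fin 5 → ℝ} (h : InK W) (hp : ∀ i j, ¬Pendant W i j)
    {o i j l : Fin 5} (hoi : o ≠ i) (hoj : o ≠ j) (hol : o ≠ l) (hij : i ≠ j) (hil : i ≠ l)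
    (hjl : j ≠ l) (h1 : √(W i j) = √(W o i) + √(W o j)) (h2 : √(W i l) = √(W o i) + √(W o l)) :
    HasPotential W := by
  obtain ⟨σ, rfl, rfl, rfl, rfl⟩ := exists_perm_four hoi hoj hol hij hil hjl
  refine HasPotential.of_comp σ ?_
  obtain ⟨a, b, c, e, k, k₁, k₂, k₃, F, hF⟩ :=
    (h.comp σ).exists_fork (fun i j hij => hp _ _ (hij.of_comp σ)) h1 h2
  rcases F.hk.eq_or_lt with hk | hk
  · exact F.hasPotential_of_eq_neg_one hk.symm (hF hk.symm).1 (hF hk.symm).2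
  rcases F.hk₂.eq_or_lt with hk₂ | hk₂
  · exact F.hasPotential_of_line hk (Or.inl hk₂.symm)
  rcases F.hk₃.eq_or_lt with hk₃ | hk₃
  · exact F.hasPotential_of_line hk (Or.inr hk₃.symm)
  · exact F.hasPotential_of_ne hk hk₂ hk₃

theorem IsCone.of_signs {ι : Type*} [Fintype ι] {u : ι → ℝ} {p q r s : ι} (h : ∑ i, u i = 0)
    (hp : ∀ i, 0 < u i → i = p ∨ i = q) (hn : ∀ i, u i < 0 → i = r ∨ i = s) : IsCone u := by
  refine ⟨h, fun i j k hij hik hjk => ⟨?_, ?_⟩⟩ <;> by_contra! h'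
  · have hi := hp i h'.1
    have hj := hp j h'.2.1
    have hk := hp k h'.2.2
    grind
  · have hi := hn i h'.1
    have hj := hn j h'.2.1
    have hk := hn k h'.2.2
    grind

section Axis

/-- The coordinate of the point `i` along the line through the points `0` and `4`. -/
noncomputable def axisCoord (W : Fin 5 → Fin 5 → ℝ) (i : Fin 5) : ℝ :=
  (W 0 i + W 0 4 - W i 4) / (2 * √(W 0 4))

/-- The Gram matrix of the components orthogonal to the line through the points `0` and `4`. -/
noncomputable def offAxis (W : Fin 5 → Fin 5 → ℝ) (i j : Fin 5) : ℝ :=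
  (W 0 i + W 0 j - W i j) / 2 - axisCoord W i * axisCoord W j

variable {W : Fin 5 → Fin 5 → ℝ}

theorem bform_eq_gram {ι : Type*} [Fintype ι] {D : ι → ι → ℝ} (o : ι) {v u : ι → ℝ}
    (hv : ∑ i, v i = 0) (hu : ∑ i, u i = 0) :
    bform D v u = ∑ i, ∑ j, (D o i + D o j - D i j) / 2 * (v i * u j) := by
  have h1 : ∑ i, ∑ j, D o i / 2 * (v i * u j) = 0 := by
    refine Finset.sum_eq_zero fun i _ => ?_
    rw [← Finset.mul_sum, ← Finset.mul_sum, hu]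
    simp
  have h2 : ∑ i, ∑ j, D o j / 2 * (v i * u j) = 0 := by
    rw [Finset.sum_comm]
    refine Finset.sum_eq_zero fun j _ => ?_
    rw [← Finset.mul_sum, ← Finset.sum_mul, hv]
    simp
  have h3 : ∀ i j, (D o i + D o j - D i j) / 2 * (v i * u j) = D o i / 2 * (v i * u j)
      + D o j / 2 * (v i * u j) + -(1 / 2) * (v i * u j * D i j) := fun i j => by ring
  simp only [h3, Finset.sum_add_distrib, h1, h2, bform, Finset.mul_sum, zero_add]

theorem InK.bform_eq_axis (h : InK W) (h04 : 0 < W 0 4) {v u : Fin 5 → ℝ}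
    (hv : ∑ i, v i = 0) (hu : ∑ i, u i = 0) :
    bform W v u = (∑ i, axisCoord W i * v i) * (∑ i, axisCoord W i * u i)
      + (offAxis W 1 1 * (v 1 * u 1) + offAxis W 2 2 * (v 2 * u 2) + offAxis W 3 3 * (v 3 * u 3)
      + offAxis W 1 2 * (v 1 * u 2 + v 2 * u 1) + offAxis W 1 3 * (v 1 * u 3 + v 3 * u 1)
      + offAxis W 2 3 * (v 2 * u 3 + v 3 * u 2)) := by
  have hr : √(W 0 4) ^ 2 = W 0 4 := Real.sq_sqrt h04.le
  have hr0 : √(W 0 4) ≠ 0 := (Real.sqrt_pos.2 h04).ne'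
  have ht0 : axisCoord W 0 = 0 := by simp [axisCoord, h.diag]
  have ht4 : axisCoord W 4 = √(W 0 4) := by
    rw [axisCoord, h.diag, div_eq_iff (by positivity)]
    linarith
  have hs : ∀ i j, offAxis W i j = offAxis W j i := fun i j => by
    rw [offAxis, offAxis, h.symm i j]; ring
  have h0 : ∀ i, offAxis W 0 i = 0 := fun i => by simp [offAxis, ht0, h.diag]
  have h4 : ∀ i, offAxis W i 4 = 0 := fun i => by
    rw [offAxis, ht4, axisCoord]
    field_simp
    ring
  have hG : ∀ i j, (W 0 i + W 0 j - W i j) / 2 * (v i * u j)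
      = (axisCoord W i * v i) * (axisCoord W j * u j) + offAxis W i j * (v i * u j) := fun i j => by
    rw [offAxis]; ring
  rw [bform_eq_gram 0 hv hu]
  simp only [hG, Finset.sum_add_distrib, ← Finset.sum_mul_sum]
  congr 1
  simp only [Fin.sum_univ_five, h0, h4, hs _ 0, hs 4, hs 2 1, hs 3 1, hs 3 2]
  ring

theorem InK.offAxis_self_nonneg (h : InK W) (h04 : 0 < W 0 4) (i : Fin 5) : 0 ≤ offAxis W i i := by
  have hr : √(W 0 4) ^ 2 = W 0 4 := Real.sq_sqrt h04.le
  have hr0 : 0 < √(W 0 4) := Real.sqrt_pos.2 h04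
  have h1 := h.sub_sq_le 0 i 4
  have h2 := h.le_add_sq 0 i 4
  have h3 : √(W 0 i) ^ 2 = W 0 i := Real.sq_sqrt (h.nonneg _ _)
  have h5 : axisCoord W i ^ 2 ≤ √(W 0 i) ^ 2 := by
    refine sq_le_sq' ?_ ?_
    · rw [axisCoord, le_div_iff₀ (by positivity)]
      linarith
    · rw [axisCoord, div_le_iff₀ (by positivity)]
      linarith
  rw [offAxis, h.diag]
  linarith

/-- There is a null vector of the cone supported exactly on the complement of `i`. -/
def NullFacet (W : Fin 5 → Fin 5 → ℝ) (i : Fin 5) : Prop :=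
  ∃ v, IsCone v ∧ qform W v = 0 ∧ v i = 0 ∧ ∀ j, j ≠ i → v j ≠ 0

theorem NullFacet.comp {i : Fin 5} (h : NullFacet W i) (σ : Equiv.Perm (Fin 5)) :
    NullFacet (fun i j => W (σ i) (σ j)) (σ.symm i) := by
  obtain ⟨v, hv, hq, hi, hj⟩ := h
  refine ⟨v ∘ σ, hv.comp σ, by rwa [qform_comp], by simpa using hi, fun j h' => hj _ ?_⟩
  rintro rfl
  simp at h'

theorem InK.bform_eq_zero_of_facet (h : InK W) {i : Fin 5} {v u : Fin 5 → ℝ} (hv : IsCone v)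
    (hq : qform W v = 0) (hj : ∀ j, j ≠ i → v j ≠ 0) (hu : ∑ j, u j = 0) (hui : u i = 0) :
    bform W v u = 0 := by
  refine h.bform_eq_zero hv hq hu fun j hj' => ?_
  by_cases hji : j = i
  · rw [hji, hui]
  · exact absurd hj' (hj j hji)

theorem InK.axis_null (h : InK W) (h04 : 0 < W 0 4) {i : Fin 5} (hi0 : i ≠ 0) (hi4 : i ≠ 4)
    {v : Fin 5 → ℝ} (hv : IsCone v) (hq : qform W v = 0) (hj : ∀ j, j ≠ i → v j ≠ 0) :
    ∑ j, axisCoord W j * v j = 0 := by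
  have hu : ∑ j, ![-1, 0, 0, 0, 1] j = (0 : ℝ) := by simp [Fin.sum_univ_five]
  have := h.bform_eq_zero_of_facet hv hq hj hu (by fin_cases i <;> simp_all)
  rw [h.bform_eq_axis h04 hv.1 hu] at this
  have ht0 : axisCoord W 0 = 0 := by simp [axisCoord, h.diag]
  have ht4 : 0 < axisCoord W 4 := by
    rw [axisCoord, h.diag, sub_zero]
    have := Real.sqrt_pos.2 h04
    positivity
  have h2 : ∑ i, axisCoord W i * ![-1, 0, 0, 0, 1] i = axisCoord W 4 := by
    simp [Fin.sum_univ_five, ht0]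
  rw [h2] at this
  simp at this
  exact this.resolve_right ht4.ne'

theorem InK.offAxis_of_facet_one (h : InK W) (h04 : 0 < W 0 4) {v : Fin 5 → ℝ} (hv : IsCone v)
    (hq : qform W v = 0) (h1 : v 1 = 0) (hj : ∀ j, j ≠ 1 → v j ≠ 0) :
    offAxis W 2 2 * v 2 + offAxis W 2 3 * v 3 = 0 ∧ offAxis W 2 3 * v 2 + offAxis W 3 3 * v 3 = 0 ∧
      ∀ u : Fin 5 → ℝ, ∑ i, u i = 0 →
        bform W v u = (offAxis W 1 2 * v 2 + offAxis W 1 3 * v 3) * u 1 := by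
  have hl := h.axis_null h04 (by decide) (by decide) hv hq hj
  have key : ∀ u : Fin 5 → ℝ, ∑ i, u i = 0 → bform W v u
      = (offAxis W 1 2 * v 2 + offAxis W 1 3 * v 3) * u 1
      + (offAxis W 2 2 * v 2 + offAxis W 2 3 * v 3) * u 2
      + (offAxis W 2 3 * v 2 + offAxis W 3 3 * v 3) * u 3 := fun u hu => by
    rw [h.bform_eq_axis h04 hv.1 hu, hl, h1]
    ring
  have e2 : offAxis W 2 2 * v 2 + offAxis W 2 3 * v 3 = 0 := by
    have hu : ∑ j, ![-1, 0, 1, 0, 0] j = (0 : ℝ) := by simp [Fin.sum_univ_five]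
    have := h.bform_eq_zero_of_facet hv hq hj hu (by simp)
    rw [key _ hu] at this
    simpa using this
  have e3 : offAxis W 2 3 * v 2 + offAxis W 3 3 * v 3 = 0 := by
    have hu : ∑ j, ![-1, 0, 0, 1, 0] j = (0 : ℝ) := by simp [Fin.sum_univ_five]
    have := h.bform_eq_zero_of_facet hv hq hj hu (by simp)
    rw [key _ hu] at this
    simpa using this
  refine ⟨e2, e3, fun u hu => ?_⟩
  rw [key u hu, e2, e3]
  ring

theorem InK.offAxis_sq_of_facet_one (h : InK W) (h04 : 0 < W 0 4) (hf : NullFacet W 1) :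
    offAxis W 2 3 ^ 2 = offAxis W 2 2 * offAxis W 3 3 := by
  obtain ⟨v, hv, hq, h1, hj⟩ := hf
  obtain ⟨e2, e3, -⟩ := h.offAxis_of_facet_one h04 hv hq h1 hj
  have h2 := hj 2 (by decide)
  have h3 := hj 3 (by decide)
  have : v 2 * (offAxis W 2 3 ^ 2 - offAxis W 2 2 * offAxis W 3 3) = 0 := by
    linear_combination offAxis W 2 3 * e3 - offAxis W 3 3 * e2
  have := (mul_eq_zero.1 this).resolve_left h2
  linarith

theorem InK.offAxis_sq (h : InK W) (h04 : 0 < W 0 4) (h1 : NullFacet W 1) (h2 : NullFacet W 2)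
    (h3 : NullFacet W 3) : offAxis W 1 2 ^ 2 = offAxis W 1 1 * offAxis W 2 2 ∧
      offAxis W 1 3 ^ 2 = offAxis W 1 1 * offAxis W 3 3 ∧
      offAxis W 2 3 ^ 2 = offAxis W 2 2 * offAxis W 3 3 := by
  refine ⟨?_, ?_, h.offAxis_sq_of_facet_one h04 h1⟩
  · have hs : offAxis W 2 1 = offAxis W 1 2 := by rw [offAxis, offAxis, h.symm 2 1]; ring
    have : offAxis W 2 1 ^ 2 = offAxis W 2 2 * offAxis W 1 1 :=
      (h.comp (Equiv.swap 1 3)).offAxis_sq_of_facet_one h04 (h3.comp (Equiv.swap 1 3))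
    rw [← hs, this, mul_comm]
  · exact (h.comp (Equiv.swap 1 2)).offAxis_sq_of_facet_one h04 (h2.comp (Equiv.swap 1 2))

theorem InK.not_facets_of_offAxis (h : InK W) (h04 : 0 < W 0 4) (h1 : NullFacet W 1)
    (h3 : NullFacet W 3) (h12 : 0 < offAxis W 1 2) (h13 : 0 < offAxis W 1 3)
    (h23 : offAxis W 2 3 < 0) : False := by
  obtain ⟨v, hv, hq, hv1, hj, hv2⟩ : ∃ v, IsCone v ∧ qform W v = 0 ∧ v 1 = 0 ∧
      (∀ j, j ≠ 1 → v j ≠ 0) ∧ 0 < v 2 := by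
    obtain ⟨v, hv, hq, h1, hj⟩ := h1
    rcases lt_or_gt_of_ne (hj 2 (by decide)) with h | h
    · exact ⟨-v, hv.neg, by rwa [qform_neg], by simpa, by simpa, by simpa⟩
    · exact ⟨v, hv, hq, h1, hj, h⟩
  obtain ⟨w, hw, hqw, hw3, hjw, hw1⟩ : ∃ v, IsCone v ∧ qform W v = 0 ∧ v 3 = 0 ∧
      (∀ j, j ≠ 3 → v j ≠ 0) ∧ 0 < v 1 := by
    obtain ⟨v, hv, hq, h1, hj⟩ := h3
    rcases lt_or_gt_of_ne (hj 1 (by decide)) with h | h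
    · exact ⟨-v, hv.neg, by rwa [qform_neg], by simpa, by simpa, by simpa⟩
    · exact ⟨v, hv, hq, h1, hj, h⟩
  obtain ⟨e2, e3, hb⟩ := h.offAxis_of_facet_one h04 hv hq hv1 hj
  have hw2 : w 2 < 0 := by
    have hw' : offAxis W 2 2 * w 2 + offAxis W 1 2 * w 1 = 0 := by
      have := ((h.comp (Equiv.swap 1 3)).offAxis_of_facet_one h04 (hw.comp (Equiv.swap 1 3))
        (by rwa [qform_comp]) hw3 (fun j hj => hjw _ (by
          intro h; rw [Equiv.swap_apply_eq_iff] at h; exact hj (by simpa using h)))).1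
      have hs : offAxis W 2 1 = offAxis W 1 2 := by rw [offAxis, offAxis, h.symm 2 1]; ring
      rw [← hs]
      exact this
    have := h.offAxis_self_nonneg h04 2
    by_contra! h'
    have := mul_pos h12 hw1
    have := mul_nonneg ‹0 ≤ offAxis W 2 2› h'
    linarith
  have hv3 : 0 < v 3 := by
    have := h.offAxis_self_nonneg h04 3
    by_contra! h'
    have := mul_pos_of_neg_of_neg h23 (neg_neg_of_pos hv2)
    have := mul_nonneg ‹0 ≤ offAxis W 3 3› (neg_nonneg.2 h')
    linarith
  have hv0 : v 0 < 0 := by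
    refine lt_of_le_of_ne ?_ (hj 0 (by decide))
    rcases (hv.2 0 2 3 (by decide) (by decide) (by decide)).1 with h | h | h <;> linarith
  have hv4 : v 4 < 0 := by
    refine lt_of_le_of_ne ?_ (hj 4 (by decide))
    rcases (hv.2 4 2 3 (by decide) (by decide) (by decide)).1 with h | h | h <;> linarith
  have key : ∀ γ : ℝ, 0 < γ → IsCone (w + (-γ) • v) → False := by
    intro γ hγ hc
    have := h.qform_nonneg hc
    rw [qform_add h.symm, qform_smul, bform_smul_right, bform_comm h.symm, hb _ hw.1, hq, hqw] at this
    have h0 : 0 < (offAxis W 1 2 * v 2 + offAxis W 1 3 * v 3) * w 1 := by positivity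
    nlinarith [mul_pos hγ h0]
  have hsum : ∀ γ : ℝ, ∑ i, (w + (-γ) • v) i = 0 := fun γ => by
    simp only [Pi.add_apply, Pi.smul_apply, smul_eq_mul, Finset.sum_add_distrib, ← Finset.mul_sum,
      hv.1, hw.1]
    simp
  have hcone : ∀ {u : Fin 5 → ℝ}, ∑ i, u i = 0 → 0 < u 1 → u 2 < 0 → u 3 < 0 →
      (u 0 = 0 ∧ 0 ≤ u 4 ∨ u 4 = 0 ∧ 0 ≤ u 0) → IsCone u := by
    intro u hu h1 h2 h3 h
    rcases h with ⟨h0, h4⟩ | ⟨h4, h0⟩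
    · refine .of_signs (p := 1) (q := 4) (r := 2) (s := 3) hu ?_ ?_ <;> intro i hi <;>
        fin_cases i <;> first | decide | exact absurd hi (by simp only [not_lt]; linarith!)
    · refine .of_signs (p := 1) (q := 0) (r := 2) (s := 3) hu ?_ ?_ <;> intro i hi <;>
        fin_cases i <;> first | decide | exact absurd hi (by simp only [not_lt]; linarith!)
  rcases lt_or_gt_of_ne (hjw 0 (by decide)) with h0 | h0
  · have hγ := div_pos_of_neg_of_neg h0 hv0
    refine key _ hγ (hcone (hsum _) ?_ ?_ ?_ (Or.inl ⟨?_, ?_⟩)) <;>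
      simp only [Pi.add_apply, Pi.smul_apply, smul_eq_mul, hv1, hw3]
    · linarith
    · linarith [mul_pos hγ hv2]
    · linarith [mul_pos hγ hv3]
    · rw [neg_mul, div_mul_cancel₀ _ hv0.ne]; ring
    · have h4 : 0 ≤ w 4 := by
        rcases (hw.2 4 0 2 (by decide) (by decide) (by decide)).2 with h | h | h <;> linarith
      linarith [mul_neg_of_pos_of_neg hγ hv4]
  · have h4 : w 4 < 0 := by
      refine lt_of_le_of_ne ?_ (hjw 4 (by decide))
      rcases (hw.2 4 0 1 (by decide) (by decide) (by decide)).1 with h | h | h <;> linarith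
    have hγ := div_pos_of_neg_of_neg h4 hv4
    refine key _ hγ (hcone (hsum _) ?_ ?_ ?_ (Or.inr ⟨?_, ?_⟩)) <;>
      simp only [Pi.add_apply, Pi.smul_apply, smul_eq_mul, hv1, hw3]
    · linarith
    · linarith [mul_pos hγ hv2]
    · linarith [mul_pos hγ hv3]
    · rw [neg_mul, div_mul_cancel₀ _ hv4.ne]; ring
    · linarith [mul_neg_of_pos_of_neg hγ hv0]

theorem mul_self_form_nonneg {p q r x y z : ℝ} (hp : 0 ≤ p) (hq : 0 ≤ q) (hr : 0 ≤ r)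
    (hx : x ^ 2 = p * q) (hy : y ^ 2 = p * r) (hz : z ^ 2 = q * r) (hxyz : 0 ≤ x * y * z)
    (a b c : ℝ) :
    0 ≤ p * (a * a) + q * (b * b) + r * (c * c) + x * (a * b + b * a) + y * (a * c + c * a)
      + z * (b * c + c * b) := by
  rcases hp.eq_or_lt with rfl | hp
  · obtain rfl : x = 0 := pow_eq_zero_iff two_ne_zero |>.1 (by linarith)
    obtain rfl : y = 0 := pow_eq_zero_iff two_ne_zero |>.1 (by linarith)
    rcases hq.eq_or_lt with rfl | hq
    · obtain rfl : z = 0 := pow_eq_zero_iff two_ne_zero |>.1 (by linarith)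
      linarith [mul_nonneg hr (mul_self_nonneg c)]
    · refine nonneg_of_mul_nonneg_right (a := q) ?_ hq
      have : q * (0 * (a * a) + q * (b * b) + r * (c * c) + 0 * (a * b + b * a)
        + 0 * (a * c + c * a) + z * (b * c + c * b)) = (q * b + z * c) ^ 2 := by
        linear_combination (-c ^ 2) * hz
      rw [this]
      positivity
  · have hxy : x * y = p * z := by
      have h1 : (x * y - p * z) * (x * y + p * z) = 0 := by
        linear_combination y ^ 2 * hx + p * q * hy - p ^ 2 * hz
      rcases mul_eq_zero.1 h1 with h | h
      · linarith
      · have h2 : p * z ^ 2 ≤ 0 := by nlinarith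
        have h3 : z ^ 2 = 0 := le_antisymm (nonpos_of_mul_nonpos_right h2 hp) (sq_nonneg z)
        obtain rfl : z = 0 := pow_eq_zero_iff two_ne_zero |>.1 h3
        linarith
    refine nonneg_of_mul_nonneg_right (a := p) ?_ hp
    have : p * (p * (a * a) + q * (b * b) + r * (c * c) + x * (a * b + b * a) + y * (a * c + c * a)
      + z * (b * c + c * b)) = (p * a + x * b + y * c) ^ 2 := by
      linear_combination (-b ^ 2) * hx - c ^ 2 * hy - 2 * b * c * hxy
    rw [this]
    positivity

theorem axis_eq_zero {l x y z : ℝ} (hp : x ≤ 0 ∨ y ≤ 0 ∨ z ≤ 0) (hn : 0 ≤ x ∨ 0 ≤ y ∨ 0 ≤ z)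
    (h : l * l + (x ^ 2 + y ^ 2 + z ^ 2 - 2 * (x * y) - 2 * (x * z) - 2 * (y * z)) = 0) : l = 0 := by
  suffices 0 ≤ x ^ 2 + y ^ 2 + z ^ 2 - 2 * (x * y) - 2 * (x * z) - 2 * (y * z) by
    exact mul_self_eq_zero.1 (le_antisymm (by linarith) (mul_self_nonneg l))
  wlog hxy : 0 ≤ x * y generalizing x y z
  · rcases le_total 0 (x * z) with hxz | hxz
    · have := @this x z y (by tauto) (by tauto) (by linarith) hxz
      linarith
    · rcases le_total 0 (y * z) with hyz | hyz
      · have := @this y z x (by tauto) (by tauto) (by linarith) hyz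
        linarith
      · nlinarith [sq_nonneg (x + y + z)]
  have hz : z * (x + y) ≤ 0 →
      0 ≤ x ^ 2 + y ^ 2 + z ^ 2 - 2 * (x * y) - 2 * (x * z) - 2 * (y * z) := fun h => by
    nlinarith [sq_nonneg (x - y), sq_nonneg z]
  rcases nonneg_and_nonneg_or_nonpos_and_nonpos_of_mul_nonneg hxy with ⟨hx, hy⟩ | ⟨hx, hy⟩
  · rcases hp with h | h | h
    · obtain rfl := le_antisymm h hx
      linarith [sq_nonneg (y - z)]
    · obtain rfl := le_antisymm h hy
      linarith [sq_nonneg (x - z)]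
    · exact hz (mul_nonpos_of_nonpos_of_nonneg h (add_nonneg hx hy))
  · rcases hn with h | h | h
    · obtain rfl := le_antisymm hx h
      linarith [sq_nonneg (y - z)]
    · obtain rfl := le_antisymm hy h
      linarith [sq_nonneg (x - z)]
    · exact hz (mul_nonpos_of_nonneg_of_nonpos h (add_nonpos hx hy))

theorem InK.hasPotential_or_condNeg_of_facets (h : InK W) (h04 : 0 < W 0 4) (h1 : NullFacet W 1)
    (h2 : NullFacet W 2) (h3 : NullFacet W 3) : HasPotential W ∨ CondNeg W := by
  obtain ⟨s12, s13, s23⟩ := h.offAxis_sq h04 h1 h2 h3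
  have p1 := h.offAxis_self_nonneg h04 1
  have p2 := h.offAxis_self_nonneg h04 2
  have p3 := h.offAxis_self_nonneg h04 3
  by_cases hs : 0 ≤ offAxis W 1 2 * offAxis W 1 3 * offAxis W 2 3
  · refine Or.inr ⟨h.diag, h.symm, fun v hv => ?_⟩
    rw [qform, h.bform_eq_axis h04 hv hv]
    have := mul_self_form_nonneg p1 p2 p3 s12 s13 s23 hs (v 1) (v 2) (v 3)
    nlinarith [mul_self_nonneg (∑ i, axisCoord W i * v i)]
  rw [not_le] at hs
  have hs12 : offAxis W 2 1 = offAxis W 1 2 := by rw [offAxis, offAxis, h.symm 2 1]; ring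
  have hs13 : offAxis W 3 1 = offAxis W 1 3 := by rw [offAxis, offAxis, h.symm 3 1]; ring
  have hs23 : offAxis W 3 2 = offAxis W 2 3 := by rw [offAxis, offAxis, h.symm 3 2]; ring
  have hneg : offAxis W 1 2 < 0 ∧ offAxis W 1 3 < 0 ∧ offAxis W 2 3 < 0 := by
    rcases lt_trichotomy (offAxis W 1 2) 0 with n12 | z | n12
    · rcases lt_trichotomy (offAxis W 1 3) 0 with n13 | z | n13
      · exact ⟨n12, n13, by nlinarith [mul_pos_of_neg_of_neg n12 n13]⟩
      · simp [z] at hs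
      · have n23 : 0 < offAxis W 2 3 := by nlinarith [mul_neg_of_neg_of_pos n12 n13]
        exact ((h.comp (Equiv.swap 1 3)).not_facets_of_offAxis h04 (h3.comp (Equiv.swap 1 3))
          (h1.comp (Equiv.swap 1 3)) (hs23.symm ▸ n23 : 0 < offAxis W 3 2)
          (hs13.symm ▸ n13 : 0 < offAxis W 3 1) (hs12.symm ▸ n12 : offAxis W 2 1 < 0)).elim
    · simp [z] at hs
    · rcases lt_trichotomy (offAxis W 1 3) 0 with n13 | z | n13
      · have n23 : 0 < offAxis W 2 3 := by nlinarith [mul_neg_of_pos_of_neg n12 n13]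
        exact ((h.comp (Equiv.swap 1 2)).not_facets_of_offAxis h04 (h2.comp (Equiv.swap 1 2))
          (h3.comp (Equiv.swap 1 2)) (hs12.symm ▸ n12 : 0 < offAxis W 2 1) n23 n13).elim
      · simp [z] at hs
      · have n23 : offAxis W 2 3 < 0 := by nlinarith [mul_pos n12 n13]
        exact (h.not_facets_of_offAxis h04 h1 h3 n12 n13 n23).elim
  refine Or.inl ⟨axisCoord W, ⟨0, 4, ?_⟩, fun v hv hq => ?_⟩
  · have := Real.sqrt_pos.2 h04
    simp only [axisCoord, h.diag]
    rw [zero_add, sub_self, zero_div, sub_zero]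
    refine ne_of_lt ?_
    positivity
  · rw [qform, h.bform_eq_axis h04 hv.1 hv.1] at hq
    have h12 : offAxis W 1 2 = -(√(offAxis W 1 1) * √(offAxis W 2 2)) := by
      rw [← Real.sqrt_mul p1, ← s12, Real.sqrt_sq_eq_abs, abs_of_neg hneg.1, neg_neg]
    have h13 : offAxis W 1 3 = -(√(offAxis W 1 1) * √(offAxis W 3 3)) := by
      rw [← Real.sqrt_mul p1, ← s13, Real.sqrt_sq_eq_abs, abs_of_neg hneg.2.1, neg_neg]
    have h23 : offAxis W 2 3 = -(√(offAxis W 2 2) * √(offAxis W 3 3)) := by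
      rw [← Real.sqrt_mul p2, ← s23, Real.sqrt_sq_eq_abs, abs_of_neg hneg.2.2, neg_neg]
    have e1 := Real.mul_self_sqrt p1
    have e2 := Real.mul_self_sqrt p2
    have e3 := Real.mul_self_sqrt p3
    have hc := hv.2 1 2 3 (by decide) (by decide) (by decide)
    have hx : ∀ {x a : ℝ}, 0 ≤ x → (a ≤ 0 → x * a ≤ 0) ∧ (0 ≤ a → 0 ≤ x * a) := fun hx =>
      ⟨fun ha => mul_nonpos_of_nonneg_of_nonpos hx ha, fun ha => mul_nonneg hx ha⟩
    have hc1 := hc.1.imp (hx (Real.sqrt_nonneg (offAxis W 1 1))).1 (Or.imp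
      (hx (Real.sqrt_nonneg (offAxis W 2 2))).1 (hx (Real.sqrt_nonneg (offAxis W 3 3))).1)
    have hc2 := hc.2.imp (hx (Real.sqrt_nonneg (offAxis W 1 1))).2 (Or.imp
      (hx (Real.sqrt_nonneg (offAxis W 2 2))).2 (hx (Real.sqrt_nonneg (offAxis W 3 3))).2)
    rw [h12, h13, h23] at hq
    refine axis_eq_zero hc1 hc2 ?_
    linear_combination hq + v 1 ^ 2 * e1 + v 2 ^ 2 * e2 + v 3 ^ 2 * e3

end Axis

theorem CondNeg.of_comp {ι : Type*} [Fintype ι] {W : ι → ι → ℝ} (σ : Equiv.Perm ι)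
    (h : CondNeg fun i j => W (σ i) (σ j)) : CondNeg W := by
  refine ⟨fun i => by simpa using h.1 (σ.symm i),
    fun i j => by simpa using h.2.1 (σ.symm i) (σ.symm j), fun v hv => ?_⟩
  have := h.2.2 (v ∘ σ) (by simpa [Equiv.sum_comp σ v] using hv)
  rwa [qform_comp] at this

theorem exists_perm_three {i j k : Fin 5} (hij : i ≠ j) (hik : i ≠ k) (hjk : j ≠ k)
    {g : Fin 3 → Fin 5} (hg : Function.Injective g) :
    ∃ σ : Equiv.Perm (Fin 5), σ (g 0) = i ∧ σ (g 1) = j ∧ σ (g 2) = k := by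
  have hinj : Function.Injective ![i, j, k] := by
    intro x y h
    fin_cases x <;> fin_cases y <;> simp_all
  obtain ⟨σ, hσ⟩ := Equiv.Perm.exists_extending_pair g ![i, j, k] hg hinj
  exact ⟨σ, hσ 0, hσ 1, hσ 2⟩

theorem InK.hasPotential_or_condNeg_of_nullFacet {W : Fin 5 → Fin 5 → ℝ} (h : InK W)
    (hpos : ∀ i j, i ≠ j → 0 < W i j) {i j k : Fin 5} (hij : i ≠ j) (hik : i ≠ k) (hjk : j ≠ k)
    (hi : NullFacet W i) (hj : NullFacet W j) (hk : NullFacet W k) :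
    HasPotential W ∨ CondNeg W := by
  obtain ⟨σ, rfl, rfl, rfl⟩ := exists_perm_three hij hik hjk (g := ![1, 2, 3]) (by decide)
  have hi := hi.comp σ
  have hj := hj.comp σ
  have hk := hk.comp σ
  rw [Equiv.symm_apply_apply] at hi hj hk
  exact ((h.comp σ).hasPotential_or_condNeg_of_facets (hpos _ _ (by simp)) hi hj hk).imp
    (HasPotential.of_comp σ) (CondNeg.of_comp σ)

/-- The point `o` lies between `i` and `j`, for the matrix `W` of squared distances. -/
def Between {ι : Type*} (W : ι → ι → ℝ) (o i j : ι) : Prop := √(W i j) = √(W o i) + √(W o j)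

/-- The matrix has positive entries and no collinear pairs with a common middle and end point. -/
structure Forkless {ι : Type*} (W : ι → ι → ℝ) : Prop where
  inK : InK W
  pos : ∀ i j, i ≠ j → 0 < W i j
  not_between : ∀ o i j l, o ≠ i → o ≠ j → o ≠ l → i ≠ j → i ≠ l → j ≠ l →
    Between W o i j → ¬Between W o i l

namespace Forkless

variable {ι : Type*} {W : ι → ι → ℝ} {x y z w : ι}

theorem between_comm (F : Forkless W) (h : Between W x y z) : Between W x z y := by
  rw [Between] at *
  rw [F.inK.symm, h, add_comm]

theorem not_between_of_sub_sq (F : Forkless W) (hxy : x ≠ y) (hxz : x ≠ z) (hxw : x ≠ w)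
    (hyz : y ≠ z) (hyw : y ≠ w) (hzw : z ≠ w) (h : Between W x y z)
    (h' : √(W y w) ^ 2 = (√(W x y) - √(W x w)) ^ 2) : False := by
  have hK := F.inK
  have hsq : ∀ i j, √(W i j) ^ 2 = W i j := fun i j => Real.sq_sqrt (hK.nonneg i j)
  obtain ⟨k, hk, -, e⟩ := hK.exists_coef x z w
  have := hK.coef_le (k := -1) (k₁ := 1) (Real.sqrt_pos.2 (F.pos x y hxy))
    (Real.sqrt_pos.2 (F.pos x z hxz)) (Real.sqrt_pos.2 (F.pos x w hxw)) (hsq _ _).symm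
    (hsq _ _).symm (hsq _ _).symm (by rw [← hsq y z, h]; ring) (by rw [← hsq y w, h']; ring) e rfl
  have hk1 : k = -1 := by linarith
  refine F.not_between x z y w hxz hxy hxw hyz.symm hzw hyw (F.between_comm h) ?_
  rw [Between, e, hk1, ← Real.sqrt_sq (add_nonneg (Real.sqrt_nonneg _) (Real.sqrt_nonneg _))]
  congr 1
  ring

theorem not_between_of_between (F : Forkless W) (hxy : x ≠ y) (hxz : x ≠ z) (hxw : x ≠ w)
    (hyz : y ≠ z) (hyw : y ≠ w) (hzw : z ≠ w) (h : Between W z x y) (h' : Between W w x y) :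
    False := by
  have hK := F.inK
  have hsq : ∀ i j, √(W i j) ^ 2 = W i j := fun i j => Real.sq_sqrt (hK.nonneg i j)
  obtain ⟨k, -, hk, e⟩ := hK.exists_coef x z w
  rw [Between, hK.symm z x] at h
  rw [Between, hK.symm w x] at h'
  have ha := Real.sqrt_pos.2 (F.pos x z hxz)
  have hb := Real.sqrt_pos.2 (F.pos x w hxw)
  have he := Real.sqrt_pos.2 (F.pos x y hxy)
  have hzy := Real.sqrt_nonneg (W z y)
  have hwy := Real.sqrt_nonneg (W w y)
  have h1 := hK.coef_form_nonneg (o := x) (i := z) (j := w) (l := y) (k₁ := 1) (k₂ := 1)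
    (hsq _ _).symm (hsq _ _).symm (hsq _ _).symm e
    (by rw [← hsq z y, h]; ring) (by rw [← hsq w y, h']; ring) hb.le ha.le
    (δ := 2 * (√(W x z) * √(W x w)) / √(W x y)) (by positivity) (by
      rw [div_le_iff₀ he]
      nlinarith)
  rw [mul_div_cancel₀ _ he.ne'] at h1
  have h2 : 0 ≤ (√(W x z) * √(W x w)) ^ 2 * (k - 1) := by linarith
  have h3 := nonneg_of_mul_nonneg_right h2 (by positivity)
  have hk1 : k = 1 := by linarith
  have h4 : √(W z w) ^ 2 = (√(W x z) - √(W x w)) ^ 2 := by rw [hsq, e, hk1]; ring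
  have h5 := Real.sqrt_nonneg (W z w)
  rcases le_total √(W x z) √(W x w) with hle | hle
  · refine F.not_between z x y w hxz.symm hyz.symm hzw hxy hxw hyw
      (by rwa [Between, hK.symm z x]) ?_
    rw [Between, hK.symm z x]
    have : √(W z w) = √(W x w) - √(W x z) := by
      refine (sq_eq_sq₀ h5 (by linarith)).1 ?_
      rw [h4]; ring
    linarith
  · refine F.not_between w x y z hxw.symm hyw.symm hzw.symm hxy hxz hyz
      (by rwa [Between, hK.symm w x]) ?_
    rw [Between, hK.symm w x, hK.symm w z]
    have : √(W z w) = √(W x z) - √(W x w) := (sq_eq_sq₀ h5 (by linarith)).1 h4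
    linarith

/-- No two collinear triples share two points. -/
theorem collinear_unique (F : Forkless W) (hxy : x ≠ y) (hxz : x ≠ z) (hxw : x ≠ w)
    (hyz : y ≠ z) (hyw : y ≠ w) (hzw : z ≠ w)
    (h : Between W x y z ∨ Between W y x z ∨ Between W z x y)
    (h' : Between W x y w ∨ Between W y x w ∨ Between W w x y) : False := by
  have hK := F.inK
  rcases h with h | h | h <;> rcases h' with h' | h' | h'
  · exact F.not_between x y z w hxy hxz hxw hyz hyw hzw h h'
  · refine F.not_between_of_sub_sq hxy hxz hxw hyz hyw hzw h ?_
    rw [Between, hK.symm y x] at h'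
    rw [h']; ring
  · refine F.not_between_of_sub_sq hxy hxz hxw hyz hyw hzw h ?_
    rw [Between, hK.symm w x, hK.symm w y] at h'
    rw [h']; ring
  · refine F.not_between_of_sub_sq hxy.symm hyz hyw hxz hxw hzw h ?_
    rw [Between] at h'
    rw [h', hK.symm y x]; ring
  · exact F.not_between y x z w hxy.symm hyz hyw hxz hxw hzw h h'
  · refine F.not_between_of_sub_sq hxy.symm hyz hyw hxz hxw hzw h ?_
    rw [Between, hK.symm w x, hK.symm w y] at h'
    rw [hK.symm y x, h']; ring
  · refine F.not_between_of_sub_sq hxy hxw hxz hyw hyz hzw.symm h' ?_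
    rw [Between, hK.symm z x, hK.symm z y] at h
    rw [h]; ring
  · refine F.not_between_of_sub_sq hxy.symm hyw hyz hxw hxz hzw.symm h' ?_
    rw [Between, hK.symm z x, hK.symm z y] at h
    rw [hK.symm y x, h]; ring
  · exact F.not_between_of_between hxy hxz hxw hyz hyw hzw h h'

end Forkless

theorem add_eq_of_null {x y z p q r : ℝ} (hs : x + y + z = 0) (hyz : 0 < y * z) (hr : 0 ≤ r)
    (hp : 0 ≤ p) (hq : 0 ≤ q) (hle : r ≤ p + q)
    (h : x * y * p ^ 2 + x * z * q ^ 2 + y * z * r ^ 2 = 0) : r = p + q := by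
  obtain rfl : x = -(y + z) := by linarith
  have h1 : (y * p - z * q) ^ 2 + y * z * ((p + q) ^ 2 - r ^ 2) = 0 := by linarith
  have h2 : r ^ 2 ≤ (p + q) ^ 2 := pow_le_pow_left₀ hr hle 2
  have h3 : y * z * ((p + q) ^ 2 - r ^ 2) = 0 :=
    le_antisymm (by linarith [sq_nonneg (y * p - z * q)]) (mul_nonneg hyz.le (by linarith))
  have h4 := (mul_eq_zero.1 h3).resolve_left hyz.ne'
  exact (sq_eq_sq₀ hr (by linarith)).1 (by linarith)

/-- A vector of the boundary of the orthant of `v` reached from `v` in the direction `±w`. -/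
theorem exists_hit {ι : Type*} [Finite ι] {v w : ι → ℝ} (hw : w ≠ 0)
    (hs : ∀ i, v i = 0 → w i = 0) : ∃ t k, v k ≠ 0 ∧ w k ≠ 0 ∧ v k + t * w k = 0 ∧
      ∀ i, (v i ≤ 0 → v i + t * w i ≤ 0) ∧ (0 ≤ v i → 0 ≤ v i + t * w i) := by
  obtain ⟨i₀, hi₀⟩ := Function.ne_iff.1 hw
  have : Nonempty ι := ⟨i₀⟩
  obtain ⟨k, hk⟩ := Finite.exists_max fun i => |w i / v i|
  have hk0 : w k / v k ≠ 0 := by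
    intro h0
    have := hk i₀
    rw [h0, abs_zero] at this
    have := div_eq_zero_iff.1 (abs_nonpos_iff.1 this)
    exact this.elim hi₀ fun h => hi₀ (hs _ h)
  obtain ⟨hwk, hvk⟩ := div_ne_zero_iff.1 hk0
  refine ⟨-(v k / w k), k, hvk, hwk, by field_simp; ring, fun i => ?_⟩
  by_cases hi : v i = 0
  · simp [hi, hs i hi]
  have e : v i + -(v k / w k) * w i = v i * (1 - (w i / v i) / (w k / v k)) := by
    field_simp
    ring
  have h1 : (w i / v i) / (w k / v k) ≤ 1 := by
    refine (le_abs_self _).trans ?_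
    rw [abs_div]
    exact div_le_one_of_le₀ (hk i) (abs_nonneg _)
  rw [e]
  exact ⟨fun h => mul_nonpos_of_nonpos_of_nonneg h (by linarith),
    fun h => mul_nonneg h (by linarith)⟩

theorem InK.exists_null_hit {ι : Type*} [Fintype ι] {W : ι → ι → ℝ} (h : InK W) {v w : ι → ℝ}
    (hv : IsCone v) (hq : qform W v = 0) (hw : ∑ i, w i = 0) (hqw : qform W w = 0) (hw0 : w ≠ 0)
    (hs : ∀ i, v i = 0 → w i = 0) : ∃ t k, v k ≠ 0 ∧ w k ≠ 0 ∧ v k + t * w k = 0 ∧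
      IsCone (v + t • w) ∧ qform W (v + t • w) = 0 := by
  obtain ⟨t, k, hk, hwk, e, hi⟩ := exists_hit hw0 hs
  refine ⟨t, k, hk, hwk, e, ⟨?_, fun i j k a b c => ?_⟩, ?_⟩
  · simp [Finset.sum_add_distrib, ← Finset.mul_sum, hv.1, hw]
  · have := hv.2 i j k a b c
    exact ⟨this.1.imp (hi i).1 (Or.imp (hi j).1 (hi k).1),
      this.2.imp (hi i).2 (Or.imp (hi j).2 (hi k).2)⟩
  · rw [qform_add h.symm, bform_smul_right, qform_smul, hq, hqw, h.bform_eq_zero hv hq hw hs]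
    simp

namespace Forkless

variable {W : Fin 5 → Fin 5 → ℝ}

theorem between_of_null (F : Forkless W) (σ : Equiv.Perm (Fin 5)) {v : Fin 5 → ℝ}
    (hs : ∑ i, v i = 0) (hq : qform W v = 0) (hv : v ≠ 0) (h0 : v (σ 0) = 0) (h1 : v (σ 1) = 0) :
    (∀ k, k ≠ σ 0 → k ≠ σ 1 → v k ≠ 0) ∧ (Between W (σ 3) (σ 4) (σ 2) ∨
      Between W (σ 4) (σ 3) (σ 2) ∨ Between W (σ 2) (σ 3) (σ 4)) := by
  have hK := F.inK
  have hs' : v (σ 2) + v (σ 3) + v (σ 4) = 0 := by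
    rw [← Equiv.sum_comp σ v, Fin.sum_univ_five, h0, h1] at hs
    linarith
  have e : v (σ 2) * v (σ 3) * W (σ 2) (σ 3) + v (σ 2) * v (σ 4) * W (σ 2) (σ 4)
      + v (σ 3) * v (σ 4) * W (σ 3) (σ 4) = 0 := by
    rw [← qform_comp W σ v, qform, bform] at hq
    simp only [Fin.sum_univ_five, Function.comp, h0, h1, hK.diag, hK.symm (σ 3) (σ 2),
      hK.symm (σ 4) (σ 2), hK.symm (σ 4) (σ 3)] at hq
    linarith
  have p23 := F.pos (σ 2) (σ 3) (by simp)
  have p24 := F.pos (σ 2) (σ 4) (by simp)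
  have p34 := F.pos (σ 3) (σ 4) (by simp)
  have hne : ¬(v (σ 2) = 0 ∧ v (σ 3) = 0 ∧ v (σ 4) = 0) := by
    rintro ⟨a, b, c⟩
    refine hv (funext fun i => ?_)
    obtain ⟨m, rfl⟩ := σ.surjective i
    fin_cases m <;> assumption
  have aux : ∀ {x y d : ℝ}, 0 < d → x + y = 0 → x * y * d = 0 → x = 0 ∧ y = 0 := by
    intro x y d hd hxy h
    obtain rfl : y = -x := by linarith
    rcases mul_eq_zero.1 ((mul_eq_zero.1 h).resolve_right hd.ne') with h | h
    · simp [h]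
    · simp [neg_eq_zero.1 h]
  have n2 : v (σ 2) ≠ 0 := fun h => hne ⟨h, aux p34 (by linarith) (by rw [h] at e; linarith)⟩
  have n3 : v (σ 3) ≠ 0 := fun h => hne <| by
    have := aux p24 (x := v (σ 2)) (y := v (σ 4)) (by linarith) (by rw [h] at e; linarith)
    exact ⟨this.1, h, this.2⟩
  have n4 : v (σ 4) ≠ 0 := fun h => hne <| by
    have := aux p23 (x := v (σ 2)) (y := v (σ 3)) (by linarith) (by rw [h] at e; linarith)
    exact ⟨this.1, this.2, h⟩
  refine ⟨fun k hk0 hk1 => ?_, ?_⟩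
  · obtain ⟨m, rfl⟩ := σ.surjective k
    fin_cases m
    exacts [absurd rfl hk0, absurd rfl hk1, n2, n3, n4]
  have hsq : ∀ i j, √(W i j) ^ 2 = W i j := fun i j => Real.sq_sqrt (hK.nonneg i j)
  have hn : ∀ i j, 0 ≤ √(W i j) := fun i j => Real.sqrt_nonneg _
  rw [← hsq (σ 2), ← hsq (σ 2) (σ 4), ← hsq (σ 3)] at e
  have t := hK.triangle
  have key : 0 < v (σ 3) * v (σ 4) ∨ 0 < v (σ 4) * v (σ 2) ∨ 0 < v (σ 3) * v (σ 2) := by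
    by_contra! hc
    obtain ⟨c1, c2, c3⟩ := hc
    have : v (σ 2) ^ 2 = -(v (σ 4) * v (σ 2)) - v (σ 3) * v (σ 2) := by
      rw [show v (σ 2) = -v (σ 3) - v (σ 4) by linarith]; ring
    rcases lt_or_gt_of_ne n2 with a | a <;> rcases lt_or_gt_of_ne n3 with b | b <;>
      rcases lt_or_gt_of_ne n4 with c | c <;> first
      | linarith
      | exact absurd (mul_pos_of_neg_of_neg b c) (not_lt.2 c1)
      | exact absurd (mul_pos b c) (not_lt.2 c1)
      | exact absurd (mul_pos_of_neg_of_neg c a) (not_lt.2 c2)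
      | exact absurd (mul_pos c a) (not_lt.2 c2)
      | exact absurd (mul_pos_of_neg_of_neg b a) (not_lt.2 c3)
      | exact absurd (mul_pos b a) (not_lt.2 c3)
  rcases key with h | h | h
  · refine Or.inr (Or.inr ?_)
    refine add_eq_of_null hs' h (hn _ _) (hn _ _) (hn _ _) ?_ e
    simpa only [hK.symm (σ 3) (σ 2)] using t (σ 3) (σ 2) (σ 4)
  · refine Or.inl ?_
    refine add_eq_of_null (x := v (σ 3)) (by linarith) h (hn _ _) (hn _ _) (hn _ _) ?_ ?_
    · simpa only [hK.symm (σ 4) (σ 3)] using t (σ 4) (σ 3) (σ 2)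
    · rw [hK.symm (σ 3) (σ 2), hK.symm (σ 4) (σ 2)]; linarith
  · refine Or.inr (Or.inl ?_)
    refine add_eq_of_null (x := v (σ 4)) (by linarith) h (hn _ _) (hn _ _) (hn _ _) ?_ ?_
    · simpa only [hK.symm (σ 3) (σ 4)] using t (σ 3) (σ 4) (σ 2)
    · rw [hK.symm (σ 3) (σ 2), hK.symm (σ 4) (σ 2), hK.symm (σ 4) (σ 3)]; linarith

theorem not_null_of_zeros (F : Forkless W) {u v : Fin 5 → ℝ} (hu : ∑ i, u i = 0)
    (hv : ∑ i, v i = 0) (hqu : qform W u = 0) (hqv : qform W v = 0) (hu0 : u ≠ 0) (hv0 : v ≠ 0)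
    {i k l : Fin 5} (hik : i ≠ k) (hil : i ≠ l) (hkl : k ≠ l) (hui : u i = 0) (huk : u k = 0)
    (hvi : v i = 0) (hvl : v l = 0) : False := by
  obtain ⟨σ, rfl, rfl, rfl⟩ := exists_perm_three hik hil hkl (g := ![0, 1, 2]) (by decide)
  have h1 := (F.between_of_null σ hu hqu hu0 hui huk).2
  have e0 : (Equiv.swap (1 : Fin 5) 2) 0 = 0 := by decide
  have h2 := (F.between_of_null (Equiv.swap 1 2 |>.trans σ) hv hqv hv0
    (by rwa [Equiv.trans_apply, e0]) (by simpa using hvl)).2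
  have e3 : (Equiv.swap (1 : Fin 5) 2) 3 = 3 := by decide
  have e4 : (Equiv.swap (1 : Fin 5) 2) 4 = 4 := by decide
  simp only [Equiv.trans_apply, e3, e4, Equiv.swap_apply_right] at h2
  exact F.collinear_unique (by simp) (by simp) (by simp) (by simp) (by simp) (by simp) h1 h2

theorem exists_eq_smul_of_support (F : Forkless W) {u v : Fin 5 → ℝ} (hv : IsCone v)
    (hu : ∑ i, u i = 0) (hqv : qform W v = 0) (hqu : qform W u = 0)
    (hs : ∀ i, v i = 0 → u i = 0) : ∃ t : ℝ, u = t • v := by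
  by_contra! hc
  have hu0 : u ≠ 0 := by simpa using hc 0
  obtain ⟨t, k, hvk, -, hk, hc1, hq1⟩ := F.inK.exists_null_hit hv hqv hu hqu hu0 hs
  have ht : t ≠ 0 := by
    rintro rfl
    simp [hvk] at hk
  have h1 : v + t • u ≠ 0 := fun h => hc (-t⁻¹) <| by
    rw [eq_neg_of_add_eq_zero_left h, smul_neg, neg_smul, neg_neg, inv_smul_smul₀ ht]
  obtain ⟨i, hi⟩ := hv.exists_eq_zero
  have hs1 : ∀ i, v i = 0 → (v + t • u) i = 0 := fun i hi => by simp [hi, hs i hi]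
  have hik : i ≠ k := fun h => hvk (h ▸ hi)
  obtain ⟨s, l, hvl, hl1, hl, hc2, hq2⟩ := F.inK.exists_null_hit hv hqv hc1.1 hq1 h1 hs1
  have hkl : k ≠ l := by
    rintro rfl
    exact hl1 hk
  have hil : i ≠ l := fun h => hvl (h ▸ hi)
  have hk2 : (v + s • (v + t • u)) k = v k := by
    rw [Pi.add_apply, Pi.smul_apply, show (v + t • u) k = 0 from hk]
    simp
  have h2 : v + s • (v + t • u) ≠ 0 := fun h => hvk <| by rw [← hk2, h]; rfl
  exact F.not_null_of_zeros hc1.1 hc2.1 hq1 hq2 h1 h2 hik hil hkl (hs1 i hi) hk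
    (by rw [Pi.add_apply, Pi.smul_apply, hs1 i hi, hi]; simp) hl

theorem exists_eq_smul (F : Forkless W) {u v : Fin 5 → ℝ} (hv : IsCone v) (hu : IsCone u)
    (hqv : qform W v = 0) (hqu : qform W u = 0) (hv0 : v ≠ 0) {i : Fin 5} (hvi : v i = 0)
    (hui : u i = 0) : ∃ t : ℝ, u = t • v := by
  by_cases h1 : ∀ i, v i = 0 → u i = 0
  · exact F.exists_eq_smul_of_support hv hu.1 hqv hqu h1
  by_cases h2 : ∀ i, u i = 0 → v i = 0
  · obtain ⟨t, rfl⟩ := F.exists_eq_smul_of_support hu hv.1 hqu hqv h2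
    have ht : t ≠ 0 := by
      rintro rfl
      simp at hv0
    exact ⟨t⁻¹, (inv_smul_smul₀ ht u).symm⟩
  push Not at h1 h2
  obtain ⟨k, hvk, huk⟩ := h1
  obtain ⟨l, hul, hvl⟩ := h2
  have hik : i ≠ k := fun h => huk (h ▸ hui)
  have hil : i ≠ l := fun h => hvl (h ▸ hvi)
  have hkl : k ≠ l := fun h => hvl (h ▸ hvk)
  exact (F.not_null_of_zeros hv.1 hu.1 hqv hqu hv0 (fun h => huk (by rw [h]; rfl))
    hik hil hkl hvi hvk hui hul).elim

end Forkless

theorem exists_orthogonal (a b c : Fin 5 → ℝ) : ∃ f : Fin 5 → ℝ, (∃ i j, f i ≠ f j) ∧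
    ∑ i, f i * a i = 0 ∧ ∑ i, f i * b i = 0 ∧ ∑ i, f i * c i = 0 := by
  let M : Matrix (Fin 4) (Fin 5) ℝ := ![Pi.single 0 1, a, b, c]
  have hM : LinearMap.ker M.mulVecLin ≠ ⊥ := LinearMap.ker_ne_bot_of_finrank_lt (by simp)
  obtain ⟨f, hf, hf0⟩ := Submodule.exists_mem_ne_zero_of_ne_bot hM
  have hr : ∀ r, ∑ i, f i * M r i = 0 := fun r => by
    have := congrFun (LinearMap.mem_ker.1 hf) r
    simpa [Matrix.mulVec, dotProduct, mul_comm] using this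
  refine ⟨f, ?_, hr 1, hr 2, hr 3⟩
  have h0 : f 0 = 0 := by simpa [M, Pi.single_apply] using hr 0
  obtain ⟨i, hi⟩ := Function.ne_iff.1 hf0
  exact ⟨i, 0, by rwa [h0]⟩

theorem exists_null_of_not_hasPotential {W : Fin 5 → Fin 5 → ℝ} (h : ¬HasPotential W)
    (a b c : Fin 5 → ℝ) : ∃ v, IsCone v ∧ qform W v = 0 ∧
      (∀ t : ℝ, v ≠ t • a) ∧ (∀ t : ℝ, v ≠ t • b) ∧ ∀ t : ℝ, v ≠ t • c := by
  obtain ⟨f, hf, ha, hb, hc⟩ := exists_orthogonal a b c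
  rw [HasPotential] at h
  push Not at h
  obtain ⟨v, hv, hq, hfv⟩ := h f hf
  have aux : ∀ u : Fin 5 → ℝ, ∑ i, f i * u i = 0 → ∀ t : ℝ, v ≠ t • u := by
    rintro u hu t rfl
    refine hfv ?_
    have : ∑ i, f i * (t • u) i = t * ∑ i, f i * u i := by
      rw [Finset.mul_sum]
      exact Finset.sum_congr rfl fun i _ => by simp; ring
    rw [this, hu, mul_zero]
  exact ⟨v, hv, hq, aux a ha, aux b hb, aux c hc⟩

theorem Forkless.hasPotential_or_condNeg {W : Fin 5 → Fin 5 → ℝ} (F : Forkless W) :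
    HasPotential W ∨ CondNeg W := by
  refine or_iff_not_imp_left.2 fun hp => ?_
  have next := exists_null_of_not_hasPotential hp
  obtain ⟨v₀, c₀, q₀, n₀, -, -⟩ := next 0 0 0
  obtain ⟨v₁, c₁, q₁, n₁₀, -, -⟩ := next v₀ v₀ v₀
  obtain ⟨v₂, c₂, q₂, n₂₀, n₂₁, -⟩ := next v₀ v₁ v₁
  obtain ⟨v₃, c₃, q₃, n₃₀, n₃₁, n₃₂⟩ := next v₀ v₁ v₂
  replace n₀ : v₀ ≠ 0 := by simpa using n₀
  have n₁ : v₁ ≠ 0 := by simpa using n₁₀ 0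
  have n₂ : v₂ ≠ 0 := by simpa using n₂₀ 0
  have n₃ : v₃ ≠ 0 := by simpa using n₃₀ 0
  have sep : ∀ {v u : Fin 5 → ℝ}, IsCone v → IsCone u → qform W v = 0 → qform W u = 0 → v ≠ 0 →
      (∀ t : ℝ, u ≠ t • v) → ∀ i, v i = 0 → u i ≠ 0 := by
    intro v u hv hu hqv hqu hv0 hn i hvi hui
    obtain ⟨t, ht⟩ := F.exists_eq_smul hv hu hqv hqu hv0 hvi hui
    exact hn t ht
  have s₀₁ := sep c₀ c₁ q₀ q₁ n₀ n₁₀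
  have s₀₂ := sep c₀ c₂ q₀ q₂ n₀ n₂₀
  have s₀₃ := sep c₀ c₃ q₀ q₃ n₀ n₃₀
  have s₁₂ := sep c₁ c₂ q₁ q₂ n₁ n₂₁
  have s₁₃ := sep c₁ c₃ q₁ q₃ n₁ n₃₁
  have s₂₃ := sep c₂ c₃ q₂ q₃ n₂ n₃₂
  obtain ⟨z₀, z0⟩ := c₀.exists_eq_zero
  obtain ⟨z₁, z1⟩ := c₁.exists_eq_zero
  obtain ⟨z₂, z2⟩ := c₂.exists_eq_zero
  obtain ⟨z₃, z3⟩ := c₃.exists_eq_zero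
  obtain ⟨σ, rfl, rfl, rfl, rfl⟩ := exists_perm_four
    (show z₀ ≠ z₁ by rintro rfl; exact s₀₁ _ z0 z1) (show z₀ ≠ z₂ by rintro rfl; exact s₀₂ _ z0 z2)
    (show z₀ ≠ z₃ by rintro rfl; exact s₀₃ _ z0 z3) (show z₁ ≠ z₂ by rintro rfl; exact s₁₂ _ z1 z2)
    (show z₁ ≠ z₃ by rintro rfl; exact s₁₃ _ z1 z3) (show z₂ ≠ z₃ by rintro rfl; exact s₂₃ _ z2 z3)
  have facet : ∀ {v : Fin 5 → ℝ} (m : Fin 5), IsCone v → qform W v = 0 → v (σ m) = 0 →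
      (∀ n, n ≠ m → v (σ n) ≠ 0) → NullFacet W (σ m) := by
    intro v m hc hq hm hn
    refine ⟨v, hc, hq, hm, fun j hj => ?_⟩
    obtain ⟨n, rfl⟩ := σ.surjective j
    exact hn n fun h => hj (h ▸ rfl)
  have f₀ : v₀ (σ 4) ≠ 0 → NullFacet W (σ 0) := fun h4 => facet 0 c₀ q₀ z0 fun n hn => by
    fin_cases n
    exacts [absurd rfl hn, fun h => s₀₁ _ h z1, fun h => s₀₂ _ h z2, fun h => s₀₃ _ h z3, h4]
  have f₁ : v₁ (σ 4) ≠ 0 → NullFacet W (σ 1) := fun h4 => facet 1 c₁ q₁ z1 fun n hn => by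
    fin_cases n
    exacts [s₀₁ _ z0, absurd rfl hn, fun h => s₁₂ _ h z2, fun h => s₁₃ _ h z3, h4]
  have f₂ : v₂ (σ 4) ≠ 0 → NullFacet W (σ 2) := fun h4 => facet 2 c₂ q₂ z2 fun n hn => by
    fin_cases n
    exacts [s₀₂ _ z0, s₁₂ _ z1, absurd rfl hn, fun h => s₂₃ _ h z3, h4]
  have f₃ : v₃ (σ 4) ≠ 0 → NullFacet W (σ 3) := fun h4 => facet 3 c₃ q₃ z3 fun n hn => by
    fin_cases n
    exacts [s₀₃ _ z0, s₁₃ _ z1, s₂₃ _ z2, absurd rfl hn, h4]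
  have fin := fun {i j k : Fin 5} (hij : i ≠ j) (hik : i ≠ k) (hjk : j ≠ k) hi hj hk =>
    (F.inK.hasPotential_or_condNeg_of_nullFacet F.pos (i := σ i) (j := σ j) (k := σ k)
      (by simpa using hij) (by simpa using hik) (by simpa using hjk) hi hj hk).resolve_left hp
  by_cases h0 : v₀ (σ 4) = 0
  · exact fin (by decide) (by decide) (by decide) (f₁ (s₀₁ _ h0)) (f₂ (s₀₂ _ h0)) (f₃ (s₀₃ _ h0))
  by_cases h1 : v₁ (σ 4) = 0
  · exact fin (by decide) (by decide) (by decide) (f₀ h0) (f₂ (s₁₂ _ h1)) (f₃ (s₁₃ _ h1))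
  by_cases h2 : v₂ (σ 4) = 0
  · exact fin (by decide) (by decide) (by decide) (f₀ h0) (f₁ h1) (f₃ (s₂₃ _ h2))
  · exact fin (by decide) (by decide) (by decide) (f₀ h0) (f₁ h1) (f₂ h2)

theorem qform_line {ι : Type*} [Fintype ι] (f : ι → ℝ) {v : ι → ℝ} (hv : ∑ i, v i = 0) :
    qform (fun i j => (f i - f j) ^ 2) v = (∑ i, f i * v i) ^ 2 := by
  have e : ∑ i, ∑ j, v i * v j * (f i - f j) ^ 2 =
      (∑ i, f i ^ 2 * v i) * (∑ j, v j) + (∑ i, v i) * (∑ j, f j ^ 2 * v j)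
        - 2 * ((∑ i, f i * v i) * ∑ j, f j * v j) := by
    rw [Finset.sum_mul_sum, Finset.sum_mul_sum, Finset.sum_mul_sum]
    simp only [Finset.mul_sum, ← Finset.sum_add_distrib, ← Finset.sum_sub_distrib]
    exact Finset.sum_congr rfl fun i _ => Finset.sum_congr rfl fun j _ => by ring
  rw [qform, bform, e, hv]
  ring

theorem condNeg_line {ι : Type*} [Fintype ι] (f : ι → ℝ) :
    CondNeg fun i j => (f i - f j) ^ 2 :=
  ⟨fun i => by simp, fun i j => by ring, fun v hv => by
    rw [qform_line f hv]
    positivity⟩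

theorem InK.emb {D : Fin 5 → Fin 5 → ℝ} (hD : InK D) : Emb D := by
  refine InK.emb_of_extremal (fun W hW hW0 => ?_) hD
  by_cases hpend : ∃ i j, Pendant W i j
  · exact ⟨W, hW0, hW, Or.inr hpend, fun _ _ h => h⟩
  by_cases hcond : CondNeg W
  · exact ⟨W, hW0, hW, Or.inl hcond, fun _ _ h => h⟩
  push Not at hpend
  have hpot : HasPotential W := by
    by_contra hpot
    refine (Forkless.hasPotential_or_condNeg ⟨hW, fun i j hij =>
      hW.pos_of_not_pendant (hpend i j) hij, fun o i j l hoi hoj hol hij hil hjl h1 h2 => ?_⟩).elim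
      hpot hcond
    exact hpot (hW.hasPotential_of_fork hpend hoi hoj hol hij hil hjl h1 h2)
  obtain ⟨f, ⟨i, j, hij⟩, hf⟩ := hpot
  refine ⟨fun i j => (f i - f j) ^ 2, fun h => ?_, (condNeg_line f).inK, Or.inl (condNeg_line f),
    fun v hv hq => by rw [qform_line f hv.1, hf v hv hq]; ring⟩
  exact hij (sub_eq_zero.1 (pow_eq_zero_iff two_ne_zero |>.1 (congrFun (congrFun h i) j)))

/-- A 5-point metric space satisfying the CAT(0) comparison admits a distance-preserving
map into a geodesic metric space satisfying the CAT(0) comparison. -/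
theorem five_point_cat0_embeds (P : Type*) [MetricSpace P]
    (hcard : Nat.card P = 5) (hP : Cat0Comparison P) :
    ∃ (X : Type) (_ : MetricSpace X), IsGeodesicSpace X ∧ Cat0Comparison X ∧
      ∃ f : P → X, Isometry f := by
  have : Finite P := Nat.finite_of_card_ne_zero (by omega)
  let e : P ≃ Fin 5 := Finite.equivFinOfCardEq hcard
  obtain ⟨X, _, hX, f, hf⟩ := (hP.inK e.symm).emb
  refine ⟨X, _, hX.isGeodesicSpace, hX.box.cat0Comparison, f ∘ e, Isometry.of_dist_eq ?_⟩
  intro x y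
  have : _ = dist (e.symm (e x)) (e.symm (e y)) ^ 2 := hf (e x) (e y)
  rw [e.symm_apply_apply, e.symm_apply_apply] at this
  exact (sq_eq_sq₀ dist_nonneg dist_nonneg).1 this
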